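/- Bott–Taubes degree-2 invariant: for a knot K, define I₂(K) = ∫_{0<x₁<x₂<x₃<x₄<1} g(x₁,x₃)·g(x₂,x₄) dx₁dx₂dx₃dx₄, where g(x,y) = (1/4π)·det(K'(x), K'(y), K(y)−K(x))/‖K(y)−K(x)‖³, and define A(K) as the Lebesgue integral over the open set {(x₁,x₂,x₃,y) : 0<x₁<x₂<x₃<1, y ∈ ℝ³, y ≠ K(x₁), y ≠ K(x₂), y ≠ K(x₃)} of the function obtained by evaluating on the standard ordered basis of ℝ³ × ℝ³ the pullback, under the map h(x₁,x₂,x₃,y) = ((y−K(x₁))/‖y−K(x₁)‖, (y−K(x₂))/‖y−K(x₂)‖, (y−K(x₃))/‖y−K(x₃)‖) into (S²)³, of the 6-form given by the wedge of the pullbacks of ω under the three projections (S²)³ → S². Then for every knot K both integrals converge absolutely, and there is a sign ε ∈ {+1, −1}, independent of K, such that K ↦ I₂(K) + ε·A(K) is a knot invariant. -/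

import Mathlib

open scoped Classical BigOperators Topology

/-- `ℝ³` with its Euclidean norm. -/
abbrev E3 := EuclideanSpace ℝ (Fin 3)

/-- The determinant of the 3×3 matrix with columns `u`, `v`, `w`. -/
def det3 (u v w : E3) : ℝ :=
  u 0 * (v 1 * w 2 - v 2 * w 1) - u 1 * (v 0 * w 2 - v 2 * w 0) +
    u 2 * (v 0 * w 1 - v 1 * w 0)

/-- The cross product on `ℝ³`. -/
noncomputable def cross3 (u v : E3) : E3 :=
  EuclideanSpace.single 0 (u 1 * v 2 - u 2 * v 1) +
  EuclideanSpace.single 1 (u 2 * v 0 - u 0 * v 2) +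
  EuclideanSpace.single 2 (u 0 * v 1 - u 1 * v 0)

/-- A knot: a smooth `1`-periodic map `ℝ → ℝ³` with nowhere-vanishing derivative whose
restriction to `[0,1)` is injective. -/
structure IsKnot (K : ℝ → E3) : Prop where
  smooth : ContDiff ℝ (⊤ : ℕ∞) K
  periodic : Function.Periodic K 1
  injOn : Set.InjOn K (Set.Ico (0 : ℝ) 1)
  deriv_ne : ∀ t, deriv K t ≠ 0

/-- A smooth isotopy between two knots. -/
def KnotIsotopic (K₀ K₁ : ℝ → E3) : Prop :=
  ∃ H : ℝ → ℝ → E3,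
    ContDiff ℝ (⊤ : ℕ∞) (fun p : ℝ × ℝ => H p.1 p.2) ∧
    (∀ t ∈ Set.Icc (0 : ℝ) 1, IsKnot (H t)) ∧
    H 0 = K₀ ∧ H 1 = K₁

/-- A knot invariant: a real-valued function taking equal values on smoothly isotopic
knots. -/
def IsKnotInvariant (V : (ℝ → E3) → ℝ) : Prop :=
  ∀ K₀ K₁ : ℝ → E3, IsKnot K₀ → IsKnot K₁ → KnotIsotopic K₀ K₁ → V K₀ = V K₁

/-- The normalized area `2`-form of `S²` (extended to ambient `ℝ³`):
`ω_u(a, b) = det(u, a, b) / 4π`. -/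
noncomputable def sphereForm (u a b : E3) : ℝ := det3 u a b / (4 * Real.pi)

/-- The Gauss integrand `g(x,y) = (1/4π)·det(K'(x), K'(y), K(y) − K(x)) / ‖K(y) − K(x)‖³`. -/
noncomputable def gaussKernel (K : ℝ → E3) (x y : ℝ) : ℝ :=
  (1 / (4 * Real.pi)) * det3 (deriv K x) (deriv K y) (K y - K x) / ‖K y - K x‖ ^ 3

/-- The open 4-simplex `{0 < x₁ < x₂ < x₃ < x₄ < 1}`. -/
def simplex4 : Set (Fin 4 → ℝ) :=
  {x | 0 < x 0 ∧ x 0 < x 1 ∧ x 1 < x 2 ∧ x 2 < x 3 ∧ x 3 < 1}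

/-- The integrand of `I₂(K)`: `g(x₁,x₃)·g(x₂,x₄)`. -/
noncomputable def I₂Integrand (K : ℝ → E3) (x : Fin 4 → ℝ) : ℝ :=
  gaussKernel K (x 0) (x 2) * gaussKernel K (x 1) (x 3)

/-- `I₂(K) = ∫_{0<x₁<x₂<x₃<x₄<1} g(x₁,x₃)·g(x₂,x₄)`. -/
noncomputable def I₂ (K : ℝ → E3) : ℝ := ∫ x in simplex4, I₂Integrand K x

/-- Evaluation of the wedge `α ∧ β ∧ γ` of three (alternating) `2`-forms on a `6`-tuple
of vectors. -/
noncomputable def wedge3 {V : Type*} (α β γ : V → V → ℝ) (v : Fin 6 → V) : ℝ :=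
  (∑ σ : Equiv.Perm (Fin 6), ((Equiv.Perm.sign σ : ℤ) : ℝ) *
      (α (v (σ 0)) (v (σ 1)) * β (v (σ 2)) (v (σ 3)) * γ (v (σ 4)) (v (σ 5)))) / 8

/-- The map `h(x₁,x₂,x₃,y) = ((y−K(x₁))/‖·‖, (y−K(x₂))/‖·‖, (y−K(x₃))/‖·‖) ∈ (S²)³`. -/
noncomputable def tripodMap (K : ℝ → E3) (z : (Fin 3 → ℝ) × E3) : E3 × E3 × E3 :=
  (‖z.2 - K (z.1 0)‖⁻¹ • (z.2 - K (z.1 0)),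
   ‖z.2 - K (z.1 1)‖⁻¹ • (z.2 - K (z.1 1)),
   ‖z.2 - K (z.1 2)‖⁻¹ • (z.2 - K (z.1 2)))

/-- The standard ordered basis of `ℝ³ × ℝ³`. -/
noncomputable def stdBasis6 (i : Fin 6) : (Fin 3 → ℝ) × E3 :=
  if h : (i : ℕ) < 3 then (Pi.single (⟨(i : ℕ), h⟩ : Fin 3) 1, 0)
  else (0, EuclideanSpace.single (⟨(i : ℕ) - 3, by have := i.isLt; omega⟩ : Fin 3) 1)

/-- The integrand of `A(K)`: the pullback under `h` of the wedge of the pullbacks of the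
normalized area form `ω` under the three projections `(S²)³ → S²`, evaluated on the
standard ordered basis of `ℝ³ × ℝ³`. -/
noncomputable def AIntegrand (K : ℝ → E3) (z : (Fin 3 → ℝ) × E3) : ℝ :=
  wedge3
    (fun A B => sphereForm (tripodMap K z).1 A.1 B.1)
    (fun A B => sphereForm (tripodMap K z).2.1 A.2.1 B.2.1)
    (fun A B => sphereForm (tripodMap K z).2.2 A.2.2 B.2.2)
    (fun i => fderiv ℝ (tripodMap K) z (stdBasis6 i))

/-- The domain of `A(K)`: `{(x₁,x₂,x₃,y) : 0<x₁<x₂<x₃<1, y ≠ K(xᵢ)}`. -/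
def ADomain (K : ℝ → E3) : Set ((Fin 3 → ℝ) × E3) :=
  {z | (0 < z.1 0 ∧ z.1 0 < z.1 1 ∧ z.1 1 < z.1 2 ∧ z.1 2 < 1) ∧
       z.2 ≠ K (z.1 0) ∧ z.2 ≠ K (z.1 1) ∧ z.2 ≠ K (z.1 2)}

/-- `A(K)`, the correction ("anomalous") term. -/
noncomputable def A (K : ℝ → E3) : ℝ := ∫ z in ADomain K, AIntegrand K z

section


/-! ### Vector algebra in `ℝ³` -/

/-- The dot product on `ℝ³` in coordinates. -/
def dot3 (u v : E3) : ℝ := u 0 * v 0 + u 1 * v 1 + u 2 * v 2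

@[simp] lemma cross3_zero' (u v : E3) : cross3 u v 0 = u 1 * v 2 - u 2 * v 1 := by
  simp [cross3]

@[simp] lemma cross3_one' (u v : E3) : cross3 u v 1 = u 2 * v 0 - u 0 * v 2 := by
  simp [cross3]

@[simp] lemma cross3_two' (u v : E3) : cross3 u v 2 = u 0 * v 1 - u 1 * v 0 := by
  simp [cross3]

lemma E3_ext {u v : E3} (h0 : u 0 = v 0) (h1 : u 1 = v 1) (h2 : u 2 = v 2) : u = v := by
  ext i; fin_cases i <;> assumption

lemma dot3_eq_inner (u v : E3) : dot3 u v = inner ℝ u v := by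
  simp [dot3, PiLp.inner_apply, Fin.sum_univ_three]; ring

lemma dot3_self (u : E3) : dot3 u u = ‖u‖ ^ 2 := by
  rw [dot3_eq_inner, real_inner_self_eq_norm_sq]

lemma abs_dot3_le (u v : E3) : |dot3 u v| ≤ ‖u‖ * ‖v‖ := by
  rw [dot3_eq_inner]; exact abs_real_inner_le_norm u v

lemma det3_eq_dot (u v w : E3) : det3 u v w = dot3 u (cross3 v w) := by
  simp [det3, dot3]; ring

lemma norm_cross3_le (u v : E3) : ‖cross3 u v‖ ≤ ‖u‖ * ‖v‖ := by
  have h : ‖cross3 u v‖ ^ 2 ≤ (‖u‖ * ‖v‖) ^ 2 := by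
    rw [mul_pow, ← dot3_self, ← dot3_self, ← dot3_self]
    simp only [dot3, cross3_zero', cross3_one', cross3_two']
    nlinarith [sq_nonneg (u 0 * v 0 + u 1 * v 1 + u 2 * v 2)]
  exact (pow_le_pow_iff_left₀ (norm_nonneg _) (by positivity) two_ne_zero).1 h

lemma abs_det3_le (u v w : E3) : |det3 u v w| ≤ ‖u‖ * ‖v‖ * ‖w‖ := by
  rw [det3_eq_dot]
  calc _ ≤ ‖u‖ * ‖cross3 v w‖ := abs_dot3_le _ _
    _ ≤ ‖u‖ * (‖v‖ * ‖w‖) := by gcongr; exact norm_cross3_le _ _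
    _ = _ := by ring

/-! Derivative rules -/

lemma hasDerivAt_coord {f : ℝ → E3} {f' : E3} {x : ℝ} (h : HasDerivAt f f' x) (i : Fin 3) :
    HasDerivAt (fun s => f s i) (f' i) x := by
  exact (PiLp.hasFDerivAt_apply (𝕜 := ℝ) 2 (f x) i).comp_hasDerivAt x h

lemma hasDerivAt_E3 {f : ℝ → E3} {f' : E3} {x : ℝ}
    (h : ∀ i, HasDerivAt (fun s => f s i) (f' i) x) : HasDerivAt f f' x := by
  have := hasDerivAt_pi.2 h
  exact (PiLp.hasFDerivAt_toLp (𝕜 := ℝ) 2 (fun i => f x i)).comp_hasDerivAt x this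

lemma HasDerivAt.dot3 {f g : ℝ → E3} {f' g' : E3} {x : ℝ} (hf : HasDerivAt f f' x)
    (hg : HasDerivAt g g' x) :
    HasDerivAt (fun s => dot3 (f s) (g s)) (dot3 f' (g x) + dot3 (f x) g') x := by
  have h := (((hasDerivAt_coord hf 0).mul (hasDerivAt_coord hg 0)).add
    ((hasDerivAt_coord hf 1).mul (hasDerivAt_coord hg 1))).add
    ((hasDerivAt_coord hf 2).mul (hasDerivAt_coord hg 2))
  refine h.congr_deriv ?_
  simp only [_root_.dot3]; ring

lemma HasDerivAt.cross3 {f g : ℝ → E3} {f' g' : E3} {x : ℝ} (hf : HasDerivAt f f' x)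
    (hg : HasDerivAt g g' x) :
    HasDerivAt (fun s => cross3 (f s) (g s)) (cross3 f' (g x) + cross3 (f x) g') x := by
  have f0 := hasDerivAt_coord hf 0
  have f1 := hasDerivAt_coord hf 1
  have f2 := hasDerivAt_coord hf 2
  have g0 := hasDerivAt_coord hg 0
  have g1 := hasDerivAt_coord hg 1
  have g2 := hasDerivAt_coord hg 2
  apply hasDerivAt_E3
  intro i
  fin_cases i
  · refine (((f1.mul g2).sub (f2.mul g1)).congr_deriv ?_).congr_of_eventuallyEq ?_
    · simp; ring
    · exact Filter.Eventually.of_forall fun s => by simp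
  · refine (((f2.mul g0).sub (f0.mul g2)).congr_deriv ?_).congr_of_eventuallyEq ?_
    · simp; ring
    · exact Filter.Eventually.of_forall fun s => by simp
  · refine (((f0.mul g1).sub (f1.mul g0)).congr_deriv ?_).congr_of_eventuallyEq ?_
    · simp; ring
    · exact Filter.Eventually.of_forall fun s => by simp

lemma HasDerivAt.det3 {f g k : ℝ → E3} {f' g' k' : E3} {x : ℝ} (hf : HasDerivAt f f' x)
    (hg : HasDerivAt g g' x) (hk : HasDerivAt k k' x) :
    HasDerivAt (fun s => det3 (f s) (g s) (k s))
      (det3 f' (g x) (k x) + det3 (f x) g' (k x) + det3 (f x) (g x) k') x := by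
  have h := hf.dot3 (hg.cross3 hk)
  simp only [det3_eq_dot]
  refine h.congr_deriv ?_
  simp [_root_.dot3]; ring

lemma continuous_coord (i : Fin 3) : Continuous (fun v : E3 => v i) := by fun_prop

lemma Continuous.dot3 {α : Type*} [TopologicalSpace α] {f g : α → E3} (hf : Continuous f)
    (hg : Continuous g) : Continuous (fun s => dot3 (f s) (g s)) := by
  unfold _root_.dot3; fun_prop

lemma Continuous.cross3 {α : Type*} [TopologicalSpace α] {f g : α → E3} (hf : Continuous f)
    (hg : Continuous g) : Continuous (fun s => cross3 (f s) (g s)) := by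
  have : (fun s => _root_.cross3 (f s) (g s)) = fun s =>
      (WithLp.toLp 2 ![f s 1 * g s 2 - f s 2 * g s 1, f s 2 * g s 0 - f s 0 * g s 2,
        f s 0 * g s 1 - f s 1 * g s 0] : E3) := by
    funext s; apply E3_ext <;> simp
  rw [this]
  apply (PiLp.continuous_toLp 2 _).comp
  apply continuous_pi
  intro i
  fin_cases i <;> simp <;> fun_prop

lemma Continuous.det3 {α : Type*} [TopologicalSpace α] {f g k : α → E3} (hf : Continuous f)
    (hg : Continuous g) (hk : Continuous k) :
    Continuous (fun s => det3 (f s) (g s) (k s)) := by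
  unfold _root_.det3; fun_prop

attribute [fun_prop] Continuous.dot3 Continuous.cross3 Continuous.det3

/-! ### Radial kernels -/

/-- The radial vector field `G(v) = φ(|v|²) v`. -/
noncomputable def GK (φ : ℝ → ℝ) (v : E3) : E3 := φ (dot3 v v) • v

/-- Its derivative at `v` in direction `a` (`ψ = φ'`). -/
noncomputable def DGK (φ ψ : ℝ → ℝ) (v a : E3) : E3 :=
  φ (dot3 v v) • a + (2 * ψ (dot3 v v) * dot3 v a) • v

/-- Its divergence. -/
noncomputable def rhoK (φ ψ : ℝ → ℝ) (v : E3) : ℝ :=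
  3 * φ (dot3 v v) + 2 * dot3 v v * ψ (dot3 v v)

lemma hasDerivAt_GK {φ ψ : ℝ → ℝ} (hφ : ∀ s, HasDerivAt φ (ψ s) s) {f : ℝ → E3} {f' : E3} {x : ℝ}
    (hf : HasDerivAt f f' x) : HasDerivAt (fun s => GK φ (f s)) (DGK φ ψ (f x) f') x := by
  have h1 : HasDerivAt (fun s => φ (dot3 (f s) (f s)))
    (ψ (dot3 (f x) (f x)) * (dot3 f' (f x) + dot3 (f x) f')) x :=
    (hφ _).comp x (hf.dot3 hf)
  have h2 := h1.smul hf
  refine h2.congr_deriv ?_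
  unfold DGK
  congr 2
  simp only [dot3]; ring

lemma continuous_GK {φ : ℝ → ℝ} (hφ : Continuous φ) {α : Type*} [TopologicalSpace α] {f : α → E3}
    (hf : Continuous f) : Continuous (fun s => GK φ (f s)) := by
  unfold GK; fun_prop

lemma continuous_DGK {φ ψ : ℝ → ℝ} (hφ : Continuous φ) (hψ : Continuous ψ)
    {α : Type*} [TopologicalSpace α] {f g : α → E3}
    (hf : Continuous f) (hg : Continuous g) : Continuous (fun s => DGK φ ψ (f s) (g s)) := by
  unfold DGK; fun_prop

lemma continuous_rhoK {φ ψ : ℝ → ℝ} (hφ : Continuous φ) (hψ : Continuous ψ)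
    {α : Type*} [TopologicalSpace α] {f : α → E3}
    (hf : Continuous f) : Continuous (fun s => rhoK φ ψ (f s)) := by
  unfold rhoK; fun_prop

end

section

open MeasureTheory Set

/-! ### Smooth families of knots and their partial derivatives -/

/-- Partial derivative in the second (space) variable. -/
noncomputable def pX (F : ℝ → ℝ → E3) (t x : ℝ) : E3 := deriv (F t) x

/-- Partial derivative in the first (time) variable. -/
noncomputable def pT (F : ℝ → ℝ → E3) (t x : ℝ) : E3 := deriv (fun s => F s x) t

/-- Joint smoothness. -/
def Sm (F : ℝ → ℝ → E3) : Prop := ContDiff ℝ (⊤ : ℕ∞) (fun p : ℝ × ℝ => F p.1 p.2)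

lemma Sm.hasFDerivAt {F : ℝ → ℝ → E3} (h : Sm F) (p : ℝ × ℝ) :
    HasFDerivAt (fun p : ℝ × ℝ => F p.1 p.2) (fderiv ℝ (fun p : ℝ × ℝ => F p.1 p.2) p) p :=
  ((h.differentiable (by simp)) p).hasFDerivAt

lemma Sm.hasDerivAt_X' {F : ℝ → ℝ → E3} (h : Sm F) (t x : ℝ) :
    HasDerivAt (F t) (fderiv ℝ (fun p : ℝ × ℝ => F p.1 p.2) (t, x) (0, 1)) x := by
  have h1 : HasDerivAt (fun x : ℝ => (t, x)) ((0 : ℝ), (1 : ℝ)) x :=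
    (hasDerivAt_const x t).prodMk (hasDerivAt_id x)
  exact (h.hasFDerivAt (t, x)).comp_hasDerivAt x h1

lemma Sm.hasDerivAt_T' {F : ℝ → ℝ → E3} (h : Sm F) (t x : ℝ) :
    HasDerivAt (fun s => F s x) (fderiv ℝ (fun p : ℝ × ℝ => F p.1 p.2) (t, x) (1, 0)) t := by
  have h1 : HasDerivAt (fun t : ℝ => (t, x)) ((1 : ℝ), (0 : ℝ)) t :=
    (hasDerivAt_id t).prodMk (hasDerivAt_const t x)
  exact (h.hasFDerivAt (t, x)).comp_hasDerivAt t h1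

lemma Sm.pX_eq {F : ℝ → ℝ → E3} (h : Sm F) (t x : ℝ) :
    pX F t x = fderiv ℝ (fun p : ℝ × ℝ => F p.1 p.2) (t, x) (0, 1) := (h.hasDerivAt_X' t x).deriv

lemma Sm.pT_eq {F : ℝ → ℝ → E3} (h : Sm F) (t x : ℝ) :
    pT F t x = fderiv ℝ (fun p : ℝ × ℝ => F p.1 p.2) (t, x) (1, 0) := (h.hasDerivAt_T' t x).deriv

lemma Sm.dX {F : ℝ → ℝ → E3} (h : Sm F) (t x : ℝ) : HasDerivAt (F t) (pX F t x) x := by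
  rw [h.pX_eq]; exact h.hasDerivAt_X' t x

lemma Sm.dT {F : ℝ → ℝ → E3} (h : Sm F) (t x : ℝ) :
    HasDerivAt (fun s => F s x) (pT F t x) t := by
  rw [h.pT_eq]; exact h.hasDerivAt_T' t x

lemma Sm.smX {F : ℝ → ℝ → E3} (h : Sm F) : Sm (pX F) := by
  have : (fun p : ℝ × ℝ => pX F p.1 p.2) =
      fun p => fderiv ℝ (fun p : ℝ × ℝ => F p.1 p.2) p (0, 1) := by
    funext p; exact h.pX_eq _ _
  unfold Sm; rw [this]
  exact (h.fderiv_right (m := (⊤ : ℕ∞)) (by simp)).clm_apply contDiff_const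

lemma Sm.smT {F : ℝ → ℝ → E3} (h : Sm F) : Sm (pT F) := by
  have : (fun p : ℝ × ℝ => pT F p.1 p.2) =
      fun p => fderiv ℝ (fun p : ℝ × ℝ => F p.1 p.2) p (1, 0) := by
    funext p; exact h.pT_eq _ _
  unfold Sm; rw [this]
  exact (h.fderiv_right (m := (⊤ : ℕ∞)) (by simp)).clm_apply contDiff_const

lemma Sm.cont {F : ℝ → ℝ → E3} (h : Sm F) : Continuous (fun p : ℝ × ℝ => F p.1 p.2) :=
  ContDiff.continuous h

lemma Sm.cont' {F : ℝ → ℝ → E3} (h : Sm F) {α : Type*} [TopologicalSpace α] {f g : α → ℝ}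
    (hf : Continuous f) (hg : Continuous g) : Continuous (fun a => F (f a) (g a)) :=
  h.cont.comp (hf.prodMk hg)

lemma Sm.symm {F : ℝ → ℝ → E3} (h : Sm F) (t x : ℝ) : pX (pT F) t x = pT (pX F) t x := by
  set f := fun p : ℝ × ℝ => F p.1 p.2 with hf
  have hsym : IsSymmSndFDerivAt ℝ f (t, x) := by
    apply ContDiffAt.isSymmSndFDerivAt (n := (⊤ : ℕ∞)) (h.contDiffAt)
    simp only [minSmoothness_of_isRCLikeNormedField]
    exact WithTop.coe_le_coe.2 (le_top : (2 : ℕ∞) ≤ ⊤)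
  have hd : DifferentiableAt ℝ (fderiv ℝ f) (t, x) := by
    have := (h.fderiv_right (m := (⊤ : ℕ∞)) (by simp))
    exact (this.differentiable (by simp)) _
  have e1 : pX (pT F) t x = fderiv ℝ (fderiv ℝ f) (t, x) (0, 1) (1, 0) := by
    rw [h.smT.pX_eq]
    have : (fun p : ℝ × ℝ => pT F p.1 p.2) = fun p => fderiv ℝ f p (1, 0) := by
      funext p; exact h.pT_eq _ _
    rw [this, fderiv_clm_apply hd (by fun_prop)]
    simp
  have e2 : pT (pX F) t x = fderiv ℝ (fderiv ℝ f) (t, x) (1, 0) (0, 1) := by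
    rw [h.smX.pT_eq]
    have : (fun p : ℝ × ℝ => pX F p.1 p.2) = fun p => fderiv ℝ f p (0, 1) := by
      funext p; exact h.pX_eq _ _
    rw [this, fderiv_clm_apply hd (by fun_prop)]
    simp
  rw [e1, e2, hsym.eq]

/-- A smooth family of knots, defined for all times. -/
structure KFam (H : ℝ → ℝ → E3) : Prop where
  sm : Sm H
  knot : ∀ t, IsKnot (H t)

lemma pX_periodic {F : ℝ → ℝ → E3} (h : ∀ t x, F t (x + 1) = F t x) (t x : ℝ) :
    pX F t (x + 1) = pX F t x := by
  unfold pX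
  rw [← deriv_comp_add_const]
  congr 1; funext y; exact h t y

lemma pT_periodic {F : ℝ → ℝ → E3} (h : ∀ t x, F t (x + 1) = F t x) (t x : ℝ) :
    pT F t (x + 1) = pT F t x := by
  unfold pT
  congr 1; funext y; exact h y x

lemma KFam.per {H : ℝ → ℝ → E3} (h : KFam H) (t x : ℝ) : H t (x + 1) = H t x :=
  (h.knot t).periodic x

/-! ### Stokes' theorem on simplices -/

lemma stokes_coord {n : ℕ} (i : Fin (n + 1)) (S : Set (Fin (n + 1) → ℝ)) (S' : Set (Fin n → ℝ))
    (lo up : (Fin n → ℝ) → ℝ)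
    (hS : ∀ (s : ℝ) (r : Fin n → ℝ), (i.insertNth s r : Fin (n+1) → ℝ) ∈ S ↔
      r ∈ S' ∧ lo r < s ∧ s < up r)
    (hle : ∀ r ∈ S', lo r ≤ up r) (hSm : MeasurableSet S) (hSm' : MeasurableSet S')
    (f f' : (Fin (n + 1) → ℝ) → ℝ) (hf' : Continuous f')
    (hd : ∀ (r : Fin n → ℝ) (s : ℝ), HasDerivAt (fun s => f (i.insertNth s r : Fin (n+1) → ℝ))
      (f' (i.insertNth s r : Fin (n+1) → ℝ)) s)
    (hintg : IntegrableOn f' S) :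
    ∫ x in S, f' x = ∫ r in S', (f (i.insertNth (up r) r : Fin (n+1) → ℝ)
      - f (i.insertNth (lo r) r : Fin (n+1) → ℝ)) := by
  have mp := (volume_preserving_piFinSuccAbove (fun _ : Fin (n + 1) => ℝ) i).symm
  rw [← integral_indicator hSm, ← integral_indicator hSm']
  rw [← mp.integral_comp (MeasurableEquiv.measurableEmbedding _)]
  have hint2 := (integrable_indicator_iff hSm).2 hintg
  rw [← mp.integrable_comp_emb (MeasurableEquiv.measurableEmbedding _)] at hint2
  rw [Measure.volume_eq_prod]
  rw [Measure.volume_eq_prod] at hint2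
  have e := integral_prod_symm _ hint2
  simp only [Function.comp_def] at e
  rw [e]
  congr 1
  funext r
  change ∫ s : ℝ, S.indicator f' (i.insertNth s r : Fin (n+1) → ℝ) = _
  by_cases hr : r ∈ S'
  · rw [indicator_of_mem hr]
    have : (fun s : ℝ => S.indicator f' (i.insertNth s r : Fin (n+1) → ℝ)) =
        (Ioo (lo r) (up r)).indicator (fun s => f' (i.insertNth s r : Fin (n+1) → ℝ)) := by
      funext s
      by_cases hs : s ∈ Ioo (lo r) (up r)
      · rw [indicator_of_mem hs, indicator_of_mem ((hS s r).2 ⟨hr, hs.1, hs.2⟩)]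
      · rw [indicator_of_notMem hs, indicator_of_notMem]
        intro h; exact hs ((hS s r).1 h).2
    rw [this]
    rw [integral_indicator measurableSet_Ioo, ← integral_Ioc_eq_integral_Ioo,
      ← intervalIntegral.integral_of_le (hle r hr)]
    apply intervalIntegral.integral_eq_sub_of_hasDerivAt
      (f := fun s => f (i.insertNth s r : Fin (n+1) → ℝ))
    · intro s _; exact hd r s
    · apply Continuous.intervalIntegrable
      exact hf'.comp (by fun_prop)
  · rw [indicator_of_notMem hr]
    rw [← integral_zero ℝ ℝ]
    congr 1; funext s
    rw [indicator_of_notMem]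
    intro h; exact hr ((hS s r).1 h).1

end

section

open MeasureTheory Set

/-- The open 3-simplex. -/
def simplex3 : Set (Fin 3 → ℝ) := {x | 0 < x 0 ∧ x 0 < x 1 ∧ x 1 < x 2 ∧ x 2 < 1}

/-- The open 2-simplex. -/
def simplex2 : Set (Fin 2 → ℝ) := {x | 0 < x 0 ∧ x 0 < x 1 ∧ x 1 < 1}

lemma measurableSet_simplex4 : MeasurableSet simplex4 := by
  unfold simplex4
  measurability

lemma measurableSet_simplex3 : MeasurableSet simplex3 := by
  unfold simplex3
  measurability

lemma measurableSet_simplex2 : MeasurableSet simplex2 := by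
  unfold simplex2
  measurability

lemma simplex4_subset : simplex4 ⊆ Icc (fun _ => 0) (fun _ => 1) := by
  rintro x ⟨h0, h1, h2, h3, h4⟩
  constructor <;> intro i <;> fin_cases i <;> simp <;> linarith

lemma simplex3_subset : simplex3 ⊆ Icc (fun _ => 0) (fun _ => 1) := by
  rintro x ⟨h0, h1, h2, h3⟩
  constructor <;> intro i <;> fin_cases i <;> simp <;> linarith

lemma simplex2_subset : simplex2 ⊆ Icc (fun _ => 0) (fun _ => 1) := by
  rintro x ⟨h0, h1, h2⟩
  constructor <;> intro i <;> fin_cases i <;> simp <;> linarith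

lemma intS4 {f : (Fin 4 → ℝ) → ℝ} (hf : Continuous f) : IntegrableOn f simplex4 :=
  (hf.continuousOn.integrableOn_compact isCompact_Icc).mono_set simplex4_subset

lemma intS3 {f : (Fin 3 → ℝ) → ℝ} (hf : Continuous f) : IntegrableOn f simplex3 :=
  (hf.continuousOn.integrableOn_compact isCompact_Icc).mono_set simplex3_subset

lemma intS2 {f : (Fin 2 → ℝ) → ℝ} (hf : Continuous f) : IntegrableOn f simplex2 :=
  (hf.continuousOn.integrableOn_compact isCompact_Icc).mono_set simplex2_subset

lemma ins4_0 (s : ℝ) (r : Fin 3 → ℝ) :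
    (Fin.insertNth (0 : Fin 4) s r : Fin 4 → ℝ) = ![s, r 0, r 1, r 2] := by
  ext j; fin_cases j <;> rfl
lemma ins4_1 (s : ℝ) (r : Fin 3 → ℝ) :
    (Fin.insertNth (1 : Fin 4) s r : Fin 4 → ℝ) = ![r 0, s, r 1, r 2] := by
  ext j; fin_cases j <;> rfl
lemma ins4_2 (s : ℝ) (r : Fin 3 → ℝ) :
    (Fin.insertNth (2 : Fin 4) s r : Fin 4 → ℝ) = ![r 0, r 1, s, r 2] := by
  ext j; fin_cases j <;> rfl
lemma ins4_3 (s : ℝ) (r : Fin 3 → ℝ) :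
    (Fin.insertNth (3 : Fin 4) s r : Fin 4 → ℝ) = ![r 0, r 1, r 2, s] := by
  ext j; fin_cases j <;> rfl
lemma ins3_0 (s : ℝ) (r : Fin 2 → ℝ) :
    (Fin.insertNth (0 : Fin 3) s r : Fin 3 → ℝ) = ![s, r 0, r 1] := by
  ext j; fin_cases j <;> rfl
lemma ins3_1 (s : ℝ) (r : Fin 2 → ℝ) :
    (Fin.insertNth (1 : Fin 3) s r : Fin 3 → ℝ) = ![r 0, s, r 1] := by
  ext j; fin_cases j <;> rfl
lemma ins3_2 (s : ℝ) (r : Fin 2 → ℝ) :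
    (Fin.insertNth (2 : Fin 3) s r : Fin 3 → ℝ) = ![r 0, r 1, s] := by
  ext j; fin_cases j <;> rfl

lemma stokes4_0 (f f' : (Fin 4 → ℝ) → ℝ) (hf' : Continuous f')
    (hd : ∀ a b c s, HasDerivAt (fun s => f ![s, a, b, c]) (f' ![s, a, b, c]) s) :
    ∫ x in simplex4, f' x =
      ∫ r in simplex3, (f ![r 0, r 0, r 1, r 2] - f ![0, r 0, r 1, r 2]) := by
  have := stokes_coord 0 simplex4 simplex3 (fun _ => 0) (fun r => r 0)
    (by intro s r; rw [ins4_0]; simp [simplex4, simplex3]; constructor <;> intro h <;>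
          refine ⟨?_, ?_, ?_⟩ <;> grind)
    (by rintro r ⟨h, -⟩; exact h.le) measurableSet_simplex4 measurableSet_simplex3 f f' hf'
    (by intro r s; simp only [ins4_0]; exact hd _ _ _ _) (intS4 hf')
  simpa only [ins4_0] using this

lemma stokes4_1 (f f' : (Fin 4 → ℝ) → ℝ) (hf' : Continuous f')
    (hd : ∀ a b c s, HasDerivAt (fun s => f ![a, s, b, c]) (f' ![a, s, b, c]) s) :
    ∫ x in simplex4, f' x =
      ∫ r in simplex3, (f ![r 0, r 1, r 1, r 2] - f ![r 0, r 0, r 1, r 2]) := by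
  have := stokes_coord 1 simplex4 simplex3 (fun r => r 0) (fun r => r 1)
    (by intro s r; rw [ins4_1]; simp [simplex4, simplex3]; constructor <;> intro h <;>
          refine ⟨?_, ?_, ?_⟩ <;> grind)
    (by rintro r ⟨_, h, -⟩; exact h.le) measurableSet_simplex4 measurableSet_simplex3 f f' hf'
    (by intro r s; simp only [ins4_1]; exact hd _ _ _ _) (intS4 hf')
  simpa only [ins4_1] using this

lemma stokes4_2 (f f' : (Fin 4 → ℝ) → ℝ) (hf' : Continuous f')
    (hd : ∀ a b c s, HasDerivAt (fun s => f ![a, b, s, c]) (f' ![a, b, s, c]) s) :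
    ∫ x in simplex4, f' x =
      ∫ r in simplex3, (f ![r 0, r 1, r 2, r 2] - f ![r 0, r 1, r 1, r 2]) := by
  have := stokes_coord 2 simplex4 simplex3 (fun r => r 1) (fun r => r 2)
    (by intro s r; rw [ins4_2]; simp [simplex4, simplex3]; constructor <;> intro h <;>
          refine ⟨?_, ?_, ?_⟩ <;> grind)
    (by rintro r ⟨_, _, h, -⟩; exact h.le) measurableSet_simplex4 measurableSet_simplex3 f f' hf'
    (by intro r s; simp only [ins4_2]; exact hd _ _ _ _) (intS4 hf')
  simpa only [ins4_2] using this

lemma stokes4_3 (f f' : (Fin 4 → ℝ) → ℝ) (hf' : Continuous f')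
    (hd : ∀ a b c s, HasDerivAt (fun s => f ![a, b, c, s]) (f' ![a, b, c, s]) s) :
    ∫ x in simplex4, f' x =
      ∫ r in simplex3, (f ![r 0, r 1, r 2, 1] - f ![r 0, r 1, r 2, r 2]) := by
  have := stokes_coord 3 simplex4 simplex3 (fun r => r 2) (fun _ => 1)
    (by intro s r; rw [ins4_3]; simp [simplex4, simplex3]; constructor <;> intro h <;>
          refine ⟨?_, ?_, ?_⟩ <;> grind)
    (by rintro r ⟨_, _, _, h⟩; exact h.le) measurableSet_simplex4 measurableSet_simplex3 f f' hf'
    (by intro r s; simp only [ins4_3]; exact hd _ _ _ _) (intS4 hf')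
  simpa only [ins4_3] using this

lemma stokes3_0 (f f' : (Fin 3 → ℝ) → ℝ) (hf' : Continuous f')
    (hd : ∀ a b s, HasDerivAt (fun s => f ![s, a, b]) (f' ![s, a, b]) s) :
    ∫ x in simplex3, f' x =
      ∫ r in simplex2, (f ![r 0, r 0, r 1] - f ![0, r 0, r 1]) := by
  have := stokes_coord 0 simplex3 simplex2 (fun _ => 0) (fun r => r 0)
    (by intro s r; rw [ins3_0]; simp [simplex3, simplex2]; constructor <;> intro h <;>
          refine ⟨?_, ?_, ?_⟩ <;> grind)
    (by rintro r ⟨h, -⟩; exact h.le) measurableSet_simplex3 measurableSet_simplex2 f f' hf'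
    (by intro r s; simp only [ins3_0]; exact hd _ _ _) (intS3 hf')
  simpa only [ins3_0] using this

lemma stokes3_1 (f f' : (Fin 3 → ℝ) → ℝ) (hf' : Continuous f')
    (hd : ∀ a b s, HasDerivAt (fun s => f ![a, s, b]) (f' ![a, s, b]) s) :
    ∫ x in simplex3, f' x =
      ∫ r in simplex2, (f ![r 0, r 1, r 1] - f ![r 0, r 0, r 1]) := by
  have := stokes_coord 1 simplex3 simplex2 (fun r => r 0) (fun r => r 1)
    (by intro s r; rw [ins3_1]; simp [simplex3, simplex2]; constructor <;> intro h <;>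
          refine ⟨?_, ?_, ?_⟩ <;> grind)
    (by rintro r ⟨_, h, -⟩; exact h.le) measurableSet_simplex3 measurableSet_simplex2 f f' hf'
    (by intro r s; simp only [ins3_1]; exact hd _ _ _) (intS3 hf')
  simpa only [ins3_1] using this

lemma stokes3_2 (f f' : (Fin 3 → ℝ) → ℝ) (hf' : Continuous f')
    (hd : ∀ a b s, HasDerivAt (fun s => f ![a, b, s]) (f' ![a, b, s]) s) :
    ∫ x in simplex3, f' x =
      ∫ r in simplex2, (f ![r 0, r 1, 1] - f ![r 0, r 1, r 1]) := by
  have := stokes_coord 2 simplex3 simplex2 (fun r => r 1) (fun _ => 1)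
    (by intro s r; rw [ins3_2]; simp [simplex3, simplex2]; constructor <;> intro h <;>
          refine ⟨?_, ?_, ?_⟩ <;> grind)
    (by rintro r ⟨_, _, h⟩; exact h.le) measurableSet_simplex3 measurableSet_simplex2 f f' hf'
    (by intro r s; simp only [ins3_2]; exact hd _ _ _) (intS3 hf')
  simpa only [ins3_2] using this

/-- Differentiation under the integral sign over a subset of a compact set. -/
lemma hasDerivAt_setIntegral_compact {α : Type*} [TopologicalSpace α] [T2Space α]
    [SecondCountableTopology α] [MeasurableSpace α]
    [BorelSpace α] (μ : Measure α) [IsFiniteMeasureOnCompacts μ] {C S : Set α} (hC : IsCompact C)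
    (hS : MeasurableSet S) (hSC : S ⊆ C) (f f' : ℝ → α → ℝ)
    (hf : Continuous (fun p : ℝ × α => f p.1 p.2)) (hf' : Continuous (fun p : ℝ × α => f' p.1 p.2))
    (hd : ∀ t a, HasDerivAt (fun t => f t a) (f' t a) t) (t : ℝ) :
    HasDerivAt (fun t => ∫ a in S, f t a ∂μ) (∫ a in S, f' t a ∂μ) t := by
  have hfin : μ S < ⊤ := (measure_mono hSC).trans_lt hC.measure_lt_top
  have hft : ∀ t, Continuous (f t) := fun t => hf.comp (by fun_prop : Continuous fun a => (t, a))
  have hft' : ∀ t, Continuous (f' t) := fun t => hf'.comp (by fun_prop : Continuous fun a => (t, a))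
  obtain ⟨B, hB⟩ := ((isCompact_Icc (a := t - 1) (b := t + 1)).prod hC).exists_bound_of_continuousOn
    hf'.continuousOn
  refine (hasDerivAt_integral_of_dominated_loc_of_deriv_le (s := Icc (t - 1) (t + 1))
    (bound := fun _ => B) (Icc_mem_nhds (by linarith) (by linarith)) ?_ ?_ ?_ ?_ ?_ ?_).2
  · exact Filter.Eventually.of_forall fun s => (hft s).aestronglyMeasurable
  · exact ((hft t).continuousOn.integrableOn_compact hC).mono_set hSC
  · exact (hft' t).aestronglyMeasurable
  · refine (ae_restrict_iff' hS).2 (Filter.Eventually.of_forall fun a ha s hs => ?_)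
    exact hB (s, a) ⟨hs, hSC ha⟩
  · exact integrableOn_const hfin.ne
  · exact Filter.Eventually.of_forall fun a s _ => hd s a

end

section

open MeasureTheory Set

/-! ### The derivative of the regularised first integral -/

/-- A `C¹` radial profile with its derivative. -/
structure Prof (φ ψ : ℝ → ℝ) : Prop where
  d : ∀ s, HasDerivAt φ (ψ s) s
  cψ : Continuous ψ

lemma Prof.cφ {φ ψ : ℝ → ℝ} (h : Prof φ ψ) : Continuous φ :=
  continuous_iff_continuousAt.2 fun s => (h.d s).continuousAt

/-- Regularised Gauss kernel. -/
noncomputable def gE (φ : ℝ → ℝ) (H : ℝ → ℝ → E3) (t x y : ℝ) : ℝ :=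
  det3 (pX H t x) (pX H t y) (GK φ (H t y - H t x))

/-- Primitive of the variation of the Gauss kernel. -/
noncomputable def pE (φ : ℝ → ℝ) (H : ℝ → ℝ → E3) (t x y : ℝ) : ℝ :=
  det3 (GK φ (H t y - H t x)) (pT H t y - pT H t x) (pX H t y)

/-- Derivative of `pE` in its first variable. -/
noncomputable def p1E (φ ψ : ℝ → ℝ) (H : ℝ → ℝ → E3) (t x y : ℝ) : ℝ :=
  det3 (DGK φ ψ (H t y - H t x) (-pX H t x)) (pT H t y - pT H t x) (pX H t y) +
  det3 (GK φ (H t y - H t x)) (-pX (pT H) t x) (pX H t y)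

/-- Regularisation error. -/
noncomputable def errE (φ ψ : ℝ → ℝ) (H : ℝ → ℝ → E3) (t x y : ℝ) : ℝ :=
  rhoK φ ψ (H t y - H t x) * det3 (pX H t x) (pX H t y) (pT H t y - pT H t x)

section
variable {φ ψ : ℝ → ℝ} {H : ℝ → ℝ → E3} {α : Type*} [TopologicalSpace α] {f g h : α → ℝ}

lemma continuous_gE (P : Prof φ ψ) (S : Sm H) (hf : Continuous f) (hg : Continuous g)
    (hh : Continuous h) : Continuous fun a => gE φ H (f a) (g a) (h a) :=
  (S.smX.cont' hf hg).det3 (S.smX.cont' hf hh)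
    (continuous_GK P.cφ ((S.cont' hf hh).sub (S.cont' hf hg)))

lemma continuous_pE (P : Prof φ ψ) (S : Sm H) (hf : Continuous f) (hg : Continuous g)
    (hh : Continuous h) : Continuous fun a => pE φ H (f a) (g a) (h a) :=
  (continuous_GK P.cφ ((S.cont' hf hh).sub (S.cont' hf hg))).det3
    ((S.smT.cont' hf hh).sub (S.smT.cont' hf hg)) (S.smX.cont' hf hh)

lemma continuous_p1E (P : Prof φ ψ) (S : Sm H) (hf : Continuous f) (hg : Continuous g)
    (hh : Continuous h) : Continuous fun a => p1E φ ψ H (f a) (g a) (h a) :=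
  ((continuous_DGK P.cφ P.cψ ((S.cont' hf hh).sub (S.cont' hf hg)) (S.smX.cont' hf hg).neg).det3
    ((S.smT.cont' hf hh).sub (S.smT.cont' hf hg)) (S.smX.cont' hf hh)).add
  ((continuous_GK P.cφ ((S.cont' hf hh).sub (S.cont' hf hg))).det3
    ((S.smT.smX.cont' hf hg).neg) (S.smX.cont' hf hh))

lemma continuous_errE (P : Prof φ ψ) (S : Sm H) (hf : Continuous f) (hg : Continuous g)
    (hh : Continuous h) : Continuous fun a => errE φ ψ H (f a) (g a) (h a) :=
  (continuous_rhoK P.cφ P.cψ ((S.cont' hf hh).sub (S.cont' hf hg))).mul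
    ((S.smX.cont' hf hg).det3 (S.smX.cont' hf hh) ((S.smT.cont' hf hh).sub (S.smT.cont' hf hg)))
end

lemma dot3_neg_neg (v : E3) : dot3 (-v) (-v) = dot3 v v := by simp [dot3]

lemma GK_neg (φ : ℝ → ℝ) (v : E3) : GK φ (-v) = - GK φ v := by
  simp [GK, dot3_neg_neg]

lemma gE_symm (φ : ℝ → ℝ) (H : ℝ → ℝ → E3) (t x y : ℝ) : gE φ H t x y = gE φ H t y x := by
  unfold gE
  rw [show H t x - H t y = -(H t y - H t x) by abel, GK_neg]
  simp only [det3, PiLp.neg_apply]; ring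

lemma hasDerivAt_pE {φ ψ : ℝ → ℝ} {H : ℝ → ℝ → E3} (P : Prof φ ψ) (S : Sm H) (t x y : ℝ) :
    HasDerivAt (fun x => pE φ H t x y) (p1E φ ψ H t x y) x := by
  have h1 : HasDerivAt (fun x => H t y - H t x) (-pX H t x) x := by
    simpa using (S.dX t x).const_sub (H t y)
  have h2 : HasDerivAt (fun x => pT H t y - pT H t x) (-pX (pT H) t x) x := by
    simpa using (S.smT.dX t x).const_sub (pT H t y)
  refine ((hasDerivAt_GK P.d h1).det3 h2 (hasDerivAt_const x (pX H t y))).congr_deriv ?_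
  unfold p1E
  simp [det3]

lemma trace_id (φ ψ : ℝ → ℝ) (v a b c : E3) :
    det3 (DGK φ ψ v a) b c + det3 a (DGK φ ψ v b) c + det3 a b (DGK φ ψ v c) =
      rhoK φ ψ v * det3 a b c := by
  simp only [DGK, rhoK, det3, dot3, PiLp.add_apply, PiLp.smul_apply, smul_eq_mul]; ring

lemma hasDerivAt_gE {φ ψ : ℝ → ℝ} {H : ℝ → ℝ → E3} (P : Prof φ ψ) (S : Sm H) (t x y : ℝ) :
    HasDerivAt (fun t => gE φ H t x y)
      (-p1E φ ψ H t x y - p1E φ ψ H t y x + errE φ ψ H t x y) t := by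
  refine ((S.smX.dT t x).det3 (S.smX.dT t y)
    (hasDerivAt_GK P.d ((S.dT t y).sub (S.dT t x)))).congr_deriv ?_
  have key := trace_id φ ψ (H t y - H t x) (pX H t x) (pX H t y) (pT H t y - pT H t x)
  unfold p1E errE
  rw [← key, S.symm, S.symm, show H t x - H t y = -(H t y - H t x) by abel, GK_neg]
  simp only [Pi.sub_apply]
  generalize H t y - H t x = v
  simp only [DGK, det3, dot3, PiLp.add_apply, PiLp.smul_apply, PiLp.neg_apply, PiLp.sub_apply,
    smul_eq_mul]
  simp only [neg_mul_neg]
  ring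

/-- The boundary term on a diagonal face. -/
noncomputable def QE (φ : ℝ → ℝ) (H : ℝ → ℝ → E3) (t x y z : ℝ) : ℝ :=
  pE φ H t x y * gE φ H t x z - gE φ H t x y * pE φ H t x z

/-- Regularised first integral. -/
noncomputable def I2E (φ : ℝ → ℝ) (H : ℝ → ℝ → E3) (t : ℝ) : ℝ :=
  ∫ x in simplex4, gE φ H t (x 0) (x 2) * gE φ H t (x 1) (x 3)

lemma continuous_QE {φ ψ : ℝ → ℝ} {H : ℝ → ℝ → E3} {α : Type*} [TopologicalSpace α] {f g h k : α → ℝ}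
    (P : Prof φ ψ) (S : Sm H) (hf : Continuous f) (hg : Continuous g)
    (hh : Continuous h) (hk : Continuous k) :
    Continuous fun a => QE φ H (f a) (g a) (h a) (k a) :=
  ((continuous_pE P S hf hg hh).mul (continuous_gE P S hf hg hk)).sub
    ((continuous_gE P S hf hg hh).mul (continuous_pE P S hf hg hk))

lemma hasDerivAt_I2E {φ ψ : ℝ → ℝ} {H : ℝ → ℝ → E3} (P : Prof φ ψ) (F : KFam H) (t : ℝ) :
    HasDerivAt (I2E φ H)
      (-(∫ r in simplex3, (QE φ H t (r 0) (r 1) (r 2) + QE φ H t (r 1) (r 2) (r 0)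
          + QE φ H t (r 2) (r 0) (r 1))) +
        ∫ x in simplex4, (errE φ ψ H t (x 0) (x 2) * gE φ H t (x 1) (x 3) +
          gE φ H t (x 0) (x 2) * errE φ ψ H t (x 1) (x 3))) t := by
  have S := F.sm
  have c0 : ∀ i : Fin 4, Continuous (fun p : ℝ × (Fin 4 → ℝ) => p.2 i) := fun i => by fun_prop
  have main := hasDerivAt_setIntegral_compact volume (C := Icc (fun _ => 0) (fun _ => 1))
    isCompact_Icc measurableSet_simplex4 simplex4_subset
    (fun t x => gE φ H t (x 0) (x 2) * gE φ H t (x 1) (x 3))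
    (fun t x => (-p1E φ ψ H t (x 0) (x 2) - p1E φ ψ H t (x 2) (x 0) + errE φ ψ H t (x 0) (x 2)) *
        gE φ H t (x 1) (x 3) + gE φ H t (x 0) (x 2) *
        (-p1E φ ψ H t (x 1) (x 3) - p1E φ ψ H t (x 3) (x 1) + errE φ ψ H t (x 1) (x 3)))
    ((continuous_gE P S continuous_fst (c0 0) (c0 2)).mul
      (continuous_gE P S continuous_fst (c0 1) (c0 3)))
    (((((continuous_p1E P S continuous_fst (c0 0) (c0 2)).neg.sub
      (continuous_p1E P S continuous_fst (c0 2) (c0 0))).add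
      (continuous_errE P S continuous_fst (c0 0) (c0 2))).mul
      (continuous_gE P S continuous_fst (c0 1) (c0 3))).add
      ((continuous_gE P S continuous_fst (c0 0) (c0 2)).mul
      (((continuous_p1E P S continuous_fst (c0 1) (c0 3)).neg.sub
      (continuous_p1E P S continuous_fst (c0 3) (c0 1))).add
      (continuous_errE P S continuous_fst (c0 1) (c0 3)))))
    (fun t x => (hasDerivAt_gE P S t _ _).mul (hasDerivAt_gE P S t _ _)) t
  refine main.congr_deriv ?_
  have ca : ∀ i : Fin 4, Continuous (fun x : Fin 4 → ℝ => x i) := fun i => by fun_prop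
  have cg : ∀ i j : Fin 4, Continuous (fun x : Fin 4 → ℝ => gE φ H t (x i) (x j)) :=
    fun i j => continuous_gE P S continuous_const (ca i) (ca j)
  have cp : ∀ i j : Fin 4, Continuous (fun x : Fin 4 → ℝ => p1E φ ψ H t (x i) (x j)) :=
    fun i j => continuous_p1E P S continuous_const (ca i) (ca j)
  have ce : ∀ i j : Fin 4, Continuous (fun x : Fin 4 → ℝ => errE φ ψ H t (x i) (x j)) :=
    fun i j => continuous_errE P S continuous_const (ca i) (ca j)
  have s0 := stokes4_0 (fun x => pE φ H t (x 0) (x 2) * gE φ H t (x 1) (x 3))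
    (fun x => p1E φ ψ H t (x 0) (x 2) * gE φ H t (x 1) (x 3)) ((cp 0 2).mul (cg 1 3))
    (fun a b c s => by simpa using (hasDerivAt_pE P S t s b).mul_const _)
  have s2 := stokes4_2 (fun x => pE φ H t (x 2) (x 0) * gE φ H t (x 1) (x 3))
    (fun x => p1E φ ψ H t (x 2) (x 0) * gE φ H t (x 1) (x 3)) ((cp 2 0).mul (cg 1 3))
    (fun a b c s => by simpa using (hasDerivAt_pE P S t s a).mul_const _)
  have s1 := stokes4_1 (fun x => gE φ H t (x 0) (x 2) * pE φ H t (x 1) (x 3))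
    (fun x => gE φ H t (x 0) (x 2) * p1E φ ψ H t (x 1) (x 3)) ((cg 0 2).mul (cp 1 3))
    (fun a b c s => by simpa using (hasDerivAt_pE P S t s c).const_mul _)
  have s3 := stokes4_3 (fun x => gE φ H t (x 0) (x 2) * pE φ H t (x 3) (x 1))
    (fun x => gE φ H t (x 0) (x 2) * p1E φ ψ H t (x 3) (x 1)) ((cg 0 2).mul (cp 3 1))
    (fun a b c s => by simpa using (hasDerivAt_pE P S t s b).const_mul _)
  have i0 := intS4 ((cp 0 2).mul (cg 1 3))
  have i2 := intS4 ((cp 2 0).mul (cg 1 3))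
  have i1 := intS4 ((cg 0 2).mul (cp 1 3))
  have i3 := intS4 ((cg 0 2).mul (cp 3 1))
  have ie := intS4 (((ce 0 2).mul (cg 1 3)).add ((cg 0 2).mul (ce 1 3)))
  have e1 : (∫ x in simplex4, ((-p1E φ ψ H t (x 0) (x 2) - p1E φ ψ H t (x 2) (x 0) + errE φ ψ H t (x 0) (x 2)) *
        gE φ H t (x 1) (x 3) + gE φ H t (x 0) (x 2) *
        (-p1E φ ψ H t (x 1) (x 3) - p1E φ ψ H t (x 3) (x 1) + errE φ ψ H t (x 1) (x 3)))) =
      -((∫ x in simplex4, p1E φ ψ H t (x 0) (x 2) * gE φ H t (x 1) (x 3)) +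
        (∫ x in simplex4, p1E φ ψ H t (x 2) (x 0) * gE φ H t (x 1) (x 3)) +
        (∫ x in simplex4, gE φ H t (x 0) (x 2) * p1E φ ψ H t (x 1) (x 3)) +
        (∫ x in simplex4, gE φ H t (x 0) (x 2) * p1E φ ψ H t (x 3) (x 1))) +
      ∫ x in simplex4, (errE φ ψ H t (x 0) (x 2) * gE φ H t (x 1) (x 3) +
          gE φ H t (x 0) (x 2) * errE φ ψ H t (x 1) (x 3)) := by
    rw [← integral_add, ← integral_add, ← integral_add, ← integral_neg, ← integral_add]
    · congr 1; funext x; ring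
    · exact (((i0.add i2).add i1).add i3).neg
    · exact ie
    · exact (i0.add i2).add i1
    · exact i3
    · exact i0.add i2
    · exact i1
    · exact i0
    · exact i2
  rw [e1, s0, s1, s2, s3]
  congr 2
  have ca3 : ∀ i : Fin 3, Continuous (fun x : Fin 3 → ℝ => x i) := fun i => by fun_prop
  have cg3 : ∀ {f g : (Fin 3 → ℝ) → ℝ}, Continuous f → Continuous g →
    Continuous (fun x : Fin 3 → ℝ => gE φ H t (f x) (g x)) :=
    fun hf hg => continuous_gE P S continuous_const hf hg
  have cp3 : ∀ {f g : (Fin 3 → ℝ) → ℝ}, Continuous f → Continuous g →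
    Continuous (fun x : Fin 3 → ℝ => pE φ H t (f x) (g x)) :=
    fun hf hg => continuous_pE P S continuous_const hf hg
  simp only [Matrix.cons_val]
  rw [← integral_add, ← integral_add, ← integral_add]
  · congr 1
    funext r
    have hp : pE φ H t 1 (r 1) = pE φ H t 0 (r 1) := by
      unfold pE
      have a1 := F.per t 0
      have a2 := pT_periodic F.per t 0
      rw [zero_add] at a1 a2
      rw [a1, a2]
    unfold QE
    rw [hp, gE_symm φ H t (r 1) (r 0), gE_symm φ H t (r 2) (r 0), gE_symm φ H t (r 2) (r 1)]
    ring
  all_goals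
    apply intS3
    have := cg3 (ca3 0) (ca3 1); have := cg3 (ca3 0) (ca3 2); have := cg3 (ca3 1) (ca3 2)
    have := cp3 (ca3 0) (ca3 1); have := cp3 (ca3 0) (ca3 2); have := cp3 (ca3 1) (ca3 2)
    have := cp3 (ca3 1) (ca3 0); have := cp3 (ca3 2) (ca3 0); have := cp3 (ca3 2) (ca3 1)
    have := cp3 (continuous_const (y := 0)) (ca3 1); have := cp3 (continuous_const (y := 1)) (ca3 1)
    fun_prop

end

section

open MeasureTheory Set

/-! ### Pointwise identities for the second integral -/

/-- `G(y - K(x)) × K'(x)`. -/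
noncomputable def bE (φ : ℝ → ℝ) (H : ℝ → ℝ → E3) (t x : ℝ) (y : E3) : E3 :=
  cross3 (GK φ (y - H t x)) (pX H t x)
/-- `G(y - K(x)) × ∂ₜK(x)`. -/
noncomputable def cE (φ : ℝ → ℝ) (H : ℝ → ℝ → E3) (t x : ℝ) (y : E3) : E3 :=
  cross3 (GK φ (y - H t x)) (pT H t x)
/-- `det(G(y - K(x)), ∂ₜK(x), K'(x))`. -/
noncomputable def lE (φ : ℝ → ℝ) (H : ℝ → ℝ → E3) (t x : ℝ) (y : E3) : ℝ :=
  det3 (GK φ (y - H t x)) (pT H t x) (pX H t x)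

/-- The regularised integrand of the second integral. -/
noncomputable def DE (φ : ℝ → ℝ) (H : ℝ → ℝ → E3) (t u v w : ℝ) (y : E3) : ℝ :=
  det3 (bE φ H t u y) (bE φ H t v y) (bE φ H t w y)

/-- Potential in the `u` direction. -/
noncomputable def SE (φ : ℝ → ℝ) (H : ℝ → ℝ → E3) (t u v w : ℝ) (y : E3) : ℝ :=
  det3 (cE φ H t u y) (bE φ H t v y) (bE φ H t w y)
  - lE φ H t v y * dot3 (GK φ (y - H t u)) (bE φ H t w y)
  + lE φ H t w y * dot3 (GK φ (y - H t u)) (bE φ H t v y)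

/-- Potential vector field in the `y` directions. -/
noncomputable def VE (φ : ℝ → ℝ) (H : ℝ → ℝ → E3) (t u v w : ℝ) (y : E3) : E3 :=
  lE φ H t u y • cross3 (bE φ H t v y) (bE φ H t w y)

/-- Residual factor. -/
noncomputable def WE (φ : ℝ → ℝ) (H : ℝ → ℝ → E3) (t u v w : ℝ) (y : E3) : ℝ :=
  dot3 (pX H t u) (bE φ H t v y) * (dot3 (pT H t u) (bE φ H t w y) + lE φ H t w y)
  - dot3 (pX H t u) (bE φ H t w y) * (dot3 (pT H t u) (bE φ H t v y) + lE φ H t v y)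

/-- `∂ₜ bE`. -/
noncomputable def btE (φ ψ : ℝ → ℝ) (H : ℝ → ℝ → E3) (t x : ℝ) (y : E3) : E3 :=
  cross3 (DGK φ ψ (y - H t x) (-pT H t x)) (pX H t x) + cross3 (GK φ (y - H t x)) (pT (pX H) t x)

/-- `∂ₓ cE`. -/
noncomputable def cxE (φ ψ : ℝ → ℝ) (H : ℝ → ℝ → E3) (t x : ℝ) (y : E3) : E3 :=
  cross3 (DGK φ ψ (y - H t x) (-pX H t x)) (pT H t x) + cross3 (GK φ (y - H t x)) (pX (pT H) t x)

/-- `∂ᵤ SE`. -/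
noncomputable def SxE (φ ψ : ℝ → ℝ) (H : ℝ → ℝ → E3) (t u v w : ℝ) (y : E3) : ℝ :=
  det3 (cxE φ ψ H t u y) (bE φ H t v y) (bE φ H t w y)
  - lE φ H t v y * dot3 (DGK φ ψ (y - H t u) (-pX H t u)) (bE φ H t w y)
  + lE φ H t w y * dot3 (DGK φ ψ (y - H t u) (-pX H t u)) (bE φ H t v y)

/-- divergence of `VE`. -/
noncomputable def dvE (φ ψ : ℝ → ℝ) (H : ℝ → ℝ → E3) (t u v w : ℝ) (y : E3) : ℝ :=
  dot3 (DGK φ ψ (y - H t u) (cross3 (pT H t u) (pX H t u))) (cross3 (bE φ H t v y) (bE φ H t w y))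
  + lE φ H t u y * (dot3 (DGK φ ψ (y - H t v) (pX H t v) - rhoK φ ψ (y - H t v) • pX H t v)
        (bE φ H t w y)
      - dot3 (DGK φ ψ (y - H t w) (pX H t w) - rhoK φ ψ (y - H t w) • pX H t w)
        (bE φ H t v y))

lemma cross_trace (φ ψ : ℝ → ℝ) (v X T : E3) :
    cross3 (DGK φ ψ v (-T)) X = cross3 (DGK φ ψ v (-X)) T + rhoK φ ψ v • cross3 X T +
      DGK φ ψ v (cross3 T X) := by
  apply E3_ext <;>
  simp only [DGK, rhoK, dot3, PiLp.add_apply, PiLp.smul_apply, PiLp.neg_apply, smul_eq_mul,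
    cross3_zero', cross3_one', cross3_two'] <;> ring

lemma DGK_neg (φ ψ : ℝ → ℝ) (v a : E3) : DGK φ ψ v (-a) = - DGK φ ψ v a := by
  apply E3_ext <;>
  simp only [DGK, dot3, PiLp.add_apply, PiLp.smul_apply, PiLp.neg_apply, smul_eq_mul] <;> ring

lemma btE_eq {H : ℝ → ℝ → E3} (S : Sm H) (φ ψ : ℝ → ℝ) (t x : ℝ) (y : E3) :
    btE φ ψ H t x y = cxE φ ψ H t x y + rhoK φ ψ (y - H t x) • cross3 (pX H t x) (pT H t x)
      + DGK φ ψ (y - H t x) (cross3 (pT H t x) (pX H t x)) := by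
  unfold btE cxE
  rw [cross_trace, S.symm]
  abel

/-- The key pointwise identity. -/
lemma key_id {H : ℝ → ℝ → E3} (S : Sm H) (φ ψ : ℝ → ℝ) (t u v w : ℝ) (y : E3) :
    det3 (btE φ ψ H t u y) (bE φ H t v y) (bE φ H t w y)
    + det3 (bE φ H t u y) (btE φ ψ H t v y) (bE φ H t w y)
    + det3 (bE φ H t u y) (bE φ H t v y) (btE φ ψ H t w y) =
    (SxE φ ψ H t u v w y + SxE φ ψ H t v w u y + SxE φ ψ H t w u v y)
    + (dvE φ ψ H t u v w y + dvE φ ψ H t v w u y + dvE φ ψ H t w u v y)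
    + (rhoK φ ψ (y - H t u) * WE φ H t u v w y + rhoK φ ψ (y - H t v) * WE φ H t v w u y
      + rhoK φ ψ (y - H t w) * WE φ H t w u v y) := by
  rw [btE_eq S, btE_eq S, btE_eq S]
  unfold SxE dvE WE
  simp only [DGK_neg]
  generalize bE φ H t u y = b1
  generalize bE φ H t v y = b2
  generalize bE φ H t w y = b3
  generalize cxE φ ψ H t u y = c1
  generalize cxE φ ψ H t v y = c2
  generalize cxE φ ψ H t w y = c3
  generalize lE φ H t u y = l1
  generalize lE φ H t v y = l2
  generalize lE φ H t w y = l3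
  generalize DGK φ ψ (y - H t u) (cross3 (pT H t u) (pX H t u)) = d1
  generalize DGK φ ψ (y - H t v) (cross3 (pT H t v) (pX H t v)) = d2
  generalize DGK φ ψ (y - H t w) (cross3 (pT H t w) (pX H t w)) = d3
  generalize DGK φ ψ (y - H t u) (pX H t u) = e1
  generalize DGK φ ψ (y - H t v) (pX H t v) = e2
  generalize DGK φ ψ (y - H t w) (pX H t w) = e3
  generalize rhoK φ ψ (y - H t u) = r1
  generalize rhoK φ ψ (y - H t v) = r2
  generalize rhoK φ ψ (y - H t w) = r3
  simp only [det3, dot3, PiLp.add_apply, PiLp.sub_apply, PiLp.smul_apply, PiLp.neg_apply,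
    smul_eq_mul, cross3_zero', cross3_one', cross3_two']
  ring

lemma SE_diag1 (φ : ℝ → ℝ) (H : ℝ → ℝ → E3) (t a b : ℝ) (y : E3) : SE φ H t a a b y = 0 := by
  unfold SE cE lE
  generalize bE φ H t b y = b3
  unfold bE
  simp only [det3, dot3, cross3_zero', cross3_one', cross3_two']
  ring

lemma SE_diag2 (φ : ℝ → ℝ) (H : ℝ → ℝ → E3) (t a b : ℝ) (y : E3) : SE φ H t a b a y = 0 := by
  unfold SE cE lE
  generalize bE φ H t b y = b3
  unfold bE
  simp only [det3, dot3, cross3_zero', cross3_one', cross3_two']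
  ring

lemma WE_at (φ : ℝ → ℝ) (H : ℝ → ℝ → E3) (t u v w : ℝ) :
    WE φ H t u v w (H t u) = QE φ H t u v w := by
  unfold WE QE pE gE lE bE
  rw [show H t v - H t u = -(H t u - H t v) by abel, show H t w - H t u = -(H t u - H t w) by abel,
    GK_neg, GK_neg]
  simp only [det3, dot3, PiLp.sub_apply, PiLp.neg_apply, cross3_zero', cross3_one', cross3_two']
  ring

/-! Derivatives -/

section
variable {φ ψ : ℝ → ℝ} {H : ℝ → ℝ → E3}

lemma hasDerivAt_bE_t (P : Prof φ ψ) (S : Sm H) (t x : ℝ) (y : E3) :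
    HasDerivAt (fun t => bE φ H t x y) (btE φ ψ H t x y) t := by
  have h1 : HasDerivAt (fun t => y - H t x) (-pT H t x) t := by
    simpa using (S.dT t x).const_sub y
  exact (hasDerivAt_GK P.d h1).cross3 (S.smX.dT t x)

lemma hasDerivAt_DE (P : Prof φ ψ) (S : Sm H) (t u v w : ℝ) (y : E3) :
    HasDerivAt (fun t => DE φ H t u v w y)
    ((SxE φ ψ H t u v w y + SxE φ ψ H t v w u y + SxE φ ψ H t w u v y)
    + (dvE φ ψ H t u v w y + dvE φ ψ H t v w u y + dvE φ ψ H t w u v y)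
    + (rhoK φ ψ (y - H t u) * WE φ H t u v w y + rhoK φ ψ (y - H t v) * WE φ H t v w u y
      + rhoK φ ψ (y - H t w) * WE φ H t w u v y)) t := by
  rw [← key_id S]
  exact (hasDerivAt_bE_t P S t u y).det3 (hasDerivAt_bE_t P S t v y) (hasDerivAt_bE_t P S t w y)

lemma hasDerivAt_SE (P : Prof φ ψ) (S : Sm H) (t u v w : ℝ) (y : E3) :
    HasDerivAt (fun u => SE φ H t u v w y) (SxE φ ψ H t u v w y) u := by
  have h1 : HasDerivAt (fun x => y - H t x) (-pX H t u) u := by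
    simpa using (S.dX t u).const_sub y
  have hG := hasDerivAt_GK P.d h1
  have hc : HasDerivAt (fun u => cE φ H t u y) (cxE φ ψ H t u y) u := hG.cross3 (S.smT.dX t u)
  have hb2 := hasDerivAt_const u (bE φ H t v y)
  have hb3 := hasDerivAt_const u (bE φ H t w y)
  refine (((hc.det3 hb2 hb3).sub ((hG.dot3 hb3).const_mul (lE φ H t v y))).add
    ((hG.dot3 hb2).const_mul (lE φ H t w y))).congr_deriv ?_
  unfold SxE
  simp only [det3, dot3, PiLp.zero_apply]
  ring

/-- Derivative of `VE` in direction `a`. -/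
noncomputable def VaE (φ ψ : ℝ → ℝ) (H : ℝ → ℝ → E3) (t u v w : ℝ) (y a : E3) : E3 :=
  det3 (DGK φ ψ (y - H t u) a) (pT H t u) (pX H t u) • cross3 (bE φ H t v y) (bE φ H t w y)
  + lE φ H t u y • (cross3 (cross3 (DGK φ ψ (y - H t v) a) (pX H t v)) (bE φ H t w y)
     + cross3 (bE φ H t v y) (cross3 (DGK φ ψ (y - H t w) a) (pX H t w)))

lemma hasDerivAt_VE (P : Prof φ ψ) (t u v w : ℝ) (y a : E3) :
    HasDerivAt (fun s : ℝ => VE φ H t u v w (y + s • a)) (VaE φ ψ H t u v w y a) 0 := by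
  have h1 : ∀ x, HasDerivAt (fun s : ℝ => y + s • a - H t x) a 0 := fun x => by
    simpa using (((hasDerivAt_id (0:ℝ)).smul_const a).const_add y).sub_const (H t x)
  have hG := fun x => hasDerivAt_GK P.d (h1 x)
  have hl : HasDerivAt (fun s : ℝ => lE φ H t u (y + s • a)) _ 0 :=
    (hG u).det3 (hasDerivAt_const _ _) (hasDerivAt_const _ _)
  have hb : ∀ x, HasDerivAt (fun s : ℝ => bE φ H t x (y + s • a)) _ 0 := fun x =>
    (hG x).cross3 (hasDerivAt_const _ _)
  refine (hl.smul ((hb v).cross3 (hb w))).congr_deriv ?_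
  unfold VaE
  simp only [zero_smul, add_zero]
  apply E3_ext <;>
  simp only [det3, PiLp.add_apply, PiLp.smul_apply, smul_eq_mul, PiLp.zero_apply,
    cross3_zero', cross3_one', cross3_two'] <;> ring

/-- standard basis vector -/
noncomputable def ee (i : Fin 3) : E3 := EuclideanSpace.single i 1

lemma div_aux1 (φ ψ : ℝ → ℝ) (v T X b : E3) :
    det3 (DGK φ ψ v (ee 0)) T X * b 0 + det3 (DGK φ ψ v (ee 1)) T X * b 1
    + det3 (DGK φ ψ v (ee 2)) T X * b 2 = dot3 (DGK φ ψ v (cross3 T X)) b := by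
  simp [det3, dot3, DGK, ee]
  ring

lemma div_aux2 (φ ψ : ℝ → ℝ) (v X b : E3) :
    cross3 (cross3 (DGK φ ψ v (ee 0)) X) b 0 + cross3 (cross3 (DGK φ ψ v (ee 1)) X) b 1
    + cross3 (cross3 (DGK φ ψ v (ee 2)) X) b 2 = dot3 (DGK φ ψ v X - rhoK φ ψ v • X) b := by
  simp [dot3, DGK, ee, rhoK]
  ring

lemma div_VE (φ ψ : ℝ → ℝ) (H : ℝ → ℝ → E3) (t u v w : ℝ) (y : E3) :
    VaE φ ψ H t u v w y (ee 0) 0 + VaE φ ψ H t u v w y (ee 1) 1 + VaE φ ψ H t u v w y (ee 2) 2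
      = dvE φ ψ H t u v w y := by
  unfold dvE
  rw [← div_aux1, ← div_aux2, ← div_aux2]
  unfold VaE
  generalize bE φ H t v y = b2
  generalize bE φ H t w y = b3
  simp only [PiLp.add_apply, PiLp.smul_apply, smul_eq_mul, cross3_zero', cross3_one', cross3_two']
  ring

variable {α : Type*} [TopologicalSpace α] {f g h k : α → ℝ} {y a : α → E3}

lemma continuous_bE (P : Prof φ ψ) (S : Sm H) (hf : Continuous f) (hg : Continuous g)
    (hy : Continuous y) : Continuous fun a => bE φ H (f a) (g a) (y a) :=
  (continuous_GK P.cφ (hy.sub (S.cont' hf hg))).cross3 (S.smX.cont' hf hg)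

lemma continuous_lE (P : Prof φ ψ) (S : Sm H) (hf : Continuous f) (hg : Continuous g)
    (hy : Continuous y) : Continuous fun a => lE φ H (f a) (g a) (y a) :=
  (continuous_GK P.cφ (hy.sub (S.cont' hf hg))).det3 (S.smT.cont' hf hg) (S.smX.cont' hf hg)

lemma continuous_cxE (P : Prof φ ψ) (S : Sm H) (hf : Continuous f) (hg : Continuous g)
    (hy : Continuous y) : Continuous fun a => cxE φ ψ H (f a) (g a) (y a) :=
  ((continuous_DGK P.cφ P.cψ (hy.sub (S.cont' hf hg)) (S.smX.cont' hf hg).neg).cross3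
    (S.smT.cont' hf hg)).add
    ((continuous_GK P.cφ (hy.sub (S.cont' hf hg))).cross3 (S.smT.smX.cont' hf hg))

lemma continuous_rE (P : Prof φ ψ) (S : Sm H) (hf : Continuous f) (hg : Continuous g)
    (hy : Continuous y) : Continuous fun a => rhoK φ ψ (y a - H (f a) (g a)) :=
  continuous_rhoK P.cφ P.cψ (hy.sub (S.cont' hf hg))

lemma continuous_DE (P : Prof φ ψ) (S : Sm H) (hf : Continuous f) (hg : Continuous g)
    (hh : Continuous h) (hk : Continuous k) (hy : Continuous y) :
    Continuous fun a => DE φ H (f a) (g a) (h a) (k a) (y a) :=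
  (continuous_bE P S hf hg hy).det3 (continuous_bE P S hf hh hy) (continuous_bE P S hf hk hy)

lemma continuous_WE (P : Prof φ ψ) (S : Sm H) (hf : Continuous f) (hg : Continuous g)
    (hh : Continuous h) (hk : Continuous k) (hy : Continuous y) :
    Continuous fun a => WE φ H (f a) (g a) (h a) (k a) (y a) := by
  have h1 := continuous_bE P S hf hh hy
  have h2 := continuous_bE P S hf hk hy
  have h3 := continuous_lE P S hf hh hy
  have h4 := continuous_lE P S hf hk hy
  have h5 := S.smX.cont' hf hg
  have h6 := S.smT.cont' hf hg
  unfold WE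
  fun_prop

lemma continuous_VE (P : Prof φ ψ) (S : Sm H) (hf : Continuous f) (hg : Continuous g)
    (hh : Continuous h) (hk : Continuous k) (hy : Continuous y) :
    Continuous fun a => VE φ H (f a) (g a) (h a) (k a) (y a) := by
  have h1 := continuous_bE P S hf hh hy
  have h2 := continuous_bE P S hf hk hy
  have h3 := continuous_lE P S hf hg hy
  unfold VE
  fun_prop

lemma continuous_VaE (P : Prof φ ψ) (S : Sm H) (hf : Continuous f) (hg : Continuous g)
    (hh : Continuous h) (hk : Continuous k) (hy : Continuous y) (ha : Continuous a) :
    Continuous fun z => VaE φ ψ H (f z) (g z) (h z) (k z) (y z) (a z) := by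
  have h1 := continuous_bE P S hf hh hy
  have h2 := continuous_bE P S hf hk hy
  have h3 := continuous_lE P S hf hg hy
  have h4 := S.smX.cont' hf hg
  have h5 := S.smT.cont' hf hg
  have h8 := S.smX.cont' hf hh
  have h9 := S.smX.cont' hf hk
  have h6 := continuous_DGK P.cφ P.cψ (hy.sub (S.cont' hf hg)) ha
  have h7 := continuous_DGK P.cφ P.cψ (hy.sub (S.cont' hf hh)) ha
  have h10 := continuous_DGK P.cφ P.cψ (hy.sub (S.cont' hf hk)) ha
  unfold VaE
  fun_prop

lemma continuous_dvE (P : Prof φ ψ) (S : Sm H) (hf : Continuous f) (hg : Continuous g)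
    (hh : Continuous h) (hk : Continuous k) (hy : Continuous y) :
    Continuous fun z => dvE φ ψ H (f z) (g z) (h z) (k z) (y z) := by
  simp only [← div_VE]
  have h0 := fun i => (continuous_coord i).comp (continuous_VaE P S hf hg hh hk hy (continuous_const (y := ee i)))
  exact ((h0 0).add (h0 1)).add (h0 2)

lemma continuous_SxE (P : Prof φ ψ) (S : Sm H) (hf : Continuous f) (hg : Continuous g)
    (hh : Continuous h) (hk : Continuous k) (hy : Continuous y) :
    Continuous fun z => SxE φ ψ H (f z) (g z) (h z) (k z) (y z) := by
  have h0 := continuous_cxE P S hf hg hy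
  have h1 := continuous_bE P S hf hh hy
  have h2 := continuous_bE P S hf hk hy
  have h3 := continuous_lE P S hf hh hy
  have h4 := continuous_lE P S hf hk hy
  have h6 := continuous_DGK P.cφ P.cψ (hy.sub (S.cont' hf hg)) (S.smX.cont' hf hg).neg
  unfold SxE
  fun_prop
end

end

section

open MeasureTheory Set

/-! ### The derivative of the regularised second integral -/

lemma integral_add3 {α : Type*} [MeasurableSpace α] {μ : Measure α} {f g h : α → ℝ}
    (hf : Integrable f μ) (hg : Integrable g μ) (hh : Integrable h μ) :
    ∫ x, (f x + g x + h x) ∂μ = ∫ x, f x ∂μ + ∫ x, g x ∂μ + ∫ x, h x ∂μ := by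
  rw [← integral_add hf hg]
  exact integral_add (hf.add hg) hh

/-- Radial cutoff profile. -/
structure Cut (c c' : ℝ → ℝ) (R : ℝ) : Prop where
  prof : Prof c c'
  hR : 0 ≤ R
  z : ∀ s, R ^ 2 ≤ s → c s = 0
  z' : ∀ s, R ^ 2 ≤ s → c' s = 0

/-- Domain of integration of the cut-off integral. -/
def dom (R : ℝ) : Set ((Fin 3 → ℝ) × E3) := simplex3 ×ˢ Metric.closedBall (0 : E3) R

lemma measurableSet_dom (R : ℝ) : MeasurableSet (dom R) :=
  measurableSet_simplex3.prod Metric.isClosed_closedBall.measurableSet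

lemma dom_subset (R : ℝ) : dom R ⊆ (Icc (fun _ => 0) (fun _ => 1)) ×ˢ Metric.closedBall (0 : E3) R :=
  prod_mono simplex3_subset le_rfl

lemma isCompact_dom (R : ℝ) : IsCompact ((Icc (fun _ => 0) (fun _ => 1) : Set (Fin 3 → ℝ)) ×ˢ
    Metric.closedBall (0 : E3) R) := isCompact_Icc.prod (isCompact_closedBall _ _)

lemma intDom {R : ℝ} {f : (Fin 3 → ℝ) × E3 → ℝ} (hf : Continuous f) : IntegrableOn f (dom R) :=
  (hf.continuousOn.integrableOn_compact (isCompact_dom R)).mono_set (dom_subset R)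

lemma integral_dom {R : ℝ} {f : (Fin 3 → ℝ) × E3 → ℝ} (hf : Continuous f) :
    ∫ z in dom R, f z = ∫ x in simplex3, ∫ y in Metric.closedBall (0 : E3) R, f (x, y) := by
  have := intDom (R := R) hf
  rw [Measure.volume_eq_prod] at this ⊢
  exact setIntegral_prod f this

lemma integral_dom_symm {R : ℝ} {f : (Fin 3 → ℝ) × E3 → ℝ} (hf : Continuous f) :
    ∫ z in dom R, f z = ∫ y in Metric.closedBall (0 : E3) R, ∫ x in simplex3, f (x, y) := by
  have := intDom (R := R) hf
  rw [Measure.volume_eq_prod, IntegrableOn, dom, ← Measure.prod_restrict] at this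
  rw [Measure.volume_eq_prod, dom, ← Measure.prod_restrict]
  exact integral_prod_symm f this

section
variable {φ ψ c c' : ℝ → ℝ} {R : ℝ} {H : ℝ → ℝ → E3}

lemma sterm (P : Prof φ ψ) (F : KFam H) (t : ℝ) (y : E3) :
    ∫ x in simplex3, (SxE φ ψ H t (x 0) (x 1) (x 2) y + SxE φ ψ H t (x 1) (x 2) (x 0) y
      + SxE φ ψ H t (x 2) (x 0) (x 1) y) = 0 := by
  have S := F.sm
  have ca : ∀ i : Fin 3, Continuous (fun x : Fin 3 → ℝ => x i) := fun i => by fun_prop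
  have cS : ∀ i j k : Fin 3, Continuous (fun x : Fin 3 → ℝ => SxE φ ψ H t (x i) (x j) (x k) y) :=
    fun i j k => continuous_SxE P S continuous_const (ca i) (ca j) (ca k) continuous_const
  have s0 := stokes3_0 (fun x => SE φ H t (x 0) (x 1) (x 2) y) _ (cS 0 1 2)
    (fun a b s => by simpa using hasDerivAt_SE P S t s a b y)
  have s1 := stokes3_1 (fun x => SE φ H t (x 1) (x 2) (x 0) y) _ (cS 1 2 0)
    (fun a b s => by simpa using hasDerivAt_SE P S t s b a y)
  have s2 := stokes3_2 (fun x => SE φ H t (x 2) (x 0) (x 1) y) _ (cS 2 0 1)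
    (fun a b s => by simpa using hasDerivAt_SE P S t s a b y)
  simp only [Matrix.cons_val, SE_diag1, SE_diag2, zero_sub, sub_zero] at s0 s1 s2
  rw [integral_add, integral_add, s0, s1, s2]
  · have : ∀ r : Fin 2 → ℝ, SE φ H t 1 (r 0) (r 1) y = SE φ H t 0 (r 0) (r 1) y := by
      intro r
      have a1 := F.per t 0
      have a2 := pT_periodic F.per t 0
      rw [zero_add] at a1 a2
      unfold SE cE
      rw [a1, a2]
    simp only [this, integral_neg, integral_zero]
    ring
  · exact intS3 (cS 0 1 2)
  · exact intS3 (cS 1 2 0)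
  · exact intS3 ((cS 0 1 2).add (cS 1 2 0))
  · exact intS3 (cS 2 0 1)

lemma Cut.eq_zero (C : Cut c c' R) {y : E3} (hy : y ∉ Metric.closedBall (0 : E3) R) :
    c (dot3 y y) = 0 ∧ c' (dot3 y y) = 0 := by
  have : R ^ 2 ≤ dot3 y y := by
    rw [dot3_self]
    have : R < ‖y‖ := by simpa using hy
    have := C.hR
    gcongr
  exact ⟨C.z _ this, C.z' _ this⟩

lemma integral_ball_eq {f : E3 → ℝ} (hf : ∀ y ∉ Metric.closedBall (0 : E3) R, f y = 0) :
    ∫ y in Metric.closedBall (0 : E3) R, f y = ∫ y, f y :=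
  setIntegral_eq_integral_of_forall_compl_eq_zero hf

lemma integrable_of_ball {f : E3 → ℝ} (hc : Continuous f)
    (hf : ∀ y ∉ Metric.closedBall (0 : E3) R, f y = 0) : Integrable f :=
  hc.integrable_of_hasCompactSupport (HasCompactSupport.intro (isCompact_closedBall _ _) hf)

lemma dvterm_y (P : Prof φ ψ) (F : KFam H) (C : Cut c c' R) (t u v w : ℝ) :
    ∫ y in Metric.closedBall (0 : E3) R, c (dot3 y y) * dvE φ ψ H t u v w y =
    ∫ y in Metric.closedBall (0 : E3) R, -(2 * c' (dot3 y y) * dot3 y (VE φ H t u v w y)) := by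
  have S := F.sm
  have cc := C.prof.cφ
  have cc' := C.prof.cψ
  rw [integral_ball_eq, integral_ball_eq]
  rotate_left
  · intro y hy; simp [(C.eq_zero hy).2]
  · intro y hy; simp [(C.eq_zero hy).1]
  have cV : Continuous (fun y => VE φ H t u v w y) := continuous_VE P S continuous_const
    continuous_const continuous_const continuous_const continuous_id
  have cVa : ∀ i, Continuous (fun y => VaE φ ψ H t u v w y (ee i)) := fun i =>
    continuous_VaE P S continuous_const
      continuous_const continuous_const continuous_const continuous_id continuous_const
  have cVi : ∀ i, Continuous (fun y => (VE φ H t u v w y) i) := fun i => (continuous_coord i).comp cV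
  have cd : Continuous (fun y : E3 => c (dot3 y y)) := by fun_prop
  have cd' : Continuous (fun y : E3 => c' (dot3 y y)) := by fun_prop
  have i1 : ∀ i : Fin 3, Integrable (fun y => (2 * c' (dot3 y y) * y i) * (VE φ H t u v w y) i) :=
    fun i => integrable_of_ball (R := R) (((continuous_const.mul cd').mul (continuous_coord i)).mul (cVi i)) (fun y hy => by simp [(C.eq_zero hy).2])
  have i2 : ∀ i : Fin 3, Integrable (fun y => c (dot3 y y) * (VaE φ ψ H t u v w y (ee i)) i) :=
    fun i => integrable_of_ball (R := R) (by have := cVa i; fun_prop)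
      (fun y hy => by simp [(C.eq_zero hy).1])
  have i3 : ∀ i : Fin 3, Integrable (fun y => c (dot3 y y) * (VE φ H t u v w y) i) :=
    fun i => integrable_of_ball (R := R) (cd.mul (cVi i)) (fun y hy => by simp [(C.eq_zero hy).1])
  have key : ∀ i : Fin 3, ∫ y, c (dot3 y y) * (VaE φ ψ H t u v w y (ee i)) i =
      - ∫ y, (2 * c' (dot3 y y) * y i) * (VE φ H t u v w y) i := by
    intro i
    refine integral_bilinear_hasLineDerivAt_right_eq_neg_left_of_integrable
      (B := ContinuousLinearMap.mul ℝ ℝ) (v := ee i) (i1 i) (i2 i) (i3 i) ?_ ?_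
    · intro y _
      have h1 : HasDerivAt (fun s : ℝ => y + s • ee i) (ee i) 0 := by
        simpa using (((hasDerivAt_id (0:ℝ)).smul_const (ee i)).const_add y)
      have := (C.prof.d _).comp (0:ℝ) (h1.dot3 h1)
      refine HasDerivAt.congr_deriv this ?_
      simp only [zero_smul, add_zero]
      fin_cases i <;> simp [dot3, ee] <;> ring
    · intro y _
      exact hasDerivAt_coord (hasDerivAt_VE P t u v w y (ee i)) i
  simp only [← div_VE, mul_add]
  have e : ∫ y, (c (dot3 y y) * (VaE φ ψ H t u v w y (ee 0)) 0 + c (dot3 y y) * (VaE φ ψ H t u v w y (ee 1)) 1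
      + c (dot3 y y) * (VaE φ ψ H t u v w y (ee 2)) 2) = 
      (∫ y, c (dot3 y y) * (VaE φ ψ H t u v w y (ee 0)) 0) +
      (∫ y, c (dot3 y y) * (VaE φ ψ H t u v w y (ee 1)) 1) +
      (∫ y, c (dot3 y y) * (VaE φ ψ H t u v w y (ee 2)) 2) := by
    rw [← integral_add (i2 0) (i2 1)]
    exact integral_add ((i2 0).add (i2 1)) (i2 2)
  have e' : (∫ y, (2 * c' (dot3 y y) * y 0) * (VE φ H t u v w y) 0) +
      (∫ y, (2 * c' (dot3 y y) * y 1) * (VE φ H t u v w y) 1) +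
      (∫ y, (2 * c' (dot3 y y) * y 2) * (VE φ H t u v w y) 2) =
      ∫ y, ((2 * c' (dot3 y y) * y 0) * (VE φ H t u v w y) 0 +
        (2 * c' (dot3 y y) * y 1) * (VE φ H t u v w y) 1 +
        (2 * c' (dot3 y y) * y 2) * (VE φ H t u v w y) 2) := by
    rw [← integral_add (i1 0) (i1 1)]
    exact (integral_add ((i1 0).add (i1 1)) (i1 2)).symm
  rw [e, key, key, key, ← neg_add, ← neg_add, e', integral_neg]
  congr 2
  funext y
  simp only [dot3]
  ring

lemma dvterm (P : Prof φ ψ) (F : KFam H) (C : Cut c c' R) (t : ℝ) (i j k : Fin 3) :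
    ∫ z in dom R, c (dot3 z.2 z.2) * dvE φ ψ H t (z.1 i) (z.1 j) (z.1 k) z.2 =
    -∫ z in dom R, 2 * c' (dot3 z.2 z.2) * dot3 z.2 (VE φ H t (z.1 i) (z.1 j) (z.1 k) z.2) := by
  have S := F.sm
  have cc := C.prof.cφ
  have cc' := C.prof.cψ
  have ca : ∀ i : Fin 3, Continuous (fun x : (Fin 3 → ℝ) × E3 => x.1 i) := fun i => by fun_prop
  have c1 := continuous_dvE P S (f := fun _ => t) continuous_const (ca i) (ca j) (ca k) continuous_snd
  have c2 := continuous_VE P S (f := fun _ => t) continuous_const (ca i) (ca j) (ca k) continuous_snd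
  rw [← integral_neg, integral_dom (by fun_prop), integral_dom (by fun_prop)]
  congr 1
  funext x
  exact dvterm_y P F C t _ _ _

lemma rterm (P : Prof φ ψ) (F : KFam H) (C : Cut c c' R) (t : ℝ)
    (hρ : ∀ x w, rhoK φ ψ w ≠ 0 → H t x + w ∈ Metric.closedBall (0 : E3) R ∧
      c (dot3 (H t x + w) (H t x + w)) = 1) (i j k : Fin 3) :
    ∫ z in dom R, c (dot3 z.2 z.2) * (rhoK φ ψ (z.2 - H t (z.1 i)) *
      WE φ H t (z.1 i) (z.1 j) (z.1 k) z.2) =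
    ∫ x in simplex3, ∫ w, rhoK φ ψ w * WE φ H t (x i) (x j) (x k) (H t (x i) + w) ∧
    IntegrableOn (fun x => ∫ w, rhoK φ ψ w * WE φ H t (x i) (x j) (x k) (H t (x i) + w)) simplex3 := by
  have S := F.sm
  have cc := C.prof.cφ
  have ca : ∀ i : Fin 3, Continuous (fun x : (Fin 3 → ℝ) × E3 => x.1 i) := fun i => by fun_prop
  have c1 := continuous_WE P S (f := fun _ => t) continuous_const (ca i) (ca j) (ca k) continuous_snd
  have c2 := continuous_rE P S (f := fun _ => t) continuous_const (ca i) continuous_snd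
  have cF : Continuous (fun z : (Fin 3 → ℝ) × E3 => c (dot3 z.2 z.2) * (rhoK φ ψ (z.2 - H t (z.1 i)) *
      WE φ H t (z.1 i) (z.1 j) (z.1 k) z.2)) := by fun_prop
  have inner : ∀ x : Fin 3 → ℝ, ∫ y in Metric.closedBall (0 : E3) R, c (dot3 y y) * (rhoK φ ψ (y - H t (x i)) *
      WE φ H t (x i) (x j) (x k) y) =
      ∫ w, rhoK φ ψ w * WE φ H t (x i) (x j) (x k) (H t (x i) + w) := by
    intro x
    rw [integral_ball_eq (fun y hy => by simp [(C.eq_zero hy).1])]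
    rw [← integral_add_left_eq_self _ (H t (x i))]
    congr 1
    funext w
    rw [add_sub_cancel_left]
    by_cases h : rhoK φ ψ w = 0
    · simp [h]
    · rw [(hρ _ _ h).2, one_mul]
  constructor
  · rw [integral_dom cF]
    congr 1
    funext x
    exact inner x
  · have := intDom (R := R) cF
    rw [Measure.volume_eq_prod, IntegrableOn, dom, ← Measure.prod_restrict] at this
    have h2 := this.integral_prod_left
    simp only [inner] at h2
    exact h2

/-- The cut-off regularised second integral. -/
noncomputable def ZA (φ c : ℝ → ℝ) (R : ℝ) (H : ℝ → ℝ → E3) (t : ℝ) : ℝ :=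
  ∫ z in dom R, c (dot3 z.2 z.2) * DE φ H t (z.1 0) (z.1 1) (z.1 2) z.2

/-- The error from the failure of `ρ` to be a delta function. -/
noncomputable def E2E (φ ψ : ℝ → ℝ) (H : ℝ → ℝ → E3) (t u v w : ℝ) : ℝ :=
  (∫ a, rhoK φ ψ a * WE φ H t u v w (H t u + a)) - QE φ H t u v w

lemma split7 (hcc : Continuous c) (a b1 b2 b3 d1 d2 d3 : (Fin 3 → ℝ) × E3 → ℝ) (ha : Continuous a)
      (hb1 : Continuous b1) (hb2 : Continuous b2) (hb3 : Continuous b3) (hd1 : Continuous d1)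
      (hd2 : Continuous d2) (hd3 : Continuous d3) :
      ∫ z in dom R, c (dot3 z.2 z.2) * (a z + (b1 z + b2 z + b3 z) + (d1 z + d2 z + d3 z)) =
      (∫ z in dom R, c (dot3 z.2 z.2) * a z) +
      ((∫ z in dom R, c (dot3 z.2 z.2) * b1 z) + (∫ z in dom R, c (dot3 z.2 z.2) * b2 z) +
        (∫ z in dom R, c (dot3 z.2 z.2) * b3 z)) +
      ((∫ z in dom R, c (dot3 z.2 z.2) * d1 z) + (∫ z in dom R, c (dot3 z.2 z.2) * d2 z) +
        (∫ z in dom R, c (dot3 z.2 z.2) * d3 z)) := by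
  have h : ∀ f : (Fin 3 → ℝ) × E3 → ℝ, Continuous f →
      IntegrableOn (fun z => c (dot3 z.2 z.2) * f z) (dom R) := fun f hf => intDom (by fun_prop)
  rw [← integral_add3 (h _ hb1) (h _ hb2) (h _ hb3), ← integral_add3 (h _ hd1) (h _ hd2) (h _ hd3)]
  refine Eq.trans ?_ (integral_add3 (h _ ha) (((h _ hb1).add (h _ hb2)).add (h _ hb3))
      (((h _ hd1).add (h _ hd2)).add (h _ hd3)))
  congr 1; funext z; ring

set_option maxHeartbeats 400000 in
lemma hasDerivAt_Z (P : Prof φ ψ) (F : KFam H) (C : Cut c c' R) (t : ℝ)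
    (hρ : ∀ x w, rhoK φ ψ w ≠ 0 → H t x + w ∈ Metric.closedBall (0 : E3) R ∧
      c (dot3 (H t x + w) (H t x + w)) = 1) :
    HasDerivAt (fun t => I2E φ H t + ZA φ c R H t)
      ((∫ x in simplex4, (errE φ ψ H t (x 0) (x 2) * gE φ H t (x 1) (x 3) +
          gE φ H t (x 0) (x 2) * errE φ ψ H t (x 1) (x 3))) +
       (∫ x in simplex3, (E2E φ ψ H t (x 0) (x 1) (x 2) + E2E φ ψ H t (x 1) (x 2) (x 0) +
          E2E φ ψ H t (x 2) (x 0) (x 1))) -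
       ∫ z in dom R, 2 * c' (dot3 z.2 z.2) * dot3 z.2 (VE φ H t (z.1 0) (z.1 1) (z.1 2) z.2
         + VE φ H t (z.1 1) (z.1 2) (z.1 0) z.2 + VE φ H t (z.1 2) (z.1 0) (z.1 1) z.2)) t := by
  have S := F.sm
  have cc := C.prof.cφ
  have cc' := C.prof.cψ
  have ca : ∀ i : Fin 3, Continuous (fun p : ℝ × ((Fin 3 → ℝ) × E3) => p.2.1 i) := fun i => by fun_prop
  have cy : Continuous (fun p : ℝ × ((Fin 3 → ℝ) × E3) => p.2.2) := by fun_prop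
  have cD := continuous_DE P S continuous_fst (ca 0) (ca 1) (ca 2) cy
  have cS := fun i j k => continuous_SxE P S continuous_fst (ca i) (ca j) (ca k) cy
  have cdv := fun i j k => continuous_dvE P S continuous_fst (ca i) (ca j) (ca k) cy
  have cW := fun i j k => continuous_WE P S continuous_fst (ca i) (ca j) (ca k) cy
  have cr := fun i => continuous_rE P S continuous_fst (ca i) cy
  have main := hasDerivAt_setIntegral_compact volume (C := (Icc (fun _ => 0) (fun _ => 1) : Set (Fin 3 → ℝ)) ×ˢ
    Metric.closedBall (0 : E3) R) (isCompact_dom R) (measurableSet_dom R) (dom_subset R)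
    (fun t z => c (dot3 z.2 z.2) * DE φ H t (z.1 0) (z.1 1) (z.1 2) z.2)
    (fun t z => c (dot3 z.2 z.2) *
    ((SxE φ ψ H t (z.1 0) (z.1 1) (z.1 2) z.2 + SxE φ ψ H t (z.1 1) (z.1 2) (z.1 0) z.2
      + SxE φ ψ H t (z.1 2) (z.1 0) (z.1 1) z.2)
    + (dvE φ ψ H t (z.1 0) (z.1 1) (z.1 2) z.2 + dvE φ ψ H t (z.1 1) (z.1 2) (z.1 0) z.2
      + dvE φ ψ H t (z.1 2) (z.1 0) (z.1 1) z.2)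
    + (rhoK φ ψ (z.2 - H t (z.1 0)) * WE φ H t (z.1 0) (z.1 1) (z.1 2) z.2
      + rhoK φ ψ (z.2 - H t (z.1 1)) * WE φ H t (z.1 1) (z.1 2) (z.1 0) z.2
      + rhoK φ ψ (z.2 - H t (z.1 2)) * WE φ H t (z.1 2) (z.1 0) (z.1 1) z.2)))
    (by fun_prop)
    (by
      have := cS 0 1 2; have := cS 1 2 0; have := cS 2 0 1
      have := cdv 0 1 2; have := cdv 1 2 0; have := cdv 2 0 1
      have := cW 0 1 2; have := cW 1 2 0; have := cW 2 0 1
      have := cr 0; have := cr 1; have := cr 2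
      fun_prop)
    (fun t z => (hasDerivAt_DE P S t _ _ _ _).const_mul _) t
  have main2 : HasDerivAt (ZA φ c R H) _ t := main
  have hI := hasDerivAt_I2E P F t
  refine HasDerivAt.congr_deriv (HasDerivAt.add hI main2) ?_
  clear main main2 hI
  have cz : ∀ i : Fin 3, Continuous (fun z : (Fin 3 → ℝ) × E3 => z.1 i) := fun i => by fun_prop
  have kS : ∀ i j k : Fin 3, Continuous fun z : (Fin 3 → ℝ) × E3 => SxE φ ψ H t (z.1 i) (z.1 j) (z.1 k) z.2 :=
    fun i j k => continuous_SxE P S continuous_const (cz i) (cz j) (cz k) continuous_snd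
  have kd : ∀ i j k : Fin 3, Continuous fun z : (Fin 3 → ℝ) × E3 => dvE φ ψ H t (z.1 i) (z.1 j) (z.1 k) z.2 :=
    fun i j k => continuous_dvE P S continuous_const (cz i) (cz j) (cz k) continuous_snd
  have kW : ∀ i j k : Fin 3, Continuous fun z : (Fin 3 → ℝ) × E3 => rhoK φ ψ (z.2 - H t (z.1 i)) * WE φ H t (z.1 i) (z.1 j) (z.1 k) z.2 :=
    fun i j k => (continuous_rE P S continuous_const (cz i) continuous_snd).mul
      (continuous_WE P S continuous_const (cz i) (cz j) (cz k) continuous_snd)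
  have kV : ∀ i j k : Fin 3, Continuous fun z : (Fin 3 → ℝ) × E3 => VE φ H t (z.1 i) (z.1 j) (z.1 k) z.2 :=
    fun i j k => continuous_VE P S continuous_const (cz i) (cz j) (cz k) continuous_snd
  have hS0 : ∫ z in dom R, c (dot3 z.2 z.2) * (SxE φ ψ H t (z.1 0) (z.1 1) (z.1 2) z.2 + SxE φ ψ H t (z.1 1) (z.1 2) (z.1 0) z.2
      + SxE φ ψ H t (z.1 2) (z.1 0) (z.1 1) z.2) = 0 := by
    rw [integral_dom_symm]
    · simp only [integral_const_mul, sterm P F, mul_zero, integral_zero]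
    · have := kS 0 1 2; have := kS 1 2 0; have := kS 2 0 1
      fun_prop
  obtain ⟨r0, j0⟩ := rterm P F C t hρ 0 1 2
  obtain ⟨r1, j1⟩ := rterm P F C t hρ 1 2 0
  obtain ⟨r2, j2⟩ := rterm P F C t hρ 2 0 1
  rw [split7 cc (fun z => SxE φ ψ H t (z.1 0) (z.1 1) (z.1 2) z.2 + SxE φ ψ H t (z.1 1) (z.1 2) (z.1 0) z.2
      + SxE φ ψ H t (z.1 2) (z.1 0) (z.1 1) z.2) _ _ _ _ _ _ (((kS 0 1 2).add (kS 1 2 0)).add (kS 2 0 1))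
      (kd 0 1 2) (kd 1 2 0) (kd 2 0 1) (kW 0 1 2) (kW 1 2 0) (kW 2 0 1), hS0,
      dvterm P F C, dvterm P F C, dvterm P F C, r0, r1, r2]
  have hV : (∫ z in dom R, 2 * c' (dot3 z.2 z.2) * dot3 z.2 (VE φ H t (z.1 0) (z.1 1) (z.1 2) z.2
         + VE φ H t (z.1 1) (z.1 2) (z.1 0) z.2 + VE φ H t (z.1 2) (z.1 0) (z.1 1) z.2)) =
      (∫ z in dom R, 2 * c' (dot3 z.2 z.2) * dot3 z.2 (VE φ H t (z.1 0) (z.1 1) (z.1 2) z.2))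
      + (∫ z in dom R, 2 * c' (dot3 z.2 z.2) * dot3 z.2 (VE φ H t (z.1 1) (z.1 2) (z.1 0) z.2))
      + (∫ z in dom R, 2 * c' (dot3 z.2 z.2) * dot3 z.2 (VE φ H t (z.1 2) (z.1 0) (z.1 1) z.2)) := by
    have h1 := kV 0 1 2; have h2 := kV 1 2 0; have h3 := kV 2 0 1
    rw [← integral_add, ← integral_add]
    · congr 1; funext z; simp only [dot3, PiLp.add_apply]; ring
    all_goals exact intDom (by fun_prop)
  have cax : ∀ i : Fin 3, Continuous (fun x : Fin 3 → ℝ => x i) := fun i => by fun_prop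
  have cQ : ∀ i j k : Fin 3, IntegrableOn (fun x : Fin 3 → ℝ => QE φ H t (x i) (x j) (x k)) simplex3 :=
    fun i j k => intS3 (continuous_QE P S continuous_const (cax i) (cax j) (cax k))
  have hE : (∫ x in simplex3, (E2E φ ψ H t (x 0) (x 1) (x 2) + E2E φ ψ H t (x 1) (x 2) (x 0) +
          E2E φ ψ H t (x 2) (x 0) (x 1))) =
      ((∫ x in simplex3, ∫ w, rhoK φ ψ w * WE φ H t (x 0) (x 1) (x 2) (H t (x 0) + w)) +
      (∫ x in simplex3, ∫ w, rhoK φ ψ w * WE φ H t (x 1) (x 2) (x 0) (H t (x 1) + w)) +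
      (∫ x in simplex3, ∫ w, rhoK φ ψ w * WE φ H t (x 2) (x 0) (x 1) (H t (x 2) + w))) -
      ∫ r in simplex3, (QE φ H t (r 0) (r 1) (r 2) + QE φ H t (r 1) (r 2) (r 0)
          + QE φ H t (r 2) (r 0) (r 1)) := by
    rw [← integral_add3 j0 j1 j2, ← integral_sub]
    · congr 1; funext x; unfold E2E; ring
    · exact (j0.add j1).add j2
    · exact ((cQ 0 1 2).add (cQ 1 2 0)).add (cQ 2 0 1)
  rw [hV, hE]
  ring
end

end

section

open MeasureTheory Set

/-! ### The explicit regularised kernel -/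

/-- Basic profile. -/
noncomputable def f0 (s : ℝ) : ℝ := if s ≤ 1 then 5 / 2 - 3 / 2 * s else s ^ (-(3/2) : ℝ)
/-- Its derivative. -/
noncomputable def f1 (s : ℝ) : ℝ := if s ≤ 1 then -(3 / 2) else -(3/2) * s ^ (-(5/2) : ℝ)

lemma prof0 : Prof f0 f1 := by
  have hpow : ∀ s : ℝ, 0 < s → HasDerivAt (fun s : ℝ => s ^ (-(3/2) : ℝ)) (-(3/2) * s ^ (-(5/2) : ℝ)) s := by
    intro s hs
    have := Real.hasDerivAt_rpow_const (x := s) (p := -(3/2)) (Or.inl hs.ne')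
    convert this using 2; norm_num
  have hlin : ∀ s : ℝ, HasDerivAt (fun s : ℝ => 5 / 2 - 3 / 2 * s) (-(3/2)) s := by
    intro s
    have := ((hasDerivAt_id s).const_mul (3/2 : ℝ)).const_sub (5/2)
    simpa using this
  constructor
  · intro s
    rcases lt_trichotomy s 1 with h | h | h
    · have e : f1 s = -(3/2) := by simp [f1, h.le]
      rw [e]
      refine (hlin s).congr_of_eventuallyEq ?_
      filter_upwards [Iio_mem_nhds h] with y hy
      simp [f0, (le_of_lt (Set.mem_Iio.1 hy) : y ≤ 1)]
    · subst h
      have e : f1 1 = -(3/2) := by simp [f1]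
      rw [e, ← hasDerivWithinAt_univ, ← Iic_union_Ici (a := (1:ℝ))]
      refine HasDerivWithinAt.union ?_ ?_
      · refine (hlin 1).hasDerivWithinAt.congr ?_ ?_
        · intro y hy
          have hy' : y ≤ 1 := hy
          simp [f0, hy']
        · simp [f0]
      · have := hpow 1 one_pos
        simp only [Real.one_rpow, mul_one] at this
        refine this.hasDerivWithinAt.congr ?_ ?_
        · intro y hy
          rcases eq_or_lt_of_le (Set.mem_Ici.1 hy) with h | h
          · rw [← h]; simp [f0]; norm_num
          · simp [f0, not_le.2 h]
        · simp [f0]; norm_num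
    · have e : f1 s = -(3/2) * s ^ (-(5/2) : ℝ) := by simp [f1, not_le.2 h]
      rw [e]
      refine (hpow s (by linarith)).congr_of_eventuallyEq ?_
      filter_upwards [Ioi_mem_nhds h] with y hy
      simp [f0, not_le.2 (Set.mem_Ioi.1 hy)]
  · unfold f1
    refine continuous_if_le continuous_id continuous_const continuousOn_const ?_ ?_
    · intro s hs
      have h1 : (1:ℝ) ≤ s := hs
      have : s ≠ 0 := by linarith
      exact (continuousAt_const.mul (Real.continuousAt_rpow_const _ _ (Or.inl this))).continuousWithinAt
    · intro s hs; 
      have h1 : s = 1 := hs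
      simp [h1]

lemma rpow_32 {r : ℝ} (hr : 0 < r) : (r ^ 2) ^ (-(3/2) : ℝ) = (r ^ 3)⁻¹ := by
  rw [← Real.rpow_natCast r 2, ← Real.rpow_mul hr.le, ← Real.rpow_natCast r 3, ← Real.rpow_neg hr.le]
  norm_num

lemma rpow_52 {r : ℝ} (hr : 0 < r) : (r ^ 2) ^ (-(5/2) : ℝ) = (r ^ 5)⁻¹ := by
  rw [← Real.rpow_natCast r 2, ← Real.rpow_mul hr.le, ← Real.rpow_natCast r 5, ← Real.rpow_neg hr.le]
  norm_num

lemma f0_large {r : ℝ} (hr : 1 < r) : f0 (r ^ 2) = (r ^ 3)⁻¹ := by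
  have h : ¬ r ^ 2 ≤ 1 := by nlinarith
  rw [f0, if_neg h, rpow_32 (by linarith)]

lemma f1_large {r : ℝ} (hr : 1 < r) : f1 (r ^ 2) = -(3/2) * (r ^ 5)⁻¹ := by
  have h : ¬ r ^ 2 ≤ 1 := by nlinarith
  rw [f1, if_neg h, rpow_52 (by linarith)]

lemma f0_small {r : ℝ} (h0 : 0 ≤ r) (hr : r ≤ 1) : f0 (r ^ 2) = 5/2 - 3/2 * r^2 := by
  have h : r ^ 2 ≤ 1 := by nlinarith
  rw [f0, if_pos h]

lemma f1_small {r : ℝ} (h0 : 0 ≤ r) (hr : r ≤ 1) : f1 (r ^ 2) = -(3/2) := by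
  have h : r ^ 2 ≤ 1 := by nlinarith
  rw [f1, if_pos h]

lemma f0_nonneg {r : ℝ} (h0 : 0 ≤ r) : 0 ≤ f0 (r ^ 2) := by
  rcases le_or_gt r 1 with h | h
  · rw [f0_small h0 h]; nlinarith
  · rw [f0_large h]; positivity

lemma f0_le_inv {r : ℝ} (h0 : 0 < r) : f0 (r ^ 2) ≤ (r ^ 3)⁻¹ := by
  rcases le_or_gt r 1 with h | h
  · rw [f0_small h0.le h, ← one_div, le_div_iff₀ (by positivity)]
    have : (1 - r)^2 * (1 + 2 * r + 3 * r^2 + 3/2 * r^3) ≥ 0 := by positivity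
    nlinarith [this]
  · rw [f0_large h]

lemma f0_le {r : ℝ} (h0 : 0 ≤ r) : f0 (r ^ 2) ≤ 20 / (1 + r) ^ 3 := by
  rw [le_div_iff₀ (by positivity)]
  rcases le_or_gt r 1 with h | h
  · rw [f0_small h0 h]
    have : (1 + r)^3 ≤ 2 ^ 3 := by gcongr; linarith
    have h2 : 5/2 - 3/2 * r^2 ≤ 5/2 := by nlinarith
    calc _ ≤ 5/2 * (1+r)^3 := by gcongr
      _ ≤ 5/2 * 2^3 := by gcongr
      _ ≤ 20 := by norm_num
  · rw [f0_large h, inv_mul_le_iff₀ (by positivity)]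
    calc (1 + r)^3 ≤ (2 * r)^3 := by gcongr; linarith
      _ = r ^ 3 * 8 := by ring
      _ ≤ r ^ 3 * 20 := by gcongr; norm_num

lemma f1_le {r : ℝ} (h0 : 0 ≤ r) : |f1 (r ^ 2) * (2 * r)| ≤ 48 / (1 + r) ^ 4 := by
  rw [le_div_iff₀ (by positivity)]
  rcases le_or_gt r 1 with h | h
  · rw [f1_small h0 h]
    have : (1 + r)^4 ≤ 2 ^ 4 := by gcongr; linarith
    have e : |-(3/2) * (2 * r)| = 3 * r := by
      rw [abs_of_nonpos (by nlinarith)]; ring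
    rw [e]
    calc _ ≤ 3 * 1 * (2:ℝ) ^ 4 := by gcongr
      _ = 48 := by norm_num
  · rw [f1_large h]
    have e : |-(3/2) * (r^5)⁻¹ * (2 * r)| = 3 * (r^4)⁻¹ := by
      rw [show -(3/2) * (r^5)⁻¹ * (2 * r) = -(3 * (r^4)⁻¹) by field_simp, abs_neg, abs_of_nonneg (by positivity)]
    rw [e]
    calc 3 * (r^4)⁻¹ * (1+r)^4 ≤ 3 * (r^4)⁻¹ * (2 * r)^4 := by gcongr; linarith
      _ = 48 := by field_simp; norm_num

lemma rho0_eq {r : ℝ} (h0 : 0 ≤ r) : 3 * f0 (r^2) + 2 * r^2 * f1 (r^2) = if r ≤ 1 then 15/2 * (1 - r^2) else 0 := by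
  split_ifs with h
  · rw [f0_small h0 h, f1_small h0 h]; ring
  · rw [not_le] at h
    rw [f0_large h, f1_large h]; field_simp; norm_num

/-- Scaled profile. -/
noncomputable def fe (e s : ℝ) : ℝ := 1 / (4 * Real.pi) * (e ^ 3)⁻¹ * f0 (s / e ^ 2)
/-- Its derivative. -/
noncomputable def fe' (e s : ℝ) : ℝ := 1 / (4 * Real.pi) * (e ^ 5)⁻¹ * f1 (s / e ^ 2)
/-- The singular profile. -/
noncomputable def fS (s : ℝ) : ℝ := 1 / (4 * Real.pi) * s ^ (-(3/2) : ℝ)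

lemma profe {e : ℝ} (he : 0 < e) : Prof (fe e) (fe' e) := by
  constructor
  · intro s
    have := ((prof0.d (s / e^2)).comp s ((hasDerivAt_id s).div_const (e^2))).const_mul
      (1 / (4 * Real.pi) * (e ^ 3)⁻¹)
    refine this.congr_deriv ?_
    unfold fe'; field_simp
  · unfold fe'
    have := prof0.cψ
    fun_prop

lemma fS_sq {r : ℝ} (hr : 0 < r) : fS (r ^ 2) = 1 / (4 * Real.pi) * (r ^ 3)⁻¹ := by
  rw [fS, rpow_32 hr]

lemma fe_nonneg {e r : ℝ} (he : 0 < e) (hr : 0 ≤ r) : 0 ≤ fe e (r ^ 2) := by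
  unfold fe
  rw [← div_pow]
  have := f0_nonneg (r := r / e) (by positivity)
  have := Real.pi_pos
  positivity

lemma fe_le_fS {e r : ℝ} (he : 0 < e) (hr : 0 < r) : fe e (r ^ 2) ≤ fS (r ^ 2) := by
  unfold fe
  rw [← div_pow, fS_sq hr]
  have := f0_le_inv (r := r / e) (by positivity)
  have := Real.pi_pos
  calc _ ≤ 1 / (4 * Real.pi) * (e ^ 3)⁻¹ * ((r / e)^3)⁻¹ := by gcongr
    _ = _ := by field_simp

lemma fe_eq_fS {e r : ℝ} (he : 0 < e) (hr : e < r) : fe e (r ^ 2) = fS (r ^ 2) := by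
  unfold fe
  have h0 : 0 < r := he.trans hr
  have := Real.pi_pos
  rw [← div_pow, fS_sq h0, f0_large (by rwa [one_lt_div he])]
  field_simp

lemma fe_le {e r : ℝ} (he : 0 < e) (hr : 0 ≤ r) : fe e (r ^ 2) ≤ 20 / (r + e) ^ 3 := by
  unfold fe
  have h1 := f0_le (r := r / e) (by positivity)
  have h2 := f0_nonneg (r := r / e) (by positivity)
  have hp := Real.pi_gt_three
  have : 1 / (4 * Real.pi) ≤ 1 := by rw [div_le_one (by positivity)]; linarith
  rw [← div_pow]
  calc _ ≤ 1 * (e^3)⁻¹ * (20 / (1 + r/e)^3) := by gcongr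
    _ = _ := by field_simp; ring_nf

lemma fe'_le {e r : ℝ} (he : 0 < e) (hr : 0 ≤ r) : |fe' e (r ^ 2) * (2 * r)| ≤ 48 / (r + e) ^ 4 := by
  unfold fe'
  have h1 := f1_le (r := r / e) (by positivity)
  have hp := Real.pi_gt_three
  have : 1 / (4 * Real.pi) ≤ 1 := by rw [div_le_one (by positivity)]; linarith
  rw [← div_pow]
  calc _ = 1 / (4 * Real.pi) * (e^4)⁻¹ * |f1 ((r/e)^2) * (2 * (r/e))| := by
        rw [show 1 / (4 * Real.pi) * (e^5)⁻¹ * f1 ((r/e)^2) * (2 * r) =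
          (1 / (4 * Real.pi) * (e^4)⁻¹) * (f1 ((r/e)^2) * (2 * (r/e))) by field_simp, abs_mul,
          abs_of_nonneg (a := 1 / (4 * Real.pi) * (e^4)⁻¹) (by positivity)]
    _ ≤ 1 * (e^4)⁻¹ * (48 / (1 + r/e)^4) := by gcongr
    _ = _ := by field_simp; ring_nf

/-- K1 -/
lemma K1 {e : ℝ} (he : 0 < e) {d a : E3} (ha : ‖a‖ ≤ e) :
    |fe e (dot3 (d + a) (d + a))| ≤ 160 / (‖d‖ + e) ^ 3 := by
  rw [dot3_self, abs_of_nonneg (fe_nonneg he (norm_nonneg _))]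
  refine (fe_le he (norm_nonneg _)).trans ?_
  have h1 : ‖d‖ ≤ ‖d + a‖ + ‖a‖ := by simpa using norm_sub_le (d + a) a
  have h2 : (‖d‖ + e) / 2 ≤ ‖d + a‖ + e := by linarith [norm_nonneg (d + a)]
  calc 20 / (‖d + a‖ + e)^3 ≤ 20 / ((‖d‖ + e) / 2)^3 := by gcongr
    _ = _ := by field_simp; norm_num

/-- K2 -/
lemma K2 {e : ℝ} (he : 0 < e) {d a : E3} (ha : ‖a‖ ≤ e) :
    |fe e (dot3 (d + a) (d + a)) - fe e (dot3 d d)| ≤ 768 * e / (‖d‖ + e) ^ 4 := by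
  rw [dot3_self, dot3_self]
  have h0 : ‖d‖ ≤ ‖d + a‖ + ‖a‖ := by simpa using norm_sub_le (d + a) a
  have h1 : ‖d‖ - e ≤ ‖d + a‖ := by linarith
  have key : ∀ r ∈ Ici (max 0 (‖d‖ - e)), |fe' e (r^2) * (2 * r)| ≤ 768 / (‖d‖ + e)^4 := by
    intro r hr
    have hr0 : 0 ≤ r := (le_max_left _ _).trans hr
    have hr1 : ‖d‖ - e ≤ r := (le_max_right _ _).trans hr
    refine (fe'_le he hr0).trans ?_
    have h2 : (‖d‖ + e) / 2 ≤ r + e := by linarith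
    calc 48 / (r + e)^4 ≤ 48 / ((‖d‖ + e) / 2)^4 := by gcongr
      _ = _ := by field_simp; norm_num
  have hd : ∀ r ∈ Ici (max 0 (‖d‖ - e)), HasDerivWithinAt (fun r => fe e (r^2)) (fe' e (r^2) * (2 * r))
      (Ici (max 0 (‖d‖ - e))) r := by
    intro r _
    have h := ((profe he).d (r^2)).comp r (hasDerivAt_pow 2 r)
    refine HasDerivAt.hasDerivWithinAt (h.congr_deriv ?_)
    simp
  have := (convex_Ici (max 0 (‖d‖ - e))).norm_image_sub_le_of_norm_hasDerivWithin_le hd key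
    (x := ‖d‖) (y := ‖d + a‖) (by simp; linarith) (by simp; linarith)
  simp only [Real.norm_eq_abs] at this
  refine this.trans ?_
  have h3 : |‖d + a‖ - ‖d‖| ≤ e := (abs_norm_sub_norm_le _ _).trans (by simpa using ha)
  calc _ ≤ 768 / (‖d‖ + e)^4 * e := by gcongr
    _ = _ := by ring

lemma rho_e {e : ℝ} (he : 0 < e) (v : E3) : rhoK (fe e) (fe' e) v =
    if ‖v‖ ≤ e then 15 / (8 * Real.pi) * (e^3)⁻¹ * (1 - (‖v‖/e)^2) else 0 := by
  have h := rho0_eq (r := ‖v‖ / e) (by positivity)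
  have hp := Real.pi_pos
  have e1 : rhoK (fe e) (fe' e) v = 1 / (4 * Real.pi) * (e^3)⁻¹ *
      (3 * f0 ((‖v‖/e)^2) + 2 * (‖v‖/e)^2 * f1 ((‖v‖/e)^2)) := by
    unfold rhoK fe fe'
    rw [dot3_self, ← div_pow]
    field_simp
  rw [e1, h]
  simp only [div_le_one he]
  split_ifs
  · field_simp; ring
  · simp

lemma rho_nonneg {e : ℝ} (he : 0 < e) (v : E3) : 0 ≤ rhoK (fe e) (fe' e) v := by
  rw [rho_e he]
  split_ifs with h
  · have : (‖v‖/e)^2 ≤ 1 := by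
      rw [sq_le_one_iff₀ (by positivity), div_le_one he]; exact h
    have hp := Real.pi_pos
    have : 0 ≤ 1 - (‖v‖/e)^2 := by linarith
    positivity
  · exact le_rfl

lemma rho_le {e : ℝ} (he : 0 < e) (v : E3) : rhoK (fe e) (fe' e) v ≤ (e^3)⁻¹ := by
  rw [rho_e he]
  split_ifs with h
  · have hp := Real.pi_gt_three
    have h1 : 15 / (8 * Real.pi) ≤ 1 := by rw [div_le_one (by positivity)]; linarith
    have h2 : (‖v‖/e)^2 ≤ 1 := by
      rw [sq_le_one_iff₀ (by positivity), div_le_one he]; exact h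
    have h4 : 0 ≤ 1 - (‖v‖/e)^2 := by linarith
    have h3 : 1 - (‖v‖/e)^2 ≤ 1 := by linarith [sq_nonneg (‖v‖/e)]
    calc _ ≤ 1 * (e^3)⁻¹ * 1 := by gcongr
      _ = _ := by ring
  · positivity

lemma rho_supp {e : ℝ} (he : 0 < e) {v : E3} (h : rhoK (fe e) (fe' e) v ≠ 0) : ‖v‖ ≤ e := by
  rw [rho_e he] at h
  by_contra h'
  simp [h'] at h

lemma rho_integrable {e : ℝ} (he : 0 < e) : Integrable (rhoK (fe e) (fe' e)) := by
  refine integrable_of_ball (R := e) (continuous_rhoK (profe he).cφ (profe he).cψ continuous_id) ?_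
  intro y hy
  by_contra h
  exact hy (by simpa using rho_supp he h)

lemma rho_integral {e : ℝ} (he : 0 < e) : ∫ v, rhoK (fe e) (fe' e) v = 1 := by
  have hp := Real.pi_pos
  simp only [rho_e he]
  rw [integral_fun_norm_addHaar (volume : Measure E3)
    (fun r => if r ≤ e then 15 / (8 * Real.pi) * (e^3)⁻¹ * (1 - (r/e)^2) else 0)]
  have hv : (volume : Measure E3).real (Metric.ball 0 1) = 4/3 * Real.pi := by
    rw [Measure.real, EuclideanSpace.volume_ball_fin_three]
    rw [ENNReal.toReal_mul, ENNReal.toReal_ofReal (by positivity)]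
    simp; ring
  rw [hv]
  simp only [finrank_euclideanSpace, Fintype.card_fin, smul_eq_mul, nsmul_eq_mul]
  have : ∫ y in Ioi (0:ℝ), y ^ (3 - 1) * (if y ≤ e then 15 / (8 * Real.pi) * (e^3)⁻¹ * (1 - (y/e)^2) else 0)
      = ∫ y in (0:ℝ)..e, 15 / (8 * Real.pi) * (e^3)⁻¹ * (y^2 - y^4/e^2) := by
    rw [intervalIntegral.integral_of_le he.le]
    rw [← integral_indicator measurableSet_Ioi, ← integral_indicator measurableSet_Ioc]
    congr 1
    funext y
    by_cases h1 : 0 < y <;> by_cases h2 : y ≤ e <;> simp [indicator, h1, h2]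
    field_simp
  rw [this]
  simp only [intervalIntegral.integral_const_mul]
  rw [intervalIntegral.integral_sub (by simp) (by simp)]
  simp only [intervalIntegral.integral_div, integral_pow]
  field_simp
  ring

end

section

open MeasureTheory Set

/-! ### The vector estimate behind `E2` -/

lemma dot3_add_right (u v w : E3) : dot3 u (v + w) = dot3 u v + dot3 u w := by
  simp [dot3]; ring
lemma dot3_add_left (u v w : E3) : dot3 (u + v) w = dot3 u w + dot3 v w := by
  simp [dot3]; ring
lemma dot3_smul_left (c : ℝ) (u w : E3) : dot3 (c • u) w = c * dot3 u w := by
  simp [dot3]; ring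
lemma dot3_comm (u w : E3) : dot3 u w = dot3 w u := by
  simp [dot3]; ring

/-- The mollifier. -/
noncomputable def rh (e : ℝ) (a : E3) : ℝ := rhoK (fe e) (fe' e) a
/-- shifted profile -/
noncomputable def Ph (e : ℝ) (d a : E3) : ℝ := fe e (dot3 (d + a) (d + a))

lemma continuous_rh {e : ℝ} (he : 0 < e) : Continuous (rh e) :=
  continuous_rhoK (profe he).cφ (profe he).cψ continuous_id

lemma continuous_Ph {e : ℝ} (he : 0 < e) (d : E3) : Continuous (Ph e d) := by
  have := (profe he).cφ
  unfold Ph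
  exact this.comp (by fun_prop)

lemma rh_integrable_mul {e : ℝ} (he : 0 < e) {f : E3 → ℝ} (hf : Continuous f) :
    Integrable (fun a => rh e a * f a) := by
  refine integrable_of_ball (R := e) ((continuous_rh he).mul hf) ?_
  intro y hy
  by_contra h
  exact hy (by simpa using rho_supp he (left_ne_zero_of_mul h))

lemma rh_bound {e : ℝ} (he : 0 < e) {f : E3 → ℝ} {M : ℝ} 
    (hf : ∀ a, ‖a‖ ≤ e → |f a| ≤ M) : |∫ a, rh e a * f a| ≤ M := by
  have h := norm_integral_le_of_norm_le (f := fun a => rh e a * f a) ((rho_integrable he).mul_const M) ?_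
  · rw [integral_mul_const, rho_integral he, one_mul] at h
    exact h
  · refine Filter.Eventually.of_forall fun a => ?_
    rw [norm_mul, Real.norm_eq_abs, Real.norm_eq_abs, abs_of_nonneg (show 0 ≤ rh e a from rho_nonneg he a)]
    by_cases h : rhoK (fe e) (fe' e) a = 0
    · rw [rh, h]; simp
    · have := hf a (rho_supp he h)
      exact mul_le_mul_of_nonneg_left this (rho_nonneg he a)

/-- Reflection symmetry. -/
lemma rh_reflect {e : ℝ} (he : 0 < e) {d w : E3} (hw : dot3 w d = 0) :
    ∫ a, rh e a * (Ph e d a * dot3 w a) = 0 := by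
  set R := (Submodule.span ℝ {w})ᗮ.reflection with hR
  have hd : R d = d := by
    refine Submodule.reflection_mem_subspace_eq_self ?_
    rw [Submodule.mem_orthogonal_singleton_iff_inner_right, ← dot3_eq_inner]; exact hw
  have hww : R w = -w := Submodule.reflection_orthogonalComplement_singleton_eq_neg w
  have hmp : MeasurePreserving R volume volume := R.measurePreserving
  have h := hmp.integral_comp R.toHomeomorph.measurableEmbedding (fun a => rh e a * (Ph e d a * dot3 w a))
  have e1 : ∀ a, rh e (R a) * (Ph e d (R a) * dot3 w (R a)) = - (rh e a * (Ph e d a * dot3 w a)) := by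
    intro a
    have a1 : rh e (R a) = rh e a := by
      unfold rh; rw [rho_e he, rho_e he, R.norm_map]
    have a2 : Ph e d (R a) = Ph e d a := by
      unfold Ph
      rw [dot3_self, dot3_self]
      congr 2
      rw [← R.norm_map (d + a), map_add, hd]
    have a3 : dot3 w (R a) = - dot3 w a := by
      have : inner ℝ (R w) (R a) = inner ℝ w a := R.inner_map_map w a
      rw [hww, inner_neg_left] at this
      rw [dot3_eq_inner, dot3_eq_inner]; linarith
    rw [a1, a2, a3]; ring
  simp only [e1] at h
  rw [integral_neg] at h
  linarith

section
variable {e C : ℝ} 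

lemma Ph_le (he : 0 < e) (hC : 1 ≤ C) {d a : E3} {r : ℝ} (hr : 0 < r) (h : r ≤ C * ‖d‖) (ha : ‖a‖ ≤ e) :
    |Ph e d a| ≤ 768 * C ^ 4 / (r + e) ^ 3 := by
  refine (K1 he ha).trans ?_
  have : (r + e) / C ≤ ‖d‖ + e := by
    rw [div_le_iff₀ (by positivity)]; nlinarith
  calc 160 / (‖d‖ + e)^3 ≤ 160 / ((r + e) / C)^3 := by gcongr
    _ = 160 * C^3 / (r+e)^3 := by field_simp
    _ ≤ 768 * C^4 / (r+e)^3 := by gcongr <;> norm_num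

lemma Ph_diff (he : 0 < e) (hC : 1 ≤ C) {d a : E3} {r : ℝ} (hr : 0 < r) (h : r ≤ C * ‖d‖) (ha : ‖a‖ ≤ e) :
    |Ph e d a - Ph e d 0| ≤ 768 * C ^ 4 * (e / (r + e) ^ 4) := by
  have := K2 he ha (d := d)
  have h0 : Ph e d 0 = fe e (dot3 d d) := by simp [Ph]
  rw [h0]
  refine this.trans ?_
  have : (r + e) / C ≤ ‖d‖ + e := by
    rw [div_le_iff₀ (by positivity)]; nlinarith
  calc 768 * e / (‖d‖ + e)^4 ≤ 768 * e / ((r + e) / C)^4 := by gcongr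
    _ = _ := by field_simp

lemma lemmaJ (he : 0 < e) (hC : 1 ≤ C) {d1 d2 α : E3} {r1 r2 : ℝ} (hr1 : 0 < r1) (hr2 : 0 < r2)
    (h11 : r1 ≤ 1) (hd1 : r1 ≤ C * ‖d1‖) (hd2 : r2 ≤ C * ‖d2‖)
    (hα : ‖α‖ ≤ C * r1) (hαd : |dot3 α d1| ≤ C * r1 ^ 3) :
    |∫ a, rh e a * (Ph e d1 a * Ph e d2 a * dot3 α a)| ≤ (768 * C^4)^2 * (2 * C^2) *
      (e * r1^2 / ((r1+e)^3 * (r2+e)^3) + r1 * e^2 / ((r1+e)^3 * (r2+e)^4)) := by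
  have hd0 : 0 < ‖d1‖ := by
    by_contra h
    have : ‖d1‖ = 0 := le_antisymm (not_lt.1 h) (norm_nonneg _)
    rw [this] at hd1; linarith
  set κ := dot3 α d1 / ‖d1‖^2 with hκ
  set w := α + (-κ) • d1 with hw
  have hwd : dot3 w d1 = 0 := by
    rw [hw, dot3_add_left, dot3_smul_left, dot3_self, hκ]; field_simp; ring
  have hκd : ‖κ • d1‖ ≤ C^2 * r1^2 := by
    rw [norm_smul, hκ, norm_div, Real.norm_eq_abs, norm_pow, norm_norm]
    have : |dot3 α d1| / ‖d1‖ ^ 2 * ‖d1‖ = |dot3 α d1| / ‖d1‖ := by field_simp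
    rw [this, div_le_iff₀ hd0]
    calc _ ≤ C * r1^3 := hαd
      _ = C * r1^2 * r1 := by ring
      _ ≤ C * r1^2 * (C * ‖d1‖) := by gcongr
      _ = _ := by ring
  have hwn : ‖w‖ ≤ 2 * C^2 * r1 := by
    have : ‖w‖ ≤ ‖α‖ + ‖κ • d1‖ := by
      rw [hw, neg_smul, ← sub_eq_add_neg]; exact norm_sub_le _ _
    have h2 : C * r1 ≤ C^2 * r1 := by gcongr; nlinarith
    have h3 : C^2 * r1^2 ≤ C^2 * r1 := by gcongr; nlinarith
    linarith
  have hsplit : ∀ a, rh e a * (Ph e d1 a * Ph e d2 a * dot3 α a) =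
      rh e a * (Ph e d1 a * Ph e d2 a * dot3 (κ • d1) a + Ph e d1 a * (Ph e d2 a - Ph e d2 0) * dot3 w a)
      + Ph e d2 0 * (rh e a * (Ph e d1 a * dot3 w a)) := by
    intro a
    have : dot3 α a = dot3 (κ • d1) a + dot3 w a := by
      rw [hw, dot3_add_left, dot3_smul_left, dot3_smul_left]; ring
    rw [this]; ring
  have c1 := continuous_Ph he d1
  have c2 := continuous_Ph he d2
  simp only [hsplit]
  rw [integral_add (rh_integrable_mul he (by fun_prop)) ((rh_integrable_mul he (by fun_prop)).const_mul _),
    integral_const_mul, rh_reflect he hwd, mul_zero, add_zero]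
  refine rh_bound he ?_
  intro a ha
  have p1 := Ph_le he hC hr1 hd1 ha
  have p2 := Ph_le he hC hr2 hd2 ha
  have p3 := Ph_diff he hC hr2 hd2 ha
  have q1 : |dot3 (κ • d1) a| ≤ C^2 * r1^2 * e := (abs_dot3_le _ _).trans (by gcongr)
  have q2 : |dot3 w a| ≤ 2 * C^2 * r1 * e := (abs_dot3_le _ _).trans (by gcongr)
  refine (abs_add_le _ _).trans ?_
  rw [abs_mul, abs_mul, abs_mul, abs_mul]
  calc _ ≤ (768 * C ^ 4 / (r1 + e) ^ 3) * (768 * C ^ 4 / (r2 + e) ^ 3) * (C^2 * r1^2 * e) + 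
        (768 * C ^ 4 / (r1 + e) ^ 3) * (768 * C ^ 4 * (e / (r2 + e) ^ 4)) * (2 * C^2 * r1 * e) := by gcongr
    _ = (768 * C^4)^2 * (C^2) * (e * r1^2 / ((r1+e)^3 * (r2+e)^3)) + 
       (768 * C^4)^2 * (2 * C^2) * (r1 * e^2 / ((r1+e)^3 * (r2+e)^4)) := by field_simp
    _ ≤ (768 * C^4)^2 * (2 * C^2) * (e * r1^2 / ((r1+e)^3 * (r2+e)^3)) + 
       (768 * C^4)^2 * (2 * C^2) * (r1 * e^2 / ((r1+e)^3 * (r2+e)^4)) := by gcongr; nlinarith [sq_nonneg C]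
    _ = _ := by ring

lemma num1 {r1 r2 s1 s2 : ℝ} (he : 0 < e) (h1 : 0 < r1) (h2 : 0 < r2) (hs1 : r1 ≤ s1) (hs2 : r2 ≤ s2) :
    (e * r1^2 / (s1^3 * s2^3) + r1 * e^2 / (s1^3 * s2^4)) * r2^3 ≤ e / s1 + e^2 / (s1^2 * s2) := by
  have g1 : 0 < s1 := by linarith
  have g2 : 0 < s2 := by linarith
  have x1 : (r1 / s1) ≤ 1 := by rwa [div_le_one g1]
  have x2 : (r2 / s2) ≤ 1 := by rwa [div_le_one g2]
  have y1 : (r2/s2)^3 * (r1/s1)^2 ≤ 1 * 1 := by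
    gcongr
    · exact pow_le_one₀ (by positivity) x2
    · exact pow_le_one₀ (by positivity) x1
  have y2 : (r2/s2)^3 * (r1/s1) ≤ 1 * 1 := by
    gcongr
    · exact pow_le_one₀ (by positivity) x2
  calc _ = ((r2/s2)^3 * (r1/s1)^2) * (e / s1) + ((r2/s2)^3 * (r1/s1)) * (e^2 / (s1^2 * s2)) := by field_simp
    _ ≤ (1*1) * (e/s1) + (1*1) * (e^2 / (s1^2 * s2)) := by gcongr
    _ = _ := by ring

lemma num3 {r1 r2 s1 s2 : ℝ} (he : 0 < e) (h1 : 0 < r1) (h2 : 0 < r2) (hs1 : r1 ≤ s1) (hs2 : r2 ≤ s2) :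
    r1 * r2 * (r1 + r2) * e^2 / (s1^3 * s2^3) ≤ e^2/(s1 * s2^2) + e^2 / (s1^2 * s2) := by
  have g1 : 0 < s1 := by linarith
  have g2 : 0 < s2 := by linarith
  calc _ ≤ s1 * s2 * (s1 + s2) * e^2 / (s1^3 * s2^3) := by gcongr
    _ = _ := by field_simp

lemma num4 {r1 r2 s1 s2 : ℝ} (he : 0 < e) (h1 : 0 < r1) (h2 : 0 < r2) (hs1 : r1 ≤ s1) (hs2 : r2 ≤ s2) :
    (e / (s1^4 * s2^3) + e / (s1^3 * s2^4)) * (r1^3 * r2^3) ≤ e/s1 + e/s2 := by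
  have g1 : 0 < s1 := by linarith
  have g2 : 0 < s2 := by linarith
  calc _ ≤ (e / (s1^4 * s2^3) + e / (s1^3 * s2^4)) * (s1^3 * s2^3) := by gcongr
    _ = _ := by field_simp

/-- weights -/
noncomputable def wt (r : ℝ) : ℝ := r ^ (-(3/4) : ℝ)

lemma wt_fourth {p : ℝ} (hp : 0 < p) : wt (p^4) = (p^3)⁻¹ := by
  rw [wt, ← Real.rpow_natCast p 4, ← Real.rpow_mul hp.le, ← Real.rpow_natCast p 3, ← Real.rpow_neg hp.le]
  norm_num

lemma exists_fourth {r : ℝ} (hr : 0 < r) : ∃ p : ℝ, 0 < p ∧ r = p^4 := by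
  refine ⟨r ^ (1/4 : ℝ), by positivity, ?_⟩
  rw [← Real.rpow_natCast, ← Real.rpow_mul hr.le]; norm_num

lemma sqrt_fourth {p : ℝ} (hp : 0 < p) : Real.sqrt (p^4) = p^2 := by
  rw [show p^4 = (p^2)^2 by ring, Real.sqrt_sq (by positivity)]

lemma num_final1 {r1 r2 : ℝ} (he : 0 < e) (h1 : 0 < r1) (h2 : 0 < r2) (h11 : r1 ≤ 1) (h21 : r2 ≤ 1) :
    e / (r1 + e) ≤ Real.sqrt e * (wt r1 * wt r2) := by
  obtain ⟨q, hq, hqe⟩ := exists_fourth (r := r1 + e) (by positivity)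
  obtain ⟨p1, hp1, rfl⟩ := exists_fourth h1
  obtain ⟨p2, hp2, rfl⟩ := exists_fourth h2
  obtain ⟨e, he', rfl⟩ := exists_fourth he
  rw [hqe, sqrt_fourth he', wt_fourth hp1, wt_fourth hp2]
  have a1 : e ≤ q := le_of_pow_le_pow_left₀ (n := 4) (by norm_num) hq.le (by nlinarith)
  have a2 : p1 ≤ q := le_of_pow_le_pow_left₀ (n := 4) (by norm_num) hq.le (by nlinarith)
  have b1 : p1 ≤ 1 := by
    by_contra h; have := one_lt_pow₀ (not_le.1 h) (n := 4) (by norm_num); linarith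
  have b2 : p2 ≤ 1 := by
    by_contra h; have := one_lt_pow₀ (not_le.1 h) (n := 4) (by norm_num); linarith
  have x1 : e / q ≤ 1 := by rwa [div_le_one hq]
  calc e^4/q^4 = e^2 * ((e/q)^2 * (q^2)⁻¹) := by field_simp
    _ ≤ e^2 * (1^2 * (p1^2)⁻¹) := by gcongr
    _ = e^2 * ((p1^2)⁻¹ * 1) := by ring
    _ ≤ e^2 * ((p1^3)⁻¹ * (p2^3)⁻¹) := by
        gcongr ?_ * (?_ * ?_)
        · rw [inv_le_inv₀ (by positivity) (by positivity)]
          calc p1^3 = p1^2 * p1 := by ring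
            _ ≤ p1^2 * 1 := by gcongr
            _ = _ := by ring
        · exact (one_le_inv₀ (by positivity)).2 (pow_le_one₀ hp2.le b2)

lemma num_final2 {r1 r2 : ℝ} (he : 0 < e) (h1 : 0 < r1) (h2 : 0 < r2) :
    e^2 / ((r1 + e) * (r2 + e)^2) ≤ Real.sqrt e * (wt r1 * wt r2) := by
  obtain ⟨q1, hq1, hqe1⟩ := exists_fourth (r := r1 + e) (by positivity)
  obtain ⟨q2, hq2, hqe2⟩ := exists_fourth (r := r2 + e) (by positivity)
  obtain ⟨p1, hp1, rfl⟩ := exists_fourth h1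
  obtain ⟨p2, hp2, rfl⟩ := exists_fourth h2
  obtain ⟨e, he', rfl⟩ := exists_fourth he
  rw [hqe1, hqe2, sqrt_fourth he', wt_fourth hp1, wt_fourth hp2]
  have a1 : e ≤ q1 := le_of_pow_le_pow_left₀ (n := 4) (by norm_num) hq1.le (by nlinarith)
  have a2 : p1 ≤ q1 := le_of_pow_le_pow_left₀ (n := 4) (by norm_num) hq1.le (by nlinarith)
  have a3 : e ≤ q2 := le_of_pow_le_pow_left₀ (n := 4) (by norm_num) hq2.le (by nlinarith)
  have a4 : p2 ≤ q2 := le_of_pow_le_pow_left₀ (n := 4) (by norm_num) hq2.le (by nlinarith)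
  have x1 : e / q1 ≤ 1 := by rwa [div_le_one hq1]
  have x2 : e / q2 ≤ 1 := by rwa [div_le_one hq2]
  calc (e^4)^2/(q1^4 * (q2^4)^2) = e^2 * ((e/q1) * (e/q2)^5 * ((q1^3)⁻¹ * (q2^3)⁻¹)) := by field_simp
    _ ≤ e^2 * (1 * 1^5 * ((p1^3)⁻¹ * (p2^3)⁻¹)) := by gcongr
    _ = _ := by ring

/-- The function `W`. -/
noncomputable def Wv (e : ℝ) (d1 d2 α1 α2 b1 b2 a : E3) : ℝ :=
  Ph e d1 a * Ph e d2 a * (dot3 α1 (d1 + a) * dot3 b2 (d2 + a) - dot3 α2 (d2 + a) * dot3 b1 (d1 + a))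

lemma abs5 {x m a b c d A B : ℝ} (hm : |m| ≤ 6 * A * B) (ha : |a| ≤ 4 * A * B) (hb : |b| ≤ 4 * A * B)
    (hc : |c| ≤ 4 * A * B) (hd : |d| ≤ 4 * A * B) : |x + m + (a + b + c + d) - x| ≤ 40 * A * B := by
  have : x + m + (a + b + c + d) - x = m + a + b + c + d := by ring
  rw [this]
  have h0 : 0 ≤ A * B := by have := (abs_nonneg _).trans ha; linarith
  have := abs_add_le (m + a + b + c) d
  have := abs_add_le (m + a + b) c
  have := abs_add_le (m + a) b
  have := abs_add_le m a
  linarith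

lemma integral_six {f0 f1 f2 f3 f4 f5 : E3 → ℝ} (h0 : Integrable f0) (h1 : Integrable f1) (h2 : Integrable f2)
    (h3 : Integrable f3) (h4 : Integrable f4) (h5 : Integrable f5) (k0 k2 k3 k4 k5 : ℝ) :
    ∫ a, (k0 * f0 a + f1 a + (k2 * f2 a + k3 * f3 a + k4 * f4 a + k5 * f5 a)) =
      k0 * (∫ a, f0 a) + (∫ a, f1 a) + (k2 * (∫ a, f2 a) + k3 * (∫ a, f3 a) + k4 * (∫ a, f4 a) + k5 * ∫ a, f5 a) := by
  have g0 := h0.const_mul k0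
  have g2 := h2.const_mul k2
  have g3 := h3.const_mul k3
  have g4 := h4.const_mul k4
  have g5 := h5.const_mul k5
  have e1 : Integrable (fun a => k2 * f2 a + k3 * f3 a) := g2.add g3
  have e2 : Integrable (fun a => k2 * f2 a + k3 * f3 a + k4 * f4 a) := e1.add g4
  have e3 : Integrable (fun a => k2 * f2 a + k3 * f3 a + k4 * f4 a + k5 * f5 a) := e2.add g5
  have e4 : Integrable (fun a => k0 * f0 a + f1 a) := g0.add h1
  rw [integral_add e4 e3, integral_add g0 h1, integral_add e2 g5, integral_add e1 g4, integral_add g2 g3]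
  simp only [integral_const_mul]

set_option maxHeartbeats 1000000 in
lemma E2_vec (he : 0 < e) (hC : 1 ≤ C) {d1 d2 α1 α2 b1 b2 : E3} {r1 r2 : ℝ}
    (hr1 : 0 < r1) (hr2 : 0 < r2) (h11 : r1 ≤ 1) (h21 : r2 ≤ 1)
    (hd1 : r1 ≤ C * ‖d1‖) (hd2 : r2 ≤ C * ‖d2‖)
    (hα1 : ‖α1‖ ≤ C * r1) (hα1d : |dot3 α1 d1| ≤ C * r1 ^ 3)
    (hα2 : ‖α2‖ ≤ C * r2) (hα2d : |dot3 α2 d2| ≤ C * r2 ^ 3)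
    (hb1 : ‖b1‖ ≤ C * r1) (hb1d : |dot3 b1 d1| ≤ C * r1 ^ 3)
    (hb2 : ‖b2‖ ≤ C * r2) (hb2d : |dot3 b2 d2| ≤ C * r2 ^ 3)
    (hq : ∀ a, |dot3 α1 a * dot3 b2 a - dot3 α2 a * dot3 b1 a| ≤ C * (r1 * r2 * (r1 + r2)) * ‖a‖^2) :
    |(∫ a, rh e a * Wv e d1 d2 α1 α2 b1 b2 a) - Wv e d1 d2 α1 α2 b1 b2 0| ≤
      (768 * C^4)^2 * (40 * C^3) * (Real.sqrt e * (wt r1 * wt r2)) := by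
  set B := Real.sqrt e * (wt r1 * wt r2) with hB
  set A := 768 * C^4 with hA
  have hA0 : 0 < A := by positivity
  set s1 := r1 + e with hs1
  set s2 := r2 + e with hs2
  have t1 : r1 ≤ s1 := by linarith
  have t2 : r2 ≤ s2 := by linarith
  have g1 : 0 < s1 := by linarith
  have g2 : 0 < s2 := by linarith
  have f1 : e / s1 ≤ B := num_final1 he hr1 hr2 h11 h21
  have f2 : e / s2 ≤ B := by rw [hB, mul_comm (wt r1)]; exact num_final1 he hr2 hr1 h21 h11
  have f3 : e^2 / (s1 * s2^2) ≤ B := num_final2 he hr1 hr2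
  have f4 : e^2 / (s2 * s1^2) ≤ B := by rw [hB, mul_comm (wt r1)]; exact num_final2 he hr2 hr1
  have f5 : e^2 / (s1^2 * s2) ≤ B := by rw [mul_comm]; exact f4
  have f6 : e^2 / (s2^2 * s1) ≤ B := by rw [mul_comm]; exact f3
  have hB0 : 0 ≤ B := le_trans (by positivity) f1
  -- linear pieces
  have J1 : ∀ α : E3, ‖α‖ ≤ C * r1 → |dot3 α d1| ≤ C * r1^3 → ∀ k, |k| ≤ C * r2^3 →
      |k * ∫ a, rh e a * (Ph e d1 a * Ph e d2 a * dot3 α a)| ≤ A^2 * (4 * C^3) * B := by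
    intro α h1 h2 k hk
    rw [abs_mul]
    have := lemmaJ he hC hr1 hr2 h11 hd1 hd2 h1 h2
    have n := num1 he hr1 hr2 t1 t2
    calc _ ≤ C * r2^3 * (A^2 * (2 * C^2) *
      (e * r1^2 / (s1^3 * s2^3) + r1 * e^2 / (s1^3 * s2^4))) := by gcongr
      _ = A^2 * (2 * C^3) * ((e * r1^2 / (s1^3 * s2^3) + r1 * e^2 / (s1^3 * s2^4)) * r2^3) := by ring
      _ ≤ A^2 * (2 * C^3) * (B + B) := by gcongr; linarith
      _ = _ := by ring
  have J2 : ∀ α : E3, ‖α‖ ≤ C * r2 → |dot3 α d2| ≤ C * r2^3 → ∀ k, |k| ≤ C * r1^3 →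
      |k * ∫ a, rh e a * (Ph e d1 a * Ph e d2 a * dot3 α a)| ≤ A^2 * (4 * C^3) * B := by
    intro α h1 h2 k hk
    rw [abs_mul]
    have := lemmaJ he hC hr2 hr1 h21 hd2 hd1 h1 h2
    simp only [mul_comm (Ph e d2 _)] at this
    have n := num1 he hr2 hr1 t2 t1
    calc _ ≤ C * r1^3 * (A^2 * (2 * C^2) *
      (e * r2^2 / (s2^3 * s1^3) + r2 * e^2 / (s2^3 * s1^4))) := by gcongr
      _ = A^2 * (2 * C^3) * ((e * r2^2 / (s2^3 * s1^3) + r2 * e^2 / (s2^3 * s1^4)) * r1^3) := by ring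
      _ ≤ A^2 * (2 * C^3) * (B + B) := by gcongr; linarith
      _ = _ := by ring
  have c1 := continuous_Ph he d1
  have c2 := continuous_Ph he d2
  set c0 := dot3 α1 d1 * dot3 b2 d2 - dot3 α2 d2 * dot3 b1 d1 with hc0
  have hc0b : |c0| ≤ 2 * C^2 * (r1^3 * r2^3) := by
    refine (abs_sub _ _).trans ?_
    rw [abs_mul, abs_mul]
    calc _ ≤ (C * r1^3) * (C * r2^3) + (C * r2^3) * (C * r1^3) := by gcongr
      _ = _ := by ring
  set q : E3 → ℝ := fun a => dot3 α1 a * dot3 b2 a - dot3 α2 a * dot3 b1 a with hqd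
  have cq : Continuous q := by rw [hqd]; fun_prop
  have hsplit : ∀ a, rh e a * Wv e d1 d2 α1 α2 b1 b2 a =
      c0 * (Ph e d1 0 * Ph e d2 0) * rh e a + 
      rh e a * ((Ph e d1 a * Ph e d2 a - Ph e d1 0 * Ph e d2 0) * c0 + Ph e d1 a * Ph e d2 a * q a) +
      (dot3 b2 d2 * (rh e a * (Ph e d1 a * Ph e d2 a * dot3 α1 a)) +
       dot3 α1 d1 * (rh e a * (Ph e d1 a * Ph e d2 a * dot3 b2 a)) +
       (-dot3 b1 d1) * (rh e a * (Ph e d1 a * Ph e d2 a * dot3 α2 a)) +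
       (-dot3 α2 d2) * (rh e a * (Ph e d1 a * Ph e d2 a * dot3 b1 a))) := by
    intro a
    simp only [Wv, hqd, hc0, dot3_add_right]
    ring
  have i0 : Integrable (rh e) := rho_integrable he
  have i1 : ∀ α, Integrable (fun a => rh e a * (Ph e d1 a * Ph e d2 a * dot3 α a)) := by
    intro α; exact rh_integrable_mul he (by fun_prop)
  have i2 : Integrable (fun a => rh e a * ((Ph e d1 a * Ph e d2 a - Ph e d1 0 * Ph e d2 0) * c0 + Ph e d1 a * Ph e d2 a * q a)) :=
    rh_integrable_mul he (by fun_prop)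
  have hM : |∫ a, rh e a * ((Ph e d1 a * Ph e d2 a - Ph e d1 0 * Ph e d2 0) * c0 + Ph e d1 a * Ph e d2 a * q a)|
      ≤ A^2 * (6 * C^3) * B := by
    refine rh_bound he ?_
    intro a ha
    have h0 : ‖(0:E3)‖ ≤ e := by simpa using he.le
    have p1 := Ph_le he hC hr1 hd1 ha
    have p2 := Ph_le he hC hr2 hd2 ha
    have p3 := Ph_diff he hC hr2 hd2 ha
    have p4 := Ph_diff he hC hr1 hd1 ha
    have p5 := Ph_le he hC hr1 hd1 h0
    have p6 := Ph_le he hC hr2 hd2 h0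
    have hq' := hq a
    have n4 := num4 he hr1 hr2 t1 t2
    have n3 := num3 he hr1 hr2 t1 t2
    have d1' : |Ph e d1 a * Ph e d2 a - Ph e d1 0 * Ph e d2 0| ≤ A^2 * (e / (s1^4 * s2^3) + e / (s1^3 * s2^4)) := by
      rw [show Ph e d1 a * Ph e d2 a - Ph e d1 0 * Ph e d2 0 = (Ph e d1 a - Ph e d1 0) * Ph e d2 a + Ph e d1 0 * (Ph e d2 a - Ph e d2 0) by ring]
      refine (abs_add_le _ _).trans ?_
      rw [abs_mul, abs_mul]
      calc _ ≤ (A * (e / s1^4)) * (A / s2^3) + (A / s1^3) * (A * (e/s2^4)) := by gcongr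
        _ = _ := by field_simp
    refine (abs_add_le _ _).trans ?_
    rw [abs_mul, abs_mul, abs_mul]
    calc _ ≤ A^2 * (e / (s1^4 * s2^3) + e / (s1^3 * s2^4)) * (2 * C^2 * (r1^3 * r2^3)) + 
          (A/s1^3) * (A/s2^3) * (C * (r1 * r2 * (r1 + r2)) * e^2) := by
          gcongr
          exact hq'.trans (by gcongr)
      _ = A^2 * (2 * C^2) * ((e / (s1^4 * s2^3) + e / (s1^3 * s2^4)) * (r1^3 * r2^3)) + 
          A^2 * C * (r1 * r2 * (r1 + r2) * e^2 / (s1^3 * s2^3)) := by field_simp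
      _ ≤ A^2 * (2 * C^2) * (B + B) + A^2 * C * (B + B) := by gcongr <;> linarith
      _ ≤ A^2 * (2 * C^3) * (B + B) + A^2 * C^3 * (B + B) := by
          gcongr
          · norm_num
          · exact le_self_pow₀ hC (by norm_num)
      _ = _ := by ring
  have hW0 : Wv e d1 d2 α1 α2 b1 b2 0 = c0 * (Ph e d1 0 * Ph e d2 0) := by
    simp only [Wv, add_zero, hc0]; ring
  simp only [hsplit]
  rw [integral_six i0 i2 (i1 _) (i1 _) (i1 _) (i1 _)]
  have hone : ∫ a, rh e a = 1 := rho_integral he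
  rw [hone, hW0]
  have k1 := J1 α1 hα1 hα1d _ hb2d
  have k2 := J2 b2 hb2 hb2d _ hα1d
  have k3 := J2 α2 hα2 hα2d (-dot3 b1 d1) (by rwa [abs_neg])
  have k4 := J1 b1 hb1 hb1d (-dot3 α2 d2) (by rwa [abs_neg])
  have := abs5 (x := c0 * (Ph e d1 0 * Ph e d2 0)) (A := A^2 * C^3) (B := B) (hM.trans_eq (by ring)) (k1.trans_eq (by ring)) (k2.trans_eq (by ring))
    (k3.trans_eq (by ring)) (k4.trans_eq (by ring))
  rw [mul_one]
  exact this.trans_eq (by ring)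
end

end

section

open MeasureTheory Set

/-! ### Uniform geometric bounds -/

/-- signed distance to the nearest integer -/
noncomputable def sd (z : ℝ) : ℝ := z - round z

lemma abs_sd_le (z : ℝ) : |sd z| ≤ 1/2 := abs_sub_round z

/-- Uniform bounds. -/
structure Bd (H : ℝ → ℝ → E3) (C : ℝ) : Prop where
  one : 1 ≤ C
  nH : ∀ t ∈ Icc (0:ℝ) 1, ∀ x, ‖H t x‖ ≤ C
  nX : ∀ t ∈ Icc (0:ℝ) 1, ∀ x, ‖pX H t x‖ ≤ C
  nT : ∀ t ∈ Icc (0:ℝ) 1, ∀ x, ‖pT H t x‖ ≤ C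
  nX' : ∀ t ∈ Icc (0:ℝ) 1, ∀ x, ‖pX (pX H) t x‖ ≤ C
  nT' : ∀ t ∈ Icc (0:ℝ) 1, ∀ x, ‖pX (pT H) t x‖ ≤ C
  lX : ∀ t ∈ Icc (0:ℝ) 1, ∀ x y, ‖pX H t y - pX H t x‖ ≤ C * |sd (y - x)|
  lT : ∀ t ∈ Icc (0:ℝ) 1, ∀ x y, ‖pT H t y - pT H t x‖ ≤ C * |sd (y - x)|
  H2 : ∀ t ∈ Icc (0:ℝ) 1, ∀ x y, ‖H t y - H t x - sd (y - x) • pX H t x‖ ≤ C * |sd (y - x)|^2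
  X2 : ∀ t ∈ Icc (0:ℝ) 1, ∀ x y, ‖pX H t y - pX H t x - sd (y - x) • pX (pX H) t x‖ ≤ C * |sd (y - x)|^2
  T2 : ∀ t ∈ Icc (0:ℝ) 1, ∀ x y, ‖pT H t y - pT H t x - sd (y - x) • pX (pT H) t x‖ ≤ C * |sd (y - x)|^2
  low : ∀ t ∈ Icc (0:ℝ) 1, ∀ x y, |sd (y - x)| ≤ C * ‖H t y - H t x‖

lemma per_int {f : ℝ → E3} (h : ∀ x, f (x + 1) = f x) (x : ℝ) (n : ℤ) : f (x - n) = f x := by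
  have : Function.Periodic f 1 := h
  simpa using this.sub_int_mul_eq n (x := x)

lemma exists_bound {F : ℝ → ℝ → E3} (S : Sm F) (hp : ∀ t x, F t (x + 1) = F t x) :
    ∃ C, ∀ t ∈ Icc (0:ℝ) 1, ∀ x, ‖F t x‖ ≤ C := by
  obtain ⟨C, hC⟩ := ((isCompact_Icc (a := (0:ℝ)) (b := 1)).prod (isCompact_Icc (a := (0:ℝ)) (b := 1))).exists_bound_of_continuousOn
    S.cont.continuousOn
  refine ⟨C, fun t ht x => ?_⟩
  have := hC (t, x - ⌊x⌋) ⟨ht, ⟨by simp, by simpa using (Int.fract_lt_one x).le⟩⟩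
  simp only [per_int (hp t)] at this
  exact this

lemma lip_of {f f' : ℝ → E3} {C : ℝ} (hf : ∀ x, HasDerivAt f (f' x) x) (hC : ∀ x, ‖f' x‖ ≤ C) (x y : ℝ) :
    ‖f y - f x‖ ≤ C * |y - x| := by
  have := convex_univ.norm_image_sub_le_of_norm_hasDerivWithin_le (f := f) (f' := f') (C := C)
    (fun z _ => (hf z).hasDerivWithinAt) (fun z _ => hC z) (mem_univ x) (mem_univ y)
  simpa using this

lemma taylor_of {f f' f'' : ℝ → E3} {C : ℝ} (hf : ∀ x, HasDerivAt f (f' x) x) 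
    (hf' : ∀ x, HasDerivAt f' (f'' x) x) (hC : ∀ x, ‖f'' x‖ ≤ C) (x y : ℝ) :
    ‖f y - f x - (y - x) • f' x‖ ≤ C * |y - x|^2 := by
  have hC0 : 0 ≤ C := (norm_nonneg _).trans (hC 0)
  have h1 : ∀ z ∈ uIcc x y, HasDerivWithinAt (fun z => f z - z • f' x) (f' z - f' x) (uIcc x y) z := by
    intro z _
    have := (hf z).sub ((hasDerivAt_id z).smul_const (f' x))
    simp only [id, one_smul] at this
    exact this.hasDerivWithinAt
  have h2 : ∀ z ∈ uIcc x y, ‖f' z - f' x‖ ≤ C * |y - x| := by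
    intro z hz
    refine (lip_of hf' hC x z).trans ?_
    exact mul_le_mul_of_nonneg_left (abs_sub_left_of_mem_uIcc hz) hC0
  have := (convex_uIcc x y).norm_image_sub_le_of_norm_hasDerivWithin_le h1 h2 left_mem_uIcc right_mem_uIcc
  have e : f y - f x - (y - x) • f' x = f y - y • f' x - (f x - x • f' x) := by rw [sub_smul]; abel
  rw [e]
  refine this.trans_eq ?_
  rw [Real.norm_eq_abs]; ring

lemma knot_inj {K : ℝ → E3} (hK : IsKnot K) {x y : ℝ} (h : K y = K x) : sd (y - x) = 0 := by
  have h1 : K (Int.fract y) = K (Int.fract x) := by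
    rw [Int.fract, Int.fract, per_int hK.periodic, per_int hK.periodic, h]
  have h2 := hK.injOn ⟨Int.fract_nonneg y, Int.fract_lt_one y⟩ ⟨Int.fract_nonneg x, Int.fract_lt_one x⟩ h1
  obtain ⟨n, hn⟩ := Int.fract_eq_fract.1 h2
  rw [sd, hn]; simp

lemma low_exists {H : ℝ → ℝ → E3} (F : KFam H) {M : ℝ} 
    (hM : ∀ t ∈ Icc (0:ℝ) 1, ∀ x y, ‖H t y - H t x - (y - x) • pX H t x‖ ≤ M * |y - x|^2) :
    ∃ C, ∀ t ∈ Icc (0:ℝ) 1, ∀ x h, |h| ≤ 1/2 → |h| ≤ C * ‖H t (x + h) - H t x‖ := by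
  have S := F.sm
  have hcp : IsCompact (Icc (0:ℝ) 1 ×ˢ Icc (0:ℝ) 1) := isCompact_Icc.prod isCompact_Icc
  -- lower bound on speed
  obtain ⟨c, hc, hcX⟩ : ∃ c, 0 < c ∧ ∀ t ∈ Icc (0:ℝ) 1, ∀ x, c ≤ ‖pX H t x‖ := by
    obtain ⟨p, hp, hm⟩ := hcp.exists_isMinOn ⟨(0, 0), by simp⟩ S.smX.cont.norm.continuousOn
    refine ⟨_, norm_pos_iff.2 ((F.knot p.1).deriv_ne p.2), fun t ht x => ?_⟩
    have := hm (show (t, x - ⌊x⌋) ∈ _ from ⟨ht, ⟨by simp, by simpa using (Int.fract_lt_one x).le⟩⟩)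
    simp only [mem_setOf_eq, per_int (pX_periodic F.per t)] at this
    exact this
  set M' := max M 1 with hM'
  have hM1 : 0 < M' := lt_of_lt_of_le one_pos (le_max_right _ _)
  set δ := c / (2 * M') with hδ
  have hδ0 : 0 < δ := by positivity
  set S3 : Set (ℝ × ℝ × ℝ) := Icc (0:ℝ) 1 ×ˢ Icc (0:ℝ) 1 ×ˢ (Icc (-(1/2)) (-δ) ∪ Icc δ (1/2)) with hS3
  have hS3c : IsCompact S3 := isCompact_Icc.prod (isCompact_Icc.prod (isCompact_Icc.union isCompact_Icc))
  have hcont : Continuous (fun p : ℝ × ℝ × ℝ => ‖H p.1 (p.2.1 + p.2.2) - H p.1 p.2.1‖) :=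
    ((S.cont' (by fun_prop) (by fun_prop)).sub (S.cont' (by fun_prop) (by fun_prop))).norm
  obtain ⟨c2, hc2, hlow2⟩ : ∃ c2, 0 < c2 ∧ ∀ p ∈ S3, c2 ≤ ‖H p.1 (p.2.1 + p.2.2) - H p.1 p.2.1‖ := by
    rcases S3.eq_empty_or_nonempty with he | hne
    · exact ⟨1, one_pos, by simp [he]⟩
    · obtain ⟨p, hp, hm⟩ := hS3c.exists_isMinOn hne hcont.continuousOn
      refine ⟨_, norm_pos_iff.2 ?_, fun q hq => hm hq⟩
      rw [sub_ne_zero]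
      intro h
      have h1 := knot_inj (F.knot p.1) h
      have h2 : |p.2.2| ≤ 1/2 := by
        rw [abs_le]; rcases hp.2.2 with h | h <;> constructor <;> linarith [h.1, h.2]
      have h3 : p.2.2 ≠ 0 := by
        rcases hp.2.2 with h | h 
        · have := h.2; intro h'; linarith
        · have := h.1; intro h'; linarith
      rw [sd, add_sub_cancel_left, sub_eq_zero] at h1
      have h4 : (round p.2.2 : ℤ) ≠ 0 := by
        intro h5; rw [h5] at h1; simp at h1; exact h3 h1
      have h5 : (1:ℝ) ≤ |((round p.2.2 : ℤ) : ℝ)| := by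
        rw [← Int.cast_abs]; exact_mod_cast Int.one_le_abs h4
      rw [← h1] at h5; linarith
  refine ⟨max (2 / c) (1 / c2), fun t ht x h hh => ?_⟩
  by_cases hs : |h| ≤ δ
  · have h1 := hM t ht x (x + h)
    rw [add_sub_cancel_left] at h1
    have h2 : ‖h • pX H t x‖ ≤ ‖H t (x + h) - H t x‖ + M * |h|^2 := by
      have := norm_sub_norm_le (h • pX H t x) (H t (x + h) - H t x)
      rw [norm_sub_rev (h • pX H t x)] at this
      linarith
    rw [norm_smul, Real.norm_eq_abs] at h2
    have h3 : |h| * c ≤ |h| * ‖pX H t x‖ := by gcongr; exact hcX t ht x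
    have h4 : M * |h|^2 ≤ |h| * (c/2) := by
      calc M * |h|^2 ≤ M' * |h|^2 := by gcongr; exact le_max_left _ _
        _ = |h| * (M' * |h|) := by ring
        _ ≤ |h| * (M' * δ) := by gcongr
        _ = _ := by rw [hδ]; field_simp
    have h5 : |h| ≤ 2 / c * ‖H t (x + h) - H t x‖ := by
      rw [div_mul_eq_mul_div, le_div_iff₀ hc]; linarith
    refine h5.trans ?_
    gcongr; exact le_max_left _ _
  · rw [not_le] at hs
    have hmem : (t, x - ⌊x⌋, h) ∈ S3 := by
      refine ⟨ht, ⟨by simp, by simpa using (Int.fract_lt_one x).le⟩, ?_⟩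
      have := abs_le.1 hh
      rcases le_or_gt 0 h with h0 | h0
      · rw [abs_of_nonneg h0] at hs; right; exact ⟨hs.le, this.2⟩
      · rw [abs_of_neg h0] at hs; left; exact ⟨this.1, by linarith⟩
    have h1 := hlow2 _ hmem
    simp only at h1
    rw [sub_add_eq_add_sub, per_int (F.per t), per_int (F.per t)] at h1
    have h5 : |h| ≤ 1 / c2 * ‖H t (x + h) - H t x‖ := by
      rw [div_mul_eq_mul_div, le_div_iff₀ hc2, one_mul]
      nlinarith
    refine h5.trans ?_
    gcongr; exact le_max_right _ _

theorem exists_Bd {H : ℝ → ℝ → E3} (F : KFam H) : ∃ C, Bd H C := by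
  have S := F.sm
  have pH := F.per
  have pX1 := pX_periodic F.per
  have pT1 := pT_periodic F.per
  have pX2 := pX_periodic pX1
  have pT2 := pX_periodic pT1
  have pX3 := pX_periodic pX2
  have pT3 := pX_periodic pT2
  obtain ⟨C0, h0⟩ := exists_bound S pH
  obtain ⟨C1, h1⟩ := exists_bound S.smX pX1
  obtain ⟨C2, h2⟩ := exists_bound S.smT pT1
  obtain ⟨C3, h3⟩ := exists_bound S.smX.smX pX2
  obtain ⟨C4, h4⟩ := exists_bound S.smT.smX pT2
  obtain ⟨C5, h5⟩ := exists_bound S.smX.smX.smX pX3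
  obtain ⟨C6, h6⟩ := exists_bound S.smT.smX.smX pT3
  have hT : ∀ t ∈ Icc (0:ℝ) 1, ∀ x y, ‖H t y - H t x - (y - x) • pX H t x‖ ≤ C3 * |y - x|^2 :=
    fun t ht x y => taylor_of (S.dX t) (S.smX.dX t) (h3 t ht) x y
  obtain ⟨C7, h7⟩ := low_exists F hT
  set L : List ℝ := [1, C0, C1, C2, C3, C4, C5, C6, C7] with hL
  obtain ⟨C, hC⟩ : ∃ C, ∀ z ∈ L, z ≤ C := by
    obtain ⟨C, hC⟩ := (L.toFinset.finite_toSet).bddAbove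
    exact ⟨C, fun z hz => hC (by simpa using hz)⟩
  simp only [hL, List.mem_cons, List.not_mem_nil, or_false, forall_eq_or_imp, forall_eq] at hC
  obtain ⟨k, k0, k1, k2, k3, k4, k5, k6, k7⟩ := hC
  have key : ∀ x y : ℝ, (y - round (y - x)) - x = sd (y - x) := by intro x y; rw [sd]; ring
  refine ⟨C, k, fun t ht x => (h0 t ht x).trans k0, fun t ht x => (h1 t ht x).trans k1,
    fun t ht x => (h2 t ht x).trans k2, fun t ht x => (h3 t ht x).trans k3, fun t ht x => (h4 t ht x).trans k4,
    ?_, ?_, ?_, ?_, ?_, ?_⟩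
  · intro t ht x y
    have := lip_of (S.smX.dX t) (fun x => (h3 t ht x).trans k3) x (y - round (y - x))
    rwa [key, per_int (pX1 t)] at this
  · intro t ht x y
    have := lip_of (S.smT.dX t) (fun x => (h4 t ht x).trans k4) x (y - round (y - x))
    rwa [key, per_int (pT1 t)] at this
  · intro t ht x y
    have := taylor_of (S.dX t) (S.smX.dX t) (fun x => (h3 t ht x).trans k3) x (y - round (y - x))
    rwa [key, per_int (pH t)] at this
  · intro t ht x y
    have := taylor_of (S.smX.dX t) (S.smX.smX.dX t) (fun x => (h5 t ht x).trans k5) x (y - round (y - x))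
    rwa [key, per_int (pX1 t)] at this
  · intro t ht x y
    have := taylor_of (S.smT.dX t) (S.smT.smX.dX t) (fun x => (h6 t ht x).trans k6) x (y - round (y - x))
    rwa [key, per_int (pT1 t)] at this
  · intro t ht x y
    have := h7 t ht x (sd (y - x)) (abs_sd_le _)
    have e : x + sd (y - x) = y - round (y - x) := by rw [sd]; ring
    rw [e, per_int (pH t)] at this
    exact this.trans (by gcongr)

end

section

open MeasureTheory Set

/-! ### Pointwise estimates -/

lemma det_Xdiff (a b v : E3) (k : ℝ) : det3 a b v = det3 a (b - a) (v - k • a) := by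
  simp [det3]; ring

lemma dot_cross_shift1 (a b v : E3) (k : ℝ) : dot3 (cross3 b a) (-v) = -dot3 (cross3 (b - a) a) (v - k • a) := by
  simp [dot3]; ring

lemma dot_cross_shift2 (a b v : E3) (k : ℝ) : dot3 (cross3 b a) (-v) = -dot3 (cross3 b a) (v - k • a) := by
  simp [dot3]; ring

lemma abs_dot_cross_le (a b c : E3) : |dot3 (cross3 a b) c| ≤ ‖a‖ * ‖b‖ * ‖c‖ :=
  (abs_dot3_le _ _).trans (by gcongr; exact norm_cross3_le _ _)

lemma cross_sub_self (a b : E3) : cross3 b a = cross3 (b - a) a := by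
  apply E3_ext <;> simp <;> ring

lemma antisym_aux {p q A1 A2 B1 B2 δ1 δ2 M : ℝ} (hM : 0 ≤ M) (h1 : |δ1| ≤ 1/2) (h2 : |δ2| ≤ 1/2)
    (hp : |p| ≤ M) (hq : |q| ≤ M) (hA1 : |A1| ≤ M * |δ1|^2) (hA2 : |A2| ≤ M * |δ2|^2)
    (hB1 : |B1| ≤ 2 * M * |δ1|^2) (hB2 : |B2| ≤ 2 * M * |δ2|^2) :
    |(δ1 * p + A1) * (δ2 * q + B2) - (δ2 * p + A2) * (δ1 * q + B1)| ≤ 4 * M^2 * (|δ1| * |δ2| * (|δ1| + |δ2|)) := by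
  have e : (δ1 * p + A1) * (δ2 * q + B2) - (δ2 * p + A2) * (δ1 * q + B1) =
    δ1 * p * B2 + A1 * (δ2 * q) + A1 * B2 + (-(δ2 * p * B1)) + (-(A2 * (δ1 * q))) + (-(A2 * B1)) := by ring
  rw [e]
  have t1 := abs_add_le (δ1 * p * B2 + A1 * (δ2 * q) + A1 * B2 + (-(δ2 * p * B1)) + (-(A2 * (δ1 * q)))) (-(A2 * B1))
  have t2 := abs_add_le (δ1 * p * B2 + A1 * (δ2 * q) + A1 * B2 + (-(δ2 * p * B1))) (-(A2 * (δ1 * q)))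
  have t3 := abs_add_le (δ1 * p * B2 + A1 * (δ2 * q) + A1 * B2) (-(δ2 * p * B1))
  have t4 := abs_add_le (δ1 * p * B2 + A1 * (δ2 * q)) (A1 * B2)
  have t5 := abs_add_le (δ1 * p * B2) (A1 * (δ2 * q))
  have u1 : |δ1 * p * B2| ≤ |δ1| * M * (2 * M * |δ2|^2) := by rw [abs_mul, abs_mul]; gcongr
  have u2 : |A1 * (δ2 * q)| ≤ (M * |δ1|^2) * (|δ2| * M) := by rw [abs_mul, abs_mul]; gcongr
  have u3 : |A1 * B2| ≤ (M * |δ1|^2) * (2 * M * |δ2|^2) := by rw [abs_mul]; gcongr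
  have u4 : |-(δ2 * p * B1)| ≤ |δ2| * M * (2 * M * |δ1|^2) := by rw [abs_neg, abs_mul, abs_mul]; gcongr
  have u5 : |-(A2 * (δ1 * q))| ≤ (M * |δ2|^2) * (|δ1| * M) := by rw [abs_neg, abs_mul, abs_mul]; gcongr
  have u6 : |-(A2 * B1)| ≤ (M * |δ2|^2) * (2 * M * |δ1|^2) := by rw [abs_neg, abs_mul]; gcongr
  have k : 4 * (|δ1| * |δ2|) ≤ |δ1| + |δ2| := by nlinarith [abs_nonneg δ1, abs_nonneg δ2]
  have k2 : M^2 * (|δ1| * |δ2|) * (4 * (|δ1| * |δ2|)) ≤ M^2 * (|δ1| * |δ2|) * (|δ1| + |δ2|) := by gcongr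
  nlinarith

section
variable {H : ℝ → ℝ → E3} {C : ℝ} {t : ℝ}

lemma Bd.pos (B : Bd H C) : 0 < C := lt_of_lt_of_le one_pos B.one

lemma Bd.H2' (B : Bd H C) (ht : t ∈ Icc (0:ℝ) 1) (x y : ℝ) :
    ‖H t y - H t x - sd (y - x) • pX H t y‖ ≤ 2 * C * |sd (y - x)|^2 := by
  have h1 := B.H2 t ht x y
  have h2 := B.lX t ht x y
  have e : H t y - H t x - sd (y - x) • pX H t y = 
    (H t y - H t x - sd (y - x) • pX H t x) - sd (y - x) • (pX H t y - pX H t x) := by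
    rw [smul_sub]; abel
  rw [e]
  refine (norm_sub_le _ _).trans ?_
  rw [norm_smul, Real.norm_eq_abs]
  calc _ ≤ C * |sd (y-x)|^2 + |sd (y-x)| * (C * |sd (y-x)|) := by gcongr
    _ = _ := by ring

lemma Bd.gnum (B : Bd H C) (ht : t ∈ Icc (0:ℝ) 1) (x y : ℝ) :
    |det3 (pX H t x) (pX H t y) (H t y - H t x)| ≤ C^3 * |sd (y - x)|^3 := by
  rw [det_Xdiff _ _ _ (sd (y - x))]
  refine (abs_det3_le _ _ _).trans ?_
  have := B.pos
  have h0 := B.nX t ht x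
  have h1 := B.H2 t ht x y
  have h2 := B.lX t ht x y
  calc _ ≤ C * (C * |sd (y - x)|) * (C * |sd (y-x)|^2) := by gcongr
    _ = _ := by ring

/-- Profiles dominated by the singular one. -/
def SubK (φ : ℝ → ℝ) : Prop := ∀ r, 0 < r → |φ (r^2)| ≤ (r^3)⁻¹

lemma sub_fS : SubK fS := by
  intro r hr
  rw [fS_sq hr]
  have hp := Real.pi_gt_three
  have : 1 / (4 * Real.pi) ≤ 1 := by rw [div_le_one (by positivity)]; linarith
  rw [abs_of_nonneg (by positivity)]
  calc _ ≤ 1 * (r^3)⁻¹ := by gcongr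
    _ = _ := one_mul _

lemma sub_fe {e : ℝ} (he : 0 < e) : SubK (fe e) := by
  intro r hr
  rw [abs_of_nonneg (fe_nonneg he hr.le)]
  exact (fe_le_fS he hr).trans ((le_abs_self _).trans (sub_fS r hr))

lemma gE_eq (φ : ℝ → ℝ) (x y : ℝ) : gE φ H t x y = φ (‖H t y - H t x‖^2) * det3 (pX H t x) (pX H t y) (H t y - H t x) := by
  rw [gE, GK, dot3_self]
  simp [det3]; ring

lemma Bd.gE_le (B : Bd H C) (ht : t ∈ Icc (0:ℝ) 1) {φ : ℝ → ℝ} (hφ : SubK φ) (x y : ℝ) :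
    |gE φ H t x y| ≤ C^6 := by
  have := B.pos
  rcases (norm_nonneg (H t y - H t x)).eq_or_lt with h | h
  · have h0 : H t y - H t x = 0 := norm_eq_zero.1 h.symm
    rw [gE, h0]; simp [GK, det3]; positivity
  · rw [gE_eq, abs_mul]
    have h1 := B.gnum ht x y
    have h2 := B.low t ht x y
    have h3 := hφ _ h
    calc _ ≤ (‖H t y - H t x‖^3)⁻¹ * (C^3 * (C * ‖H t y - H t x‖)^3) := by
          gcongr
          exact h1.trans (by gcongr)
      _ = _ := by field_simp

lemma Wv_eq (e u v w : ℝ) (a : E3) : WE (fe e) H t u v w (H t u + a) = 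
    Wv e (H t u - H t v) (H t u - H t w) (cross3 (pX H t v) (pX H t u)) (cross3 (pX H t w) (pX H t u))
      (cross3 (pT H t v - pT H t u) (pX H t v)) (cross3 (pT H t w - pT H t u) (pX H t w)) a := by
  have e1 : H t u + a - H t v = H t u - H t v + a := by abel
  have e2 : H t u + a - H t w = H t u - H t w + a := by abel
  simp only [WE, bE, cE, lE, GK, Wv, Ph, e1, e2]
  generalize fe e (dot3 (H t u - H t v + a) (H t u - H t v + a)) = f1
  generalize fe e (dot3 (H t u - H t w + a) (H t u - H t w + a)) = f2
  generalize H t u - H t v + a = p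
  generalize H t u - H t w + a = q
  simp [dot3, det3]
  ring

theorem Bd.E2_le (B : Bd H C) (ht : t ∈ Icc (0:ℝ) 1) {e : ℝ} (he : 0 < e) (u v w : ℝ) 
    (hv : sd (v - u) ≠ 0) (hw : sd (w - u) ≠ 0) :
    |E2E (fe e) (fe' e) H t u v w| ≤ (768 * (4 * C^4)^4)^2 * (40 * (4*C^4)^3) * 
      (Real.sqrt e * (wt |sd (v - u)| * wt |sd (w - u)|)) := by
  have hC := B.pos
  have h1 := B.one
  have p1 : C ≤ C^4 := le_self_pow₀ h1 (by norm_num)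
  have p2 : C^2 ≤ C^4 := pow_le_pow_right₀ h1 (by norm_num)
  have p3 : C^3 ≤ C^4 := pow_le_pow_right₀ h1 (by norm_num)
  have hlow : ∀ v, |sd (v - u)| ≤ 4 * C^4 * ‖H t u - H t v‖ := by
    intro v
    refine (B.low t ht u v).trans ?_
    rw [norm_sub_rev]; gcongr; linarith
  have hα : ∀ v, ‖cross3 (pX H t v) (pX H t u)‖ ≤ 4 * C^4 * |sd (v - u)| := by
    intro v
    rw [cross_sub_self]
    refine (norm_cross3_le _ _).trans ?_
    have a1 := B.lX t ht u v
    have a2 := B.nX t ht u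
    calc _ ≤ (C * |sd (v-u)|) * C := by gcongr
      _ = C^2 * |sd (v-u)| := by ring
      _ ≤ _ := by gcongr; linarith
  have hαd : ∀ v, |dot3 (cross3 (pX H t v) (pX H t u)) (H t u - H t v)| ≤ 4 * C^4 * |sd (v - u)|^3 := by
    intro v
    rw [← neg_sub (H t v) (H t u), dot_cross_shift1 _ _ _ (sd (v - u)), abs_neg]
    refine (abs_dot_cross_le _ _ _).trans ?_
    have a1 := B.lX t ht u v
    have a2 := B.nX t ht u
    have a3 := B.H2 t ht u v
    calc _ ≤ (C * |sd (v-u)|) * C * (C * |sd (v-u)|^2) := by gcongr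
      _ = C^3 * |sd (v-u)|^3 := by ring
      _ ≤ _ := by gcongr; linarith
  have hb : ∀ v, ‖cross3 (pT H t v - pT H t u) (pX H t v)‖ ≤ 4 * C^4 * |sd (v - u)| := by
    intro v
    refine (norm_cross3_le _ _).trans ?_
    have a1 := B.lT t ht u v
    have a2 := B.nX t ht v
    calc _ ≤ (C * |sd (v-u)|) * C := by gcongr
      _ = C^2 * |sd (v-u)| := by ring
      _ ≤ _ := by gcongr; linarith
  have hbd : ∀ v, |dot3 (cross3 (pT H t v - pT H t u) (pX H t v)) (H t u - H t v)| ≤ 4 * C^4 * |sd (v - u)|^3 := by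
    intro v
    rw [← neg_sub (H t v) (H t u), dot_cross_shift2 _ _ _ (sd (v - u)), abs_neg]
    refine (abs_dot_cross_le _ _ _).trans ?_
    have a1 := B.lT t ht u v
    have a2 := B.nX t ht v
    have a3 := B.H2' ht u v
    calc _ ≤ (C * |sd (v-u)|) * C * (2 * C * |sd (v-u)|^2) := by gcongr
      _ = 2 * C^3 * |sd (v-u)|^3 := by ring
      _ ≤ _ := by gcongr; linarith
  have hq : ∀ a, |dot3 (cross3 (pX H t v) (pX H t u)) a * dot3 (cross3 (pT H t w - pT H t u) (pX H t w)) a -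
      dot3 (cross3 (pX H t w) (pX H t u)) a * dot3 (cross3 (pT H t v - pT H t u) (pX H t v)) a| ≤
      4 * C^4 * (|sd (v - u)| * |sd (w - u)| * (|sd (v - u)| + |sd (w - u)|)) * ‖a‖^2 := by
    intro a
    have d1 : ∀ v, dot3 (cross3 (pX H t v) (pX H t u)) a = sd (v - u) * dot3 (cross3 (pX (pX H) t u) (pX H t u)) a
        + dot3 (cross3 (pX H t v - pX H t u - sd (v - u) • pX (pX H) t u) (pX H t u)) a := by
      intro v; simp [dot3]; ring
    have d2 : ∀ v, dot3 (cross3 (pT H t v - pT H t u) (pX H t v)) a = 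
        sd (v - u) * dot3 (cross3 (pX (pT H) t u) (pX H t u)) a
        + (dot3 (cross3 (pT H t v - pT H t u) (pX H t v - pX H t u)) a +
          dot3 (cross3 (pT H t v - pT H t u - sd (v - u) • pX (pT H) t u) (pX H t u)) a) := by
      intro v; simp [dot3]; ring
    rw [d1 v, d1 w, d2 v, d2 w]
    have nXu := B.nX t ht u
    have nX'u := B.nX' t ht u
    have nT'u := B.nT' t ht u
    have bA : ∀ v, |dot3 (cross3 (pX H t v - pX H t u - sd (v - u) • pX (pX H) t u) (pX H t u)) a| ≤ C^2 * ‖a‖ * |sd (v-u)|^2 := by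
      intro v
      refine (abs_dot_cross_le _ _ _).trans ?_
      have := B.X2 t ht u v
      calc _ ≤ (C * |sd (v-u)|^2) * C * ‖a‖ := by gcongr
        _ = _ := by ring
    have bB : ∀ v, |(dot3 (cross3 (pT H t v - pT H t u) (pX H t v - pX H t u)) a +
          dot3 (cross3 (pT H t v - pT H t u - sd (v - u) • pX (pT H) t u) (pX H t u)) a)| ≤ 2 * (C^2 * ‖a‖) * |sd (v-u)|^2 := by
      intro v
      refine (abs_add_le _ _).trans ?_
      have h1 := B.T2 t ht u v
      have h2 := B.lT t ht u v
      have h3 := B.lX t ht u v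
      have k1 := abs_dot_cross_le (pT H t v - pT H t u) (pX H t v - pX H t u) a
      have k2 := abs_dot_cross_le (pT H t v - pT H t u - sd (v - u) • pX (pT H) t u) (pX H t u) a
      calc _ ≤ (C * |sd (v-u)|) * (C * |sd (v-u)|) * ‖a‖ + (C * |sd (v-u)|^2) * C * ‖a‖ := 
            add_le_add (k1.trans (by gcongr)) (k2.trans (by gcongr))
        _ = _ := by ring
    have bp : |dot3 (cross3 (pX (pX H) t u) (pX H t u)) a| ≤ C^2 * ‖a‖ :=
      (abs_dot_cross_le _ _ _).trans (by rw [pow_two]; gcongr)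
    have bq : |dot3 (cross3 (pX (pT H) t u) (pX H t u)) a| ≤ C^2 * ‖a‖ :=
      (abs_dot_cross_le _ _ _).trans (by rw [pow_two]; gcongr)
    refine (antisym_aux (by positivity) (abs_sd_le _) (abs_sd_le _) bp bq (bA v) (bA w) (bB v) (bB w)).trans_eq ?_
    ring
  have := E2_vec he (C := 4 * C^4) (by linarith) (abs_pos.2 hv) (abs_pos.2 hw)
    ((abs_sd_le _).trans (by norm_num)) ((abs_sd_le _).trans (by norm_num)) (hlow v) (hlow w)
    (hα v) (hαd v) (hα w) (hαd w) (hb v) (hbd v) (hb w) (hbd w) hq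
  unfold E2E
  have e0 : QE (fe e) H t u v w = WE (fe e) H t u v w (H t u + 0) := by rw [add_zero, WE_at]
  rw [e0]
  simp only [Wv_eq]
  exact this

lemma err_num {e δ C : ℝ} (he : 0 < e) (hδ : 0 < δ) (hC : 1 ≤ C) (h : δ ≤ C * e) :
    (e^3)⁻¹ * δ^2 ≤ C^4 * (Real.sqrt e * (wt δ * wt δ)) := by
  obtain ⟨p, hp, rfl⟩ := exists_fourth hδ
  obtain ⟨e, he', rfl⟩ := exists_fourth he
  rw [sqrt_fourth he', wt_fourth hp]
  have h1 : (p/e)^4 ≤ C := by rw [div_pow, div_le_iff₀ (by positivity)]; exact h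
  have h2 : (p/e)^14 ≤ C^4 := by
    rcases le_or_gt (p/e) 1 with g | g
    · exact (pow_le_one₀ (by positivity) g).trans (one_le_pow₀ hC)
    · calc (p/e)^14 ≤ (p/e)^16 := pow_le_pow_right₀ g.le (by norm_num)
        _ = ((p/e)^4)^4 := by ring
        _ ≤ C^4 := by gcongr
  calc _ = (p/e)^14 * (e^2 * ((p^3)⁻¹ * (p^3)⁻¹)) := by field_simp
    _ ≤ _ := by gcongr

lemma wt_nonneg {r : ℝ} (hr : 0 ≤ r) : 0 ≤ wt r := Real.rpow_nonneg hr _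

theorem Bd.err_le (B : Bd H C) (ht : t ∈ Icc (0:ℝ) 1) {e : ℝ} (he : 0 < e) (x y : ℝ) :
    |errE (fe e) (fe' e) H t x y| ≤ C^7 * (Real.sqrt e * (wt |sd (y - x)| * wt |sd (y - x)|)) := by
  have hC := B.pos
  have hw := wt_nonneg (abs_nonneg (sd (y - x)))
  unfold errE
  by_cases h0 : rhoK (fe e) (fe' e) (H t y - H t x) = 0
  · rw [h0]; simp; positivity
  have hs := rho_supp he h0
  have hlow := B.low t ht x y
  have hd : |det3 (pX H t x) (pX H t y) (pT H t y - pT H t x)| ≤ C^3 * |sd (y-x)|^2 := by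
    have : det3 (pX H t x) (pX H t y) (pT H t y - pT H t x) = det3 (pX H t x) (pX H t y - pX H t x) (pT H t y - pT H t x) := by
      have := det_Xdiff (pX H t x) (pX H t y) (pT H t y - pT H t x) 0
      simpa using this
    rw [this]
    refine (abs_det3_le _ _ _).trans ?_
    have h0 := B.nX t ht x
    have h1 := B.lT t ht x y
    have h2 := B.lX t ht x y
    calc _ ≤ C * (C * |sd (y - x)|) * (C * |sd (y-x)|) := by gcongr
      _ = _ := by ring
  rw [abs_mul, abs_of_nonneg (rho_nonneg he _)]
  have hr := rho_le he (H t y - H t x)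
  calc _ ≤ (e^3)⁻¹ * (C^3 * |sd (y-x)|^2) := by gcongr
    _ = C^3 * ((e^3)⁻¹ * |sd (y-x)|^2) := by ring
    _ ≤ C^3 * (C^4 * (Real.sqrt e * (wt |sd (y - x)| * wt |sd (y - x)|))) := by
        refine mul_le_mul_of_nonneg_left ?_ (by positivity)
        rcases (abs_nonneg (sd (y - x))).eq_or_lt with h | h
        · rw [← h] at hw ⊢; simp; positivity
        · exact err_num he h B.one (hlow.trans (by gcongr))
    _ = _ := by ring
end

end

section

open MeasureTheory Set

/-! ### Bound for the tripod integrand -/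

noncomputable def mm (d : ℝ) : ℝ := min (d ^ (-(1/4) : ℝ)) ((d^2)⁻¹)
noncomputable def Bf (d : ℝ) : ℝ := (d^2)⁻¹ * mm d ^ 2

lemma mm_nonneg {d : ℝ} (h : 0 ≤ d) : 0 ≤ mm d := le_min (Real.rpow_nonneg h _) (by positivity)
lemma Bf_nonneg {d : ℝ} : 0 ≤ Bf d := by unfold Bf; positivity

lemma ratio_le {r d q C : ℝ} (hr : 0 ≤ r) (hr1 : r ≤ 1) (hd : 0 < d) (hdq : d ≤ q) (hC : 1 ≤ C) 
    (h : r ≤ C * q) : r * (q^2)⁻¹ ≤ C^2 * (mm d * wt r) := by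
  rcases hr.eq_or_lt with h0 | h0
  · rw [← h0]; simp
    have := mm_nonneg hd.le; have := wt_nonneg (le_refl (0:ℝ)); positivity
  have hq : 0 < q := lt_of_lt_of_le hd hdq
  unfold mm
  obtain ⟨p, hp, rfl⟩ := exists_fourth h0
  rw [wt_fourth hp]
  have hp1 : p ≤ 1 := by
    by_contra hh; push Not at hh
    have := one_lt_pow₀ hh (n := 4) (by norm_num); linarith
  have hC2 : 1 ≤ C^2 := one_le_pow₀ hC
  have key : p^7 * (q^2)⁻¹ ≤ C^2 * min (d ^ (-(1/4) : ℝ)) ((d^2)⁻¹) := by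
    rw [mul_min_of_nonneg _ _ (by positivity)]
    apply le_min
    · have h1 : d ^ (-(1/4) : ℝ) ≥ q ^ (-(1/4) : ℝ) := Real.rpow_le_rpow_of_nonpos hd hdq (by norm_num)
      refine le_trans ?_ (mul_le_mul_of_nonneg_left h1 (by positivity))
      obtain ⟨s, hs, rfl⟩ := exists_fourth hq
      have e1 : (s^4) ^ (-(1/4) : ℝ) = s⁻¹ := by
        rw [← Real.rpow_natCast s 4, ← Real.rpow_mul hs.le]
        norm_num
        rw [Real.rpow_neg_one]
      rw [e1]
      have h2 : (p/s)^4 ≤ C := by rw [div_pow, div_le_iff₀ (by positivity)]; exact h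
      have h3 : (p/s)^7 ≤ C^2 := by
        rcases le_or_gt (p/s) 1 with g | g
        · exact (pow_le_one₀ (by positivity) g).trans hC2
        · calc (p/s)^7 ≤ (p/s)^8 := pow_le_pow_right₀ g.le (by norm_num)
            _ = ((p/s)^4)^2 := by ring
            _ ≤ C^2 := by gcongr
      calc _ = (p/s)^7 * s⁻¹ := by field_simp
        _ ≤ _ := by gcongr
    · have : p^7 ≤ 1 := pow_le_one₀ hp.le hp1
      calc p^7 * (q^2)⁻¹ ≤ 1 * (d^2)⁻¹ := by gcongr
        _ ≤ C^2 * (d^2)⁻¹ := by gcongr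
  calc p^4 * (q^2)⁻¹ = (p^7 * (q^2)⁻¹) * (p^3)⁻¹ := by field_simp
    _ ≤ (C^2 * min (d ^ (-(1/4) : ℝ)) ((d^2)⁻¹)) * (p^3)⁻¹ := by gcongr
    _ = _ := by ring

section
variable {H : ℝ → ℝ → E3} {C : ℝ} {t : ℝ}

lemma DE_cyc (φ : ℝ → ℝ) (u v w : ℝ) (y : E3) : DE φ H t u v w y = DE φ H t v w u y := by
  simp only [DE, det3]; ring

lemma det_sub2 (a b c : E3) : det3 a b c = det3 a (b - a) (c - a) := by simp [det3]; ring

lemma bE_smul (φ : ℝ → ℝ) (u : ℝ) (y : E3) : bE φ H t u y = φ (‖y - H t u‖^2) • cross3 (y - H t u) (pX H t u) := by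
  rw [bE, GK, dot3_self]; apply E3_ext <;> simp <;> ring

lemma det3_smul3 (a b c : ℝ) (u v w : E3) : det3 (a • u) (b • v) (c • w) = a * b * c * det3 u v w := by
  simp [det3]; ring

lemma bE_self (φ : ℝ → ℝ) (u : ℝ) : bE φ H t u (H t u) = 0 := by
  rw [bE_smul]; apply E3_ext <;> simp

lemma DE_self (φ : ℝ → ℝ) (u v w : ℝ) : DE φ H t u v w (H t u) = 0 := by
  rw [DE, bE_self]; simp [det3]

lemma Bd.cross_diff (B : Bd H C) (ht : t ∈ Icc (0:ℝ) 1) (u v : ℝ) (y : E3) :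
    ‖cross3 (y - H t v) (pX H t v) - cross3 (y - H t u) (pX H t u)‖ ≤ 
      2 * C^2 * (|sd (v - u)| * (‖y - H t u‖ + |sd (v - u)|)) := by
  have e : cross3 (y - H t v) (pX H t v) - cross3 (y - H t u) (pX H t u) =
    cross3 (y - H t u) (pX H t v - pX H t u) - cross3 (H t v - H t u - sd (v - u) • pX H t v) (pX H t v) := by
    apply E3_ext <;> simp <;> ring
  rw [e]
  have hC := B.pos
  have h1 := B.one
  have a1 := B.lX t ht u v
  have a2 := B.nX t ht v
  have a3 := B.H2' ht u v
  calc _ ≤ ‖y - H t u‖ * (C * |sd (v-u)|) + (2 * C * |sd (v-u)|^2) * C := by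
        refine (norm_sub_le _ _).trans (add_le_add ((norm_cross3_le _ _).trans (by gcongr)) ((norm_cross3_le _ _).trans (by gcongr)))
    _ ≤ _ := by
        have h2 : C ≤ 2 * C^2 := by nlinarith
        have : C * (|sd (v-u)| * ‖y - H t u‖) ≤ 2 * C^2 * (|sd (v-u)| * ‖y - H t u‖) := by gcongr
        nlinarith

noncomputable def St (H : ℝ → ℝ → E3) (t u v w : ℝ) (y : E3) : ℝ :=
  Bf ‖y - H t u‖ * (wt |sd (v - u)| * wt |sd (w - u)|)

lemma St_nonneg (u v w : ℝ) (y : E3) : 0 ≤ St H t u v w y := by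
  have := wt_nonneg (abs_nonneg (sd (v - u)))
  have := wt_nonneg (abs_nonneg (sd (w - u)))
  have := Bf_nonneg (d := ‖y - H t u‖)
  unfold St; positivity

lemma Bd.D_le_min (B : Bd H C) (ht : t ∈ Icc (0:ℝ) 1) {φ : ℝ → ℝ} (hφ : SubK φ) (u v w : ℝ) (y : E3)
    (hv : ‖y - H t u‖ ≤ ‖y - H t v‖) (hw : ‖y - H t u‖ ≤ ‖y - H t w‖) :
    |DE φ H t u v w y| ≤ 576 * C^11 * St H t u v w y := by
  have hC := B.pos
  have h1 := B.one
  have hSt := St_nonneg (H := H) (t := t) u v w y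
  rcases (norm_nonneg (y - H t u)).eq_or_lt with h0 | h0
  · have : y = H t u := by rw [← sub_eq_zero]; exact norm_eq_zero.1 h0.symm
    rw [this] at hSt ⊢
    rw [DE_self]; simp; positivity
  have low : ∀ v, ‖y - H t u‖ ≤ ‖y - H t v‖ → |sd (v - u)| ≤ 2 * C * ‖y - H t v‖ := by
    intro v hv
    have := B.low t ht u v
    have h3 : ‖H t v - H t u‖ ≤ 2 * ‖y - H t v‖ := by
      have : H t v - H t u = (y - H t u) - (y - H t v) := by abel
      rw [this]; exact (norm_sub_le _ _).trans (by linarith)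
    calc _ ≤ C * ‖H t v - H t u‖ := this
      _ ≤ C * (2 * ‖y - H t v‖) := by gcongr
      _ = _ := by ring
  have cd : ∀ v, ‖y - H t u‖ ≤ ‖y - H t v‖ → 
      ‖cross3 (y - H t v) (pX H t v) - cross3 (y - H t u) (pX H t u)‖ ≤ 6 * C^3 * (|sd (v - u)| * ‖y - H t v‖) := by
    intro v hv
    refine (B.cross_diff ht u v y).trans ?_
    have := low v hv
    calc _ ≤ 2 * C^2 * (|sd (v - u)| * (C * ‖y - H t v‖ + 2 * C * ‖y - H t v‖)) := by
          gcongr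
          exact hv.trans (le_mul_of_one_le_left (norm_nonneg _) h1)
      _ = _ := by ring
  have rt : ∀ v, ‖y - H t u‖ ≤ ‖y - H t v‖ → |φ (‖y - H t v‖^2)| * (|sd (v - u)| * ‖y - H t v‖) ≤ 
      (2 * C)^2 * (mm ‖y - H t u‖ * wt |sd (v - u)|) := by
    intro v hv
    have hp : 0 < ‖y - H t v‖ := lt_of_lt_of_le h0 hv
    refine le_trans ?_ (ratio_le (abs_nonneg _) ((abs_sd_le _).trans (by norm_num)) h0 hv (by linarith) (low v hv))
    have := hφ _ hp
    calc _ ≤ (‖y - H t v‖^3)⁻¹ * (|sd (v - u)| * ‖y - H t v‖) := by gcongr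
      _ = _ := by field_simp
  have h2 := mul_le_mul (rt v hv) (rt w hw) (by positivity) 
    (by have := mm_nonneg h0.le; have := wt_nonneg (abs_nonneg (sd (v-u))); positivity)
  have nX := B.nX t ht u
  have f1 := hφ _ h0
  rw [DE, bE_smul, bE_smul, bE_smul, det3_smul3, det_sub2, abs_mul, abs_mul, abs_mul]
  have hd : |det3 (cross3 (y - H t u) (pX H t u)) (cross3 (y - H t v) (pX H t v) - cross3 (y - H t u) (pX H t u))
     (cross3 (y - H t w) (pX H t w) - cross3 (y - H t u) (pX H t u))| ≤ 
      (‖y - H t u‖ * C) * (6 * C^3 * (|sd (v - u)| * ‖y - H t v‖)) * (6 * C^3 * (|sd (w - u)| * ‖y - H t w‖)) := by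
    refine (abs_det3_le _ _ _).trans ?_
    have k1 := cd v hv
    have k2 := cd w hw
    have k3 := (norm_cross3_le (y - H t u) (pX H t u)).trans (mul_le_mul_of_nonneg_left nX (norm_nonneg _))
    gcongr
  calc _ ≤ |φ (‖y - H t u‖^2)| * |φ (‖y - H t v‖^2)| * |φ (‖y - H t w‖^2)| * 
        ((‖y - H t u‖ * C) * (6 * C^3 * (|sd (v - u)| * ‖y - H t v‖)) * (6 * C^3 * (|sd (w - u)| * ‖y - H t w‖))) := by gcongr
    _ = 36 * C^7 * ((|φ (‖y - H t u‖^2)| * ‖y - H t u‖) * ((|φ (‖y - H t v‖^2)| * (|sd (v - u)| * ‖y - H t v‖)) * 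
         (|φ (‖y - H t w‖^2)| * (|sd (w - u)| * ‖y - H t w‖)))) := by ring
    _ ≤ 36 * C^7 * (((‖y - H t u‖^3)⁻¹ * ‖y - H t u‖) * (((2 * C)^2 * (mm ‖y - H t u‖ * wt |sd (v - u)|)) *
         ((2 * C)^2 * (mm ‖y - H t u‖ * wt |sd (w - u)|)))) := by
        gcongr
    _ = _ := by rw [St, Bf]; field_simp; ring

theorem Bd.D_le (B : Bd H C) (ht : t ∈ Icc (0:ℝ) 1) {φ : ℝ → ℝ} (hφ : SubK φ) (u v w : ℝ) (y : E3) :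
    |DE φ H t u v w y| ≤ 576 * C^11 * (St H t u v w y + St H t v w u y + St H t w u v y) := by
  have hC := B.pos
  have s1 := St_nonneg (H := H) (t := t) u v w y
  have s2 := St_nonneg (H := H) (t := t) v w u y
  have s3 := St_nonneg (H := H) (t := t) w u v y
  have p : 0 < 576 * C^11 := by positivity
  rcases le_total ‖y - H t u‖ ‖y - H t v‖ with h1 | h1
  · rcases le_total ‖y - H t u‖ ‖y - H t w‖ with h2 | h2
    · exact (B.D_le_min ht hφ u v w y h1 h2).trans (by gcongr; linarith)
    · rw [DE_cyc, DE_cyc]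
      exact (B.D_le_min ht hφ w u v y h2 (h2.trans h1)).trans (by gcongr; linarith)
  · rcases le_total ‖y - H t v‖ ‖y - H t w‖ with h2 | h2
    · rw [DE_cyc]
      exact (B.D_le_min ht hφ v w u y h2 h1).trans (by gcongr; linarith)
    · rw [DE_cyc, DE_cyc]
      exact (B.D_le_min ht hφ w u v y (h2.trans h1) h2).trans (by gcongr; linarith)

lemma Bd.G_far (B : Bd H C) (ht : t ∈ Icc (0:ℝ) 1) {φ : ℝ → ℝ} (hφ : SubK φ) (u : ℝ) {y : E3} {e : ℝ} (he : 0 < e)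
    (he2 : e * (2 * C) ≤ 1) (hy : 1 ≤ e * ‖y‖) : ‖GK φ (y - H t u)‖ ≤ 4 * e^2 := by
  have hC := B.pos
  have h1 := B.nH t ht u
  have h2 : ‖y‖ ≤ ‖y - H t u‖ + ‖H t u‖ := by simpa using norm_add_le (y - H t u) (H t u)
  have h3 : 1 ≤ 2 * e * ‖y - H t u‖ := by nlinarith
  have hp : 0 < ‖y - H t u‖ := by
    by_contra h; push Not at h; nlinarith [norm_nonneg (y - H t u)]
  rw [GK, dot3_self, norm_smul, Real.norm_eq_abs]
  have f := hφ _ hp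
  calc _ ≤ (‖y - H t u‖^3)⁻¹ * ‖y - H t u‖ := by gcongr
    _ = (1 / ‖y - H t u‖)^2 := by field_simp
    _ ≤ (2 * e)^2 := by
      gcongr
      rw [div_le_iff₀ hp]; exact h3
    _ = _ := by ring

lemma Bd.V_far (B : Bd H C) (ht : t ∈ Icc (0:ℝ) 1) {φ : ℝ → ℝ} (hφ : SubK φ) (u v w : ℝ) {y : E3} {e : ℝ} (he : 0 < e)
    (he2 : e * (2 * C) ≤ 1) (hy : 1 ≤ e * ‖y‖) : ‖VE φ H t u v w y‖ ≤ 64 * C^4 * e^6 := by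
  have hC := B.pos
  have hb : ∀ v, ‖bE φ H t v y‖ ≤ 4 * e^2 * C := by
    intro v
    have g := B.G_far ht hφ v he he2 hy
    have nX := B.nX t ht v
    exact (norm_cross3_le _ _).trans (by gcongr)
  have hl : |lE φ H t u y| ≤ 4 * e^2 * C * C := by
    have g := B.G_far ht hφ u he he2 hy
    have nX := B.nX t ht u
    have nT := B.nT t ht u
    exact (abs_det3_le _ _ _).trans (by gcongr)
  rw [VE, norm_smul, Real.norm_eq_abs]
  calc _ ≤ (4 * e^2 * C * C) * ((4 * e^2 * C) * (4 * e^2 * C)) := by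
        gcongr
        have h1 := hb v
        have h2 := hb w
        exact (norm_cross3_le _ _).trans (by gcongr)
    _ = _ := by ring
end

end

section

open MeasureTheory Set

/-! ### Integrability of the majorants -/

lemma integrable_abs_rpow : Integrable (fun z : ℝ => (Set.Iio (3:ℝ)).indicator (fun r => r ^ (-(3/4) : ℝ)) |z|) := by
  have := (integrable_fun_norm_addHaar (E := ℝ) (F := ℝ) volume 
    (f := (Set.Iio (3:ℝ)).indicator (fun r => r ^ (-(3/4) : ℝ)))).2
  simp only [Real.norm_eq_abs] at this
  refine this ?_
  simp only [Module.finrank_self, Nat.sub_self, pow_zero, one_smul]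
  rw [integrableOn_indicator_iff measurableSet_Iio, inter_comm, Ioi_inter_Iio]
  rw [intervalIntegral.integrableOn_Ioo_rpow_iff (by norm_num)]
  norm_num

noncomputable def Wt (z : ℝ) : ℝ := wt |sd z|

lemma Wt_nonneg (z : ℝ) : 0 ≤ Wt z := wt_nonneg (abs_nonneg _)

lemma measurable_Wt : Measurable Wt := by
  unfold Wt wt sd
  have : Measurable (fun z : ℝ => (round z : ℝ)) := by
    simp only [round_eq]
    fun_prop
  fun_prop

lemma integrable_W : Integrable ((Icc (-1:ℝ) 1).indicator Wt) := by
  have h0 := integrable_abs_rpow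
  have h1 := h0.comp_sub_right 1
  have h2 := h0.comp_add_right 1
  refine ((h0.add h1).add h2).mono' (measurable_Wt.indicator measurableSet_Icc).aestronglyMeasurable ?_
  refine Filter.Eventually.of_forall fun z => ?_
  have nn : ∀ z : ℝ, 0 ≤ (Set.Iio (3:ℝ)).indicator (fun r => r ^ (-(3/4) : ℝ)) |z| := fun z =>
    by
      unfold Set.indicator
      split_ifs
      · exact Real.rpow_nonneg (abs_nonneg z) _
      · exact le_rfl
  simp only [Pi.add_apply]
  by_cases hz : z ∈ Icc (-1:ℝ) 1
  · rw [indicator_of_mem hz, Real.norm_of_nonneg (Wt_nonneg z)]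
    have hz1 := hz.1
    have hz2 := hz.2
    have hs : |sd z| ≤ 1/2 := abs_sd_le z
    have n1 := nn z
    have n2 := nn (z - 1)
    have n3 := nn (z + 1)
    have key : ∀ w : ℝ, |w| ≤ 1/2 → (Set.Iio (3:ℝ)).indicator (fun r => r ^ (-(3/4) : ℝ)) |w| = wt |w| := by
      intro w hw
      rw [indicator_of_mem (by simp only [mem_Iio]; linarith)]; rfl
    have : (round z : ℤ) = 0 ∨ (round z : ℤ) = 1 ∨ (round z : ℤ) = -1 := by
      have h := abs_le.1 hs
      unfold sd at h
      have a1 : (round z : ℝ) < 2 := by linarith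
      have a2 : (-2:ℝ) < (round z : ℝ) := by linarith
      have a1' : round z < 2 := by exact_mod_cast a1
      have a2' : -2 < round z := by exact_mod_cast a2
      omega
    unfold Wt
    rcases this with h | h | h
    · have e : sd z = z := by simp [sd, h]
      rw [e] at hs ⊢; rw [← key _ hs]; linarith
    · have e : sd z = z - 1 := by simp [sd, h]
      rw [e] at hs ⊢; rw [← key _ hs]; linarith
    · have e : sd z = z + 1 := by simp [sd, h]
      rw [e] at hs ⊢; rw [← key _ hs]; linarith
  · rw [indicator_of_notMem hz, norm_zero]
    have n1 := nn z
    have n2 := nn (z - 1)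
    have n3 := nn (z + 1)
    positivity

lemma mp_shear {n : ℕ} (i j : Fin n) (h : j ≠ i) :
    MeasurePreserving (fun x : Fin n → ℝ => Function.update x j (x j - x i)) := by
  convert! Real.volume_preserving_transvectionStruct (⟨j, i, h, -1⟩ : Matrix.TransvectionStruct (Fin n) ℝ) using 1
  funext x k
  simp [Matrix.TransvectionStruct.toMatrix, Matrix.transvection, Matrix.add_mulVec, Matrix.single_mulVec]
  by_cases hk : k = j
  · subst hk; simp; ring
  · simp [hk]

theorem star_integrable {n : ℕ} (i j k : Fin n) (hj : j ≠ i) (hk : k ≠ i) (hjk : j ≠ k) :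
    IntegrableOn (fun x : Fin n → ℝ => Wt (x j - x i) * Wt (x k - x i)) (Icc (fun _ => 0) (fun _ => 1)) := by
  set f : Fin n → ℝ → ℝ := fun m => if m = j ∨ m = k then (Icc (-1:ℝ) 1).indicator Wt else (Icc (0:ℝ) 1).indicator 1 with hf
  have h1 : Integrable (fun x : Fin n → ℝ => ∏ m, f m (x m)) := by
    apply Integrable.fintype_prod
    intro m
    simp only [hf]
    split_ifs
    · exact integrable_W
    · rw [integrable_indicator_iff measurableSet_Icc]
      exact integrableOn_const (by simp)
  have mp := (mp_shear i k hk).comp (mp_shear i j hj)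
  have h2 := (mp.integrable_comp h1.aestronglyMeasurable).2 h1
  refine (h2.integrableOn (s := Icc (fun _ => 0) (fun _ => 1))).congr_fun ?_ measurableSet_Icc
  intro x hx
  have hx0 : ∀ m, 0 ≤ x m := fun m => hx.1 m
  have hx1 : ∀ m, x m ≤ 1 := fun m => hx.2 m
  simp only [Function.comp]
  have hki : k ≠ j := hjk.symm
  rw [Finset.prod_eq_mul j k hjk]
  · simp only [hf]
    have m1 : x j - x i ∈ Icc (-1:ℝ) 1 := ⟨by linarith [hx0 j, hx1 i], by linarith [hx1 j, hx0 i]⟩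
    have m2 : x k - x i ∈ Icc (-1:ℝ) 1 := ⟨by linarith [hx0 k, hx1 i], by linarith [hx1 k, hx0 i]⟩
    simp [hjk, hki, hj.symm, hk.symm, -mem_Icc, m1, m2]
  · intro m _ ⟨a, b⟩
    simp [hf, a, b, hx0 m, hx1 m]
  · simp
  · simp

lemma integrable_Bf : Integrable (fun y : E3 => Bf ‖y‖) := by
  rw [integrable_fun_norm_addHaar (E := E3) (F := ℝ) volume]
  have hm : Measurable (fun y : ℝ => y ^ (Module.finrank ℝ E3 - 1) • Bf y) := by
    unfold Bf mm
    simp only [smul_eq_mul]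
    fun_prop
  have : Module.finrank ℝ E3 - 1 = 2 := by simp
  rw [this] at hm ⊢
  rw [← Ioc_union_Ioi_eq_Ioi (zero_le_one : (0:ℝ) ≤ 1)]
  apply IntegrableOn.union
  · rw [integrableOn_Ioc_iff_integrableOn_Ioo]
    have := (intervalIntegral.integrableOn_Ioo_rpow_iff (s := -(1/2)) (t := (1:ℝ)) one_pos).2 (by norm_num)
    refine Integrable.mono' this hm.aestronglyMeasurable ?_
    refine ae_restrict_of_forall_mem measurableSet_Ioo fun y hy => ?_
    have hy0 := hy.1
    have n := Bf_nonneg (d := y)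
    rw [smul_eq_mul, Real.norm_of_nonneg (by positivity)]
    unfold Bf
    have e : y^2 * ((y^2)⁻¹ * mm y ^ 2) = mm y ^ 2 := by field_simp
    rw [e]
    calc mm y ^ 2 ≤ (y ^ (-(1/4) : ℝ))^2 := by
          gcongr
          · exact mm_nonneg hy0.le
          · exact min_le_left _ _
      _ = _ := by rw [← Real.rpow_natCast, ← Real.rpow_mul hy0.le]; norm_num
  · have := (integrableOn_Ioi_rpow_iff (s := -4) (t := (1:ℝ)) one_pos).2 (by norm_num)
    refine Integrable.mono' this hm.aestronglyMeasurable ?_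
    refine ae_restrict_of_forall_mem measurableSet_Ioi fun y hy => ?_
    have hy0 : 0 < y := lt_trans one_pos hy
    have n := Bf_nonneg (d := y)
    rw [smul_eq_mul, Real.norm_of_nonneg (by positivity)]
    unfold Bf
    have e : y^2 * ((y^2)⁻¹ * mm y ^ 2) = mm y ^ 2 := by field_simp
    rw [e]
    calc mm y ^ 2 ≤ ((y^2)⁻¹)^2 := by
          gcongr
          · exact mm_nonneg hy0.le
          · exact min_le_right _ _
      _ = y ^ (-4 : ℝ) := by
          rw [Real.rpow_neg hy0.le]; norm_cast; rw [← inv_pow, ← inv_pow]; ring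

/-- The majorant of the tripod integrand is integrable. -/
theorem star_integrable_St {K : ℝ → E3} (hK : Continuous K) (i j k : Fin 3) (hj : j ≠ i) (hk : k ≠ i) (hjk : j ≠ k) :
    IntegrableOn (fun z : (Fin 3 → ℝ) × E3 => Bf ‖z.2 - K (z.1 i)‖ * (Wt (z.1 j - z.1 i) * Wt (z.1 k - z.1 i)))
      (simplex3 ×ˢ univ) := by
  have hs := (star_integrable i j k hj hk hjk).mono_set simplex3_subset
  unfold IntegrableOn at hs ⊢
  rw [Measure.volume_eq_prod, ← Measure.prod_restrict, Measure.restrict_univ]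
  have hB : Measurable Bf := by unfold Bf mm; fun_prop
  have hW := measurable_Wt
  have hKm := hK.measurable
  have hm : Measurable (fun z : (Fin 3 → ℝ) × E3 => Bf ‖z.2 - K (z.1 i)‖ * (Wt (z.1 j - z.1 i) * Wt (z.1 k - z.1 i))) := by
    fun_prop
  rw [integrable_prod_iff hm.aestronglyMeasurable]
  constructor
  · refine Filter.Eventually.of_forall fun x => ?_
    exact (integrable_Bf.comp_sub_right (K (x i))).mul_const (Wt (x j - x i) * Wt (x k - x i))
  · have e : (fun x : Fin 3 → ℝ => ∫ y : E3, ‖Bf ‖y - K (x i)‖ * (Wt (x j - x i) * Wt (x k - x i))‖) = 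
        fun x => (∫ y : E3, Bf ‖y‖) * (Wt (x j - x i) * Wt (x k - x i)) := by
      funext x
      have : ∀ y : E3, ‖Bf ‖y - K (x i)‖ * (Wt (x j - x i) * Wt (x k - x i))‖ = Bf ‖y - K (x i)‖ * (Wt (x j - x i) * Wt (x k - x i)) := by
        intro y
        have := Bf_nonneg (d := ‖y - K (x i)‖)
        have := Wt_nonneg (x j - x i)
        have := Wt_nonneg (x k - x i)
        rw [Real.norm_of_nonneg (by positivity)]
      simp only [this]
      rw [integral_mul_const, integral_sub_right_eq_self (fun y => Bf ‖y‖)]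
    simp only [e]
    exact hs.const_mul _

end

section

open MeasureTheory Set

/-! ### Derivative bound for the regularised functional -/

lemma dsT_zero_neg {x : ℝ} (h : x < 0) : deriv Real.smoothTransition x = 0 := by
  have : Real.smoothTransition =ᶠ[𝓝 x] fun _ => 0 := by
    filter_upwards [Iio_mem_nhds h] with y hy
    exact Real.smoothTransition.zero_of_nonpos (le_of_lt hy)
  rw [this.deriv_eq]; simp

lemma dsT_zero_pos {x : ℝ} (h : 1 < x) : deriv Real.smoothTransition x = 0 := by
  have : Real.smoothTransition =ᶠ[𝓝 x] fun _ => 1 := by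
    filter_upwards [Ioi_mem_nhds h] with y hy
    exact Real.smoothTransition.one_of_one_le (le_of_lt hy)
  rw [this.deriv_eq]; simp

lemma dsT_cont : Continuous (deriv Real.smoothTransition) :=
  (Real.smoothTransition.contDiff (n := 1)).continuous_deriv (by norm_num)

lemma dsT_bound : ∃ K0, ∀ x, |deriv Real.smoothTransition x| ≤ K0 := by
  obtain ⟨K0, h⟩ := (isCompact_Icc (a := (0:ℝ)) (b := 1)).exists_bound_of_continuousOn dsT_cont.continuousOn
  refine ⟨K0, fun x => ?_⟩
  have h0 : 0 ≤ K0 := (norm_nonneg _).trans (h 0 (by simp))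
  rcases lt_or_ge x 0 with g | g
  · rw [dsT_zero_neg g]; simpa
  rcases lt_or_ge 1 x with g' | g'
  · rw [dsT_zero_pos g']; simpa
  exact h x ⟨g, g'⟩

noncomputable def cc (e s : ℝ) : ℝ := Real.smoothTransition (2 - e^2 * s)
noncomputable def cc' (e s : ℝ) : ℝ := deriv Real.smoothTransition (2 - e^2 * s) * (-e^2)

lemma cutE {e : ℝ} (he : 0 < e) : Cut (cc e) (cc' e) (2/e) where
  prof := ⟨fun s => by
      have h1 : HasDerivAt Real.smoothTransition (deriv Real.smoothTransition (2 - e^2 * s)) (2 - e^2 * s) :=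
        ((Real.smoothTransition.contDiff (n := 1)).differentiable (by norm_num) _).hasDerivAt
      have h2 : HasDerivAt (fun s : ℝ => 2 - e^2 * s) (-e^2) s := by
        simpa using ((hasDerivAt_id s).const_mul (e^2)).const_sub 2
      exact h1.comp s h2, by
      unfold cc'
      exact (dsT_cont.comp (by fun_prop)).mul continuous_const⟩
  hR := by positivity
  z := fun s hs => by
    have : 4 ≤ e^2 * s := by
      calc (4:ℝ) = e^2 * (2/e)^2 := by field_simp; norm_num
        _ ≤ _ := by gcongr
    exact Real.smoothTransition.zero_of_nonpos (by linarith)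
  z' := fun s hs => by
    have : 4 ≤ e^2 * s := by
      calc (4:ℝ) = e^2 * (2/e)^2 := by field_simp; norm_num
        _ ≤ _ := by gcongr
    unfold cc'
    rw [dsT_zero_neg (by linarith)]; simp

lemma abs_sd_eq {z : ℝ} (h0 : 0 ≤ z) (h1 : z < 1) : |sd z| = min z (1 - z) := by
  rw [sd, abs_sub_round_eq_min, Int.fract_eq_self.2 ⟨h0, h1⟩]

lemma abs_sd_neg (z : ℝ) : |sd (-z)| = |sd z| := by
  unfold sd
  rw [abs_sub_round_eq_min, abs_sub_round_eq_min]
  by_cases h : Int.fract z = 0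
  · rw [Int.fract_neg_eq_zero.2 h, h]
  · rw [Int.fract_neg h, sub_sub_cancel, min_comm]

lemma Wt_neg (z : ℝ) : Wt (-z) = Wt z := by rw [Wt, abs_sd_neg, Wt]

lemma wt_anti {r s : ℝ} (hr : 0 < r) (h : r ≤ s) : wt s ≤ wt r :=
  Real.rpow_le_rpow_of_nonpos hr h (by norm_num)

lemma Wt_star {a b c : ℝ} (ha : 0 < a) (hab : a < b) (hb : b < 1) (hc : 0 < c) (hc1 : c < 1) (h : b ≤ c ∨ c ≤ 1 - b) :
    Wt b * Wt b ≤ Wt b * Wt a + Wt b * Wt c := by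
  have n := Wt_nonneg b
  have na := Wt_nonneg a
  have nc := Wt_nonneg c
  rw [← mul_add]
  refine mul_le_mul_of_nonneg_left ?_ n
  unfold Wt at *
  rw [abs_sd_eq (ha.trans hab).le hb, abs_sd_eq ha.le (hab.trans hb), abs_sd_eq hc.le hc1] at *
  rcases le_total b (1 - b) with g | g
  · have : wt (min b (1 - b)) ≤ wt (min a (1 - a)) := by
      apply wt_anti
      · exact lt_min ha (by linarith)
      · rw [min_eq_left g]; exact (min_le_left _ _).trans hab.le
    linarith
  · have : wt (min b (1 - b)) ≤ wt (min c (1 - c)) := by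
      apply wt_anti
      · exact lt_min hc (by linarith)
      · rw [min_eq_right g]
        rcases h with h | h
        · exact (min_le_right _ _).trans (by linarith)
        · exact (min_le_left _ _).trans h
    linarith

lemma sd_ne {x y : ℝ} (h : x < y) (h1 : y - x < 1) : sd (y - x) ≠ 0 := by
  rw [← abs_pos, abs_sd_eq (by linarith) h1]
  exact lt_min (by linarith) (by linarith)

lemma sd_ne' {x y : ℝ} (h : x < y) (h1 : y - x < 1) : sd (x - y) ≠ 0 := by
  rw [← abs_pos, ← neg_sub, abs_sd_neg]
  exact abs_pos.2 (sd_ne h h1)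

section
variable {H : ℝ → ℝ → E3} {C : ℝ} {t : ℝ}

/-- star majorant on the 4-simplex -/
noncomputable def M4 (x : Fin 4 → ℝ) : ℝ :=
  (Wt (x 2 - x 0) * Wt (x 1 - x 0) + Wt (x 2 - x 0) * Wt (x 3 - x 0)) +
  (Wt (x 3 - x 1) * Wt (x 2 - x 1) + Wt (x 3 - x 1) * Wt (x 0 - x 1))

lemma intM4 : IntegrableOn M4 simplex4 := by
  unfold M4
  have h1 := (star_integrable (n := 4) 0 2 1 (by decide) (by decide) (by decide)).mono_set simplex4_subset
  have h2 := (star_integrable (n := 4) 0 2 3 (by decide) (by decide) (by decide)).mono_set simplex4_subset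
  have h3 := (star_integrable (n := 4) 1 3 2 (by decide) (by decide) (by decide)).mono_set simplex4_subset
  have h4 := (star_integrable (n := 4) 1 3 0 (by decide) (by decide) (by decide)).mono_set simplex4_subset
  exact (h1.add h2).add (h3.add h4)

noncomputable def M3 (x : Fin 3 → ℝ) : ℝ :=
  Wt (x 1 - x 0) * Wt (x 2 - x 0) + Wt (x 2 - x 1) * Wt (x 0 - x 1) + Wt (x 0 - x 2) * Wt (x 1 - x 2)

lemma intM3 : IntegrableOn M3 simplex3 := by
  unfold M3
  have h1 := (star_integrable (n := 3) 0 1 2 (by decide) (by decide) (by decide)).mono_set simplex3_subset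
  have h2 := (star_integrable (n := 3) 1 2 0 (by decide) (by decide) (by decide)).mono_set simplex3_subset
  have h3 := (star_integrable (n := 3) 2 0 1 (by decide) (by decide) (by decide)).mono_set simplex3_subset
  exact (h1.add h2).add h3

lemma E1_bound (B : Bd H C) (ht : t ∈ Icc (0:ℝ) 1) {e : ℝ} (he : 0 < e) :
    |∫ x in simplex4, (errE (fe e) (fe' e) H t (x 0) (x 2) * gE (fe e) H t (x 1) (x 3) +
      gE (fe e) H t (x 0) (x 2) * errE (fe e) (fe' e) H t (x 1) (x 3))| ≤ (C^13 * ∫ x in simplex4, M4 x) * √e := by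
  have hC := B.pos
  have h := norm_integral_le_of_norm_le (μ := volume.restrict simplex4) 
    (f := fun x => errE (fe e) (fe' e) H t (x 0) (x 2) * gE (fe e) H t (x 1) (x 3) +
      gE (fe e) H t (x 0) (x 2) * errE (fe e) (fe' e) H t (x 1) (x 3)) 
    (g := fun x => (C^13 * √e) * M4 x) (intM4.const_mul _) ?_
  · rw [Real.norm_eq_abs, integral_const_mul] at h
    exact h.trans_eq (by ring)
  · refine ae_restrict_of_forall_mem measurableSet_simplex4 fun x hx => ?_
    obtain ⟨h0, h01, h12, h23, h3⟩ := hx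
    have g1 := B.gE_le ht (sub_fe he) (x 0) (x 2)
    have g2 := B.gE_le ht (sub_fe he) (x 1) (x 3)
    have e1 := B.err_le ht he (x 0) (x 2)
    have e2 := B.err_le ht he (x 1) (x 3)
    have s1 : Wt (x 2 - x 0) * Wt (x 2 - x 0) ≤ _ := Wt_star (a := x 1 - x 0) (b := x 2 - x 0) (c := x 3 - x 0)
      (by linarith) (by linarith) (by linarith) (by linarith) (by linarith) (Or.inl (by linarith))
    have s2 : Wt (x 3 - x 1) * Wt (x 3 - x 1) ≤ _ := Wt_star (a := x 2 - x 1) (b := x 3 - x 1) (c := x 1 - x 0)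
      (by linarith) (by linarith) (by linarith) (by linarith) (by linarith) (Or.inr (by linarith))
    rw [← Wt_neg (x 1 - x 0), neg_sub] at s2
    rw [Real.norm_eq_abs]
    refine (abs_add_le _ _).trans ?_
    rw [abs_mul, abs_mul]
    have sq := Real.sqrt_nonneg e
    calc _ ≤ (C^7 * (√e * (Wt (x 2 - x 0) * Wt (x 2 - x 0)))) * C^6 + C^6 * (C^7 * (√e * (Wt (x 3 - x 1) * Wt (x 3 - x 1)))) := by
          refine add_le_add (mul_le_mul e1 g2 (abs_nonneg _) ((abs_nonneg _).trans e1)) 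
            (mul_le_mul g1 e2 (abs_nonneg _) ((abs_nonneg _).trans g1))
      _ = (C^13 * √e) * (Wt (x 2 - x 0) * Wt (x 2 - x 0) + Wt (x 3 - x 1) * Wt (x 3 - x 1)) := by ring
      _ ≤ _ := by
          unfold M4
          refine mul_le_mul_of_nonneg_left (add_le_add s1 s2) (by positivity)

lemma E2_bound (B : Bd H C) (ht : t ∈ Icc (0:ℝ) 1) {e : ℝ} (he : 0 < e) :
    |∫ x in simplex3, (E2E (fe e) (fe' e) H t (x 0) (x 1) (x 2) + E2E (fe e) (fe' e) H t (x 1) (x 2) (x 0) +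
          E2E (fe e) (fe' e) H t (x 2) (x 0) (x 1))| ≤ 
      ((768 * (4 * C^4)^4)^2 * (40 * (4*C^4)^3) * ∫ x in simplex3, M3 x) * √e := by
  have hC := B.pos
  have h := norm_integral_le_of_norm_le (μ := volume.restrict simplex3) 
    (f := fun x => E2E (fe e) (fe' e) H t (x 0) (x 1) (x 2) + E2E (fe e) (fe' e) H t (x 1) (x 2) (x 0) +
          E2E (fe e) (fe' e) H t (x 2) (x 0) (x 1)) 
    (g := fun x => ((768 * (4 * C^4)^4)^2 * (40 * (4*C^4)^3) * √e) * M3 x) (intM3.const_mul _) ?_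
  · rw [Real.norm_eq_abs, integral_const_mul] at h
    exact h.trans_eq (by ring)
  · refine ae_restrict_of_forall_mem measurableSet_simplex3 fun x hx => ?_
    obtain ⟨h0, h01, h12, h3⟩ := hx
    have e1 := B.E2_le ht he (x 0) (x 1) (x 2) (sd_ne h01 (by linarith)) (sd_ne (by linarith) (by linarith))
    have e2 := B.E2_le ht he (x 1) (x 2) (x 0) (sd_ne h12 (by linarith)) (sd_ne' (by linarith) (by linarith))
    have e3 := B.E2_le ht he (x 2) (x 0) (x 1) (sd_ne' (by linarith) (by linarith)) (sd_ne' (by linarith) (by linarith))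
    rw [Real.norm_eq_abs]
    refine (abs_add_le _ _).trans ?_
    refine (add_le_add ((abs_add_le _ _).trans (add_le_add e1 e2)) e3).trans_eq ?_
    unfold M3 Wt
    ring

lemma E3_bound (B : Bd H C) (ht : t ∈ Icc (0:ℝ) 1) {e : ℝ} (he : 0 < e) (he2 : e * (2 * C) ≤ 1) {K0 : ℝ} 
    (hK0 : ∀ x, |deriv Real.smoothTransition x| ≤ K0) :
    |∫ z in dom (2/e), 2 * cc' e (dot3 z.2 z.2) * dot3 z.2 (VE (fe e) H t (z.1 0) (z.1 1) (z.1 2) z.2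
         + VE (fe e) H t (z.1 1) (z.1 2) (z.1 0) z.2 + VE (fe e) H t (z.1 2) (z.1 0) (z.1 1) z.2)| ≤ 
      (6144 * K0 * C^4 * (volume.real simplex3 * volume.real (Metric.ball (0:E3) 1))) * √e := by
  have hC := B.pos
  have k0 : 0 ≤ K0 := (abs_nonneg _).trans (hK0 0)
  have he1 : e ≤ 1 := by nlinarith [B.one]
  have fin : volume (dom (2/e)) < ⊤ := by
    unfold dom
    rw [Measure.volume_eq_prod, Measure.prod_prod]
    refine ENNReal.mul_lt_top ((measure_mono simplex3_subset).trans_lt ?_) measure_closedBall_lt_top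
    exact isCompact_Icc.measure_lt_top
  have h := norm_setIntegral_le_of_norm_le_const (μ := volume) 
    (f := fun z : (Fin 3 → ℝ) × E3 => 2 * cc' e (dot3 z.2 z.2) * dot3 z.2 (VE (fe e) H t (z.1 0) (z.1 1) (z.1 2) z.2
         + VE (fe e) H t (z.1 1) (z.1 2) (z.1 0) z.2 + VE (fe e) H t (z.1 2) (z.1 0) (z.1 1) z.2)) 
     (C := 768 * K0 * C^4 * e^7) fin ?_
  · rw [Real.norm_eq_abs] at h
    refine h.trans ?_
    have e1 : volume.real (dom (2/e)) = (8 * (volume.real simplex3 * volume.real (Metric.ball (0:E3) 1))) * (e^3)⁻¹ := by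
      unfold dom
      rw [Measure.volume_eq_prod, measureReal_prod_prod, Measure.addHaar_real_closedBall _ _ (by positivity)]
      simp
      field_simp
      norm_num
      ring
    rw [e1]
    have e4 : e^4 ≤ √e := by
      rw [Real.le_sqrt (by positivity) he.le, ← pow_mul]
      calc e^(4*2) ≤ e^1 := pow_le_pow_of_le_one he.le he1 (by norm_num)
        _ = e := pow_one e
    have nn : 0 ≤ volume.real simplex3 * volume.real (Metric.ball (0:E3) 1) := by positivity
    calc _ = (6144 * K0 * C^4 * (volume.real simplex3 * volume.real (Metric.ball (0:E3) 1))) * e^4 := by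
          field_simp; ring
      _ ≤ _ := by gcongr
  · intro z hz
    have hy : ‖z.2‖ ≤ 2/e := by simpa using hz.2
    rw [Real.norm_eq_abs, dot3_self]
    by_cases hf : 1 ≤ e * ‖z.2‖
    · have v1 := B.V_far ht (sub_fe he) (z.1 0) (z.1 1) (z.1 2) he he2 hf
      have v2 := B.V_far ht (sub_fe he) (z.1 1) (z.1 2) (z.1 0) he he2 hf
      have v3 := B.V_far ht (sub_fe he) (z.1 2) (z.1 0) (z.1 1) he he2 hf
      have vv := (norm_add_le _ _).trans (add_le_add ((norm_add_le _ _).trans (add_le_add v1 v2)) v3)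
      have hc : |cc' e (‖z.2‖^2)| ≤ K0 * e^2 := by
        unfold cc'
        rw [abs_mul, abs_neg, abs_of_nonneg (sq_nonneg e)]
        gcongr; exact hK0 _
      rw [abs_mul, abs_mul, abs_two]
      calc _ ≤ 2 * (K0 * e^2) * ((2/e) * (64 * C^4*e^6 + 64 * C^4*e^6 + 64 * C^4*e^6)) := by
            refine mul_le_mul (by gcongr) ((abs_dot3_le _ _).trans (by gcongr)) (abs_nonneg _) (by positivity)
        _ = _ := by field_simp; ring
    · have : cc' e (‖z.2‖^2) = 0 := by
        unfold cc'
        rw [dsT_zero_pos, zero_mul]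
        push Not at hf
        have : (e * ‖z.2‖)^2 < 1 := by
          rw [sq_lt_one_iff₀ (by positivity)]; exact hf
        nlinarith
      rw [this]; simp; positivity

noncomputable def ZZ (H : ℝ → ℝ → E3) (e t : ℝ) : ℝ := I2E (fe e) H t + ZA (fe e) (cc e) (2/e) H t

theorem Z_bound (F : KFam H) (B : Bd H C) : ∃ M, ∀ e, 0 < e → e * (2 * C) ≤ 1 → ∀ t ∈ Icc (0:ℝ) 1, ∃ Z',
    HasDerivAt (ZZ H e) Z' t ∧ |Z'| ≤ M * √e := by
  obtain ⟨K0, hK0⟩ := dsT_bound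
  refine ⟨(C^13 * ∫ x in simplex4, M4 x) + ((768 * (4 * C^4)^4)^2 * (40 * (4*C^4)^3) * ∫ x in simplex3, M3 x) + 
    (6144 * K0 * C^4 * (volume.real simplex3 * volume.real (Metric.ball (0:E3) 1))), fun e he he2 t ht => ?_⟩
  have hρ : ∀ x w, rhoK (fe e) (fe' e) w ≠ 0 → H t x + w ∈ Metric.closedBall 0 (2/e) ∧ 
      cc e (dot3 (H t x + w) (H t x + w)) = 1 := by
    intro x w hw
    have h1 := rho_supp he hw
    have h2 := B.nH t ht x
    have h3 := norm_add_le (H t x) w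
    have hC1 := B.one
    have he1 : 2 * e ≤ 1 := by nlinarith
    have h4 : e * ‖H t x + w‖ ≤ 1 := by nlinarith
    constructor
    · simp only [mem_closedBall_zero_iff]
      rw [le_div_iff₀ he]; linarith
    · rw [dot3_self]
      refine Real.smoothTransition.one_of_one_le ?_
      have : (e * ‖H t x + w‖)^2 ≤ 1 := pow_le_one₀ (by positivity) h4
      nlinarith
  refine ⟨_, hasDerivAt_Z (profe he) F (cutE he) t hρ, ?_⟩
  have b1 := E1_bound B ht he
  have b2 := E2_bound B ht he
  have b3 := E3_bound B ht he he2 hK0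
  refine (abs_sub _ _).trans ?_
  refine (add_le_add ((abs_add_le _ _).trans (add_le_add b1 b2)) b3).trans_eq ?_
  ring
end

end

section

open MeasureTheory Set Filter

/-! ### The limit of the regularisation -/

lemma ev_GK (v : E3) : ∀ᶠ e in 𝓝[>] (0:ℝ), GK (fe e) v = GK fS v := by
  by_cases hv : v = 0
  · subst hv; simp [GK]
  · have hp : 0 < ‖v‖ := norm_pos_iff.2 hv
    filter_upwards [Ioo_mem_nhdsGT hp] with e he
    rw [GK, GK, dot3_self, fe_eq_fS he.1 he.2]

section
variable {H : ℝ → ℝ → E3} {C : ℝ} {t : ℝ}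

lemma ev_gE (x y : ℝ) : ∀ᶠ e in 𝓝[>] (0:ℝ), gE (fe e) H t x y = gE fS H t x y := by
  filter_upwards [ev_GK (H t y - H t x)] with e he
  rw [gE, gE, he]

lemma ev_DE (u v w : ℝ) (y : E3) : ∀ᶠ e in 𝓝[>] (0:ℝ), DE (fe e) H t u v w y = DE fS H t u v w y := by
  filter_upwards [ev_GK (y - H t u), ev_GK (y - H t v), ev_GK (y - H t w)] with e h1 h2 h3
  simp only [DE, bE, h1, h2, h3]

lemma ev_cc (s : ℝ) : ∀ᶠ e in 𝓝[>] (0:ℝ), cc e s = 1 := by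
  have : Tendsto (fun e : ℝ => 2 - e^2 * s) (𝓝[>] 0) (𝓝 2) := by
    have : Continuous (fun e : ℝ => 2 - e^2 * s) := by fun_prop
    simpa using (this.tendsto 0).mono_left nhdsWithin_le_nhds
  filter_upwards [this.eventually (lt_mem_nhds (by norm_num : (1:ℝ) < 2))] with e he
  exact Real.smoothTransition.one_of_one_le (le_of_lt he)

lemma measurable_DE (F : KFam H) {φ : ℝ → ℝ} (hφ : Measurable φ) : 
    Measurable (fun z : (Fin 3 → ℝ) × E3 => DE φ H t (z.1 0) (z.1 1) (z.1 2) z.2) := by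
  have e : (fun z : (Fin 3 → ℝ) × E3 => DE φ H t (z.1 0) (z.1 1) (z.1 2) z.2) = fun z =>
    φ (‖z.2 - H t (z.1 0)‖^2) * φ (‖z.2 - H t (z.1 1)‖^2) * φ (‖z.2 - H t (z.1 2)‖^2) * 
      det3 (cross3 (z.2 - H t (z.1 0)) (pX H t (z.1 0))) (cross3 (z.2 - H t (z.1 1)) (pX H t (z.1 1)))
        (cross3 (z.2 - H t (z.1 2)) (pX H t (z.1 2))) := by
    funext z
    rw [DE, bE_smul, bE_smul, bE_smul, det3_smul3]
  rw [e]
  have c1 : Continuous (H t) := (F.knot t).smooth.continuous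
  have c2 : Continuous (pX H t) := (F.knot t).smooth.continuous_deriv (by norm_num)
  have n : ∀ i : Fin 3, Measurable (fun z : (Fin 3 → ℝ) × E3 => φ (‖z.2 - H t (z.1 i)‖^2)) := by
    intro i
    refine hφ.comp (Continuous.measurable ?_)
    fun_prop
  refine (((n 0).mul (n 1)).mul (n 2)).mul (Continuous.measurable ?_)
  fun_prop

noncomputable def SD (H : ℝ → ℝ → E3) (t : ℝ) (z : (Fin 3 → ℝ) × E3) : ℝ :=
  St H t (z.1 0) (z.1 1) (z.1 2) z.2 + St H t (z.1 1) (z.1 2) (z.1 0) z.2 + St H t (z.1 2) (z.1 0) (z.1 1) z.2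

lemma int_SD (F : KFam H) : IntegrableOn (SD H t) (simplex3 ×ˢ univ) := by
  have c1 : Continuous (H t) := (F.knot t).smooth.continuous
  exact ((star_integrable_St c1 0 1 2 (by decide) (by decide) (by decide)).add 
    (star_integrable_St c1 1 2 0 (by decide) (by decide) (by decide))).add 
    (star_integrable_St c1 2 0 1 (by decide) (by decide) (by decide))

lemma measurable_fS : Measurable fS := by unfold fS; fun_prop

lemma int_DE (F : KFam H) (B : Bd H C) (ht : t ∈ Icc (0:ℝ) 1) {φ : ℝ → ℝ} (hφ : Measurable φ) (hs : SubK φ) :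
    IntegrableOn (fun z : (Fin 3 → ℝ) × E3 => DE φ H t (z.1 0) (z.1 1) (z.1 2) z.2) (simplex3 ×ˢ univ) := by
  refine Integrable.mono' ((int_SD F (t := t)).const_mul (576 * C^11)) (measurable_DE F hφ).aestronglyMeasurable ?_
  refine Eventually.of_forall fun z => ?_
  exact B.D_le ht hs _ _ _ _

lemma measurable_gE (F : KFam H) {φ : ℝ → ℝ} (hφ : Measurable φ) {n : ℕ} (i j : Fin n) : 
    Measurable (fun x : Fin n → ℝ => gE φ H t (x i) (x j)) := by
  simp only [gE_eq]
  have c1 : Continuous (H t) := (F.knot t).smooth.continuous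
  have c2 : Continuous (pX H t) := (F.knot t).smooth.continuous_deriv (by norm_num)
  refine (hφ.comp (Continuous.measurable ?_)).mul (Continuous.measurable ?_)
  · fun_prop
  · fun_prop

lemma fin_S4 : IntegrableOn (fun _ : Fin 4 → ℝ => C) simplex4 :=
  intS4 continuous_const

lemma int_gg (F : KFam H) (B : Bd H C) (ht : t ∈ Icc (0:ℝ) 1) {φ : ℝ → ℝ} (hφ : Measurable φ) (hs : SubK φ) :
    IntegrableOn (fun x : Fin 4 → ℝ => gE φ H t (x 0) (x 2) * gE φ H t (x 1) (x 3)) simplex4 := by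
  refine Integrable.mono' (fin_S4 (C := C^6 * C^6)) ((measurable_gE F hφ 0 2).mul (measurable_gE F hφ 1 3)).aestronglyMeasurable ?_
  refine Eventually.of_forall fun z => ?_
  rw [Real.norm_eq_abs, abs_mul]
  have := B.pos
  exact mul_le_mul (B.gE_le ht hs _ _) (B.gE_le ht hs _ _) (abs_nonneg _) (by positivity)

/-- limit functional -/
noncomputable def LL (H : ℝ → ℝ → E3) (t : ℝ) : ℝ := I2E fS H t + 
  ∫ z in simplex3 ×ˢ univ, DE fS H t (z.1 0) (z.1 1) (z.1 2) z.2

lemma ZA_eq {e : ℝ} (he : 0 < e) : ZA (fe e) (cc e) (2/e) H t = 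
    ∫ z in simplex3 ×ˢ univ, cc e (dot3 z.2 z.2) * DE (fe e) H t (z.1 0) (z.1 1) (z.1 2) z.2 := by
  unfold ZA
  symm
  refine setIntegral_eq_of_subset_of_forall_sdiff_eq_zero (measurableSet_simplex3.prod MeasurableSet.univ) ?_ ?_
  · exact prod_mono le_rfl (subset_univ _)
  · intro z hz
    have : z.2 ∉ Metric.closedBall (0:E3) (2/e) := fun h => hz.2 ⟨hz.1.1, h⟩
    simp only [mem_closedBall_zero_iff, not_le] at this
    rw [(cutE he).z, zero_mul]
    rw [dot3_self]
    have : 0 < 2/e := by positivity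
    gcongr

theorem tendsto_ZZ (F : KFam H) (B : Bd H C) (ht : t ∈ Icc (0:ℝ) 1) :
    Tendsto (fun e => ZZ H e t) (𝓝[>] 0) (𝓝 (LL H t)) := by
  unfold ZZ LL
  have hC := B.pos
  have pos : ∀ᶠ e in 𝓝[>] (0:ℝ), 0 < e := self_mem_nhdsWithin
  refine Tendsto.add ?_ ?_
  · unfold I2E
    refine tendsto_integral_filter_of_dominated_convergence (fun _ => C^6 * C^6) ?_ ?_ fin_S4 ?_
    · filter_upwards [pos] with e he
      exact ((measurable_gE F (profe he).cφ.measurable 0 2).mul (measurable_gE F (profe he).cφ.measurable 1 3)).aestronglyMeasurable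
    · filter_upwards [pos] with e he
      refine Eventually.of_forall fun z => ?_
      rw [Real.norm_eq_abs, abs_mul]
      exact mul_le_mul (B.gE_le ht (sub_fe he) _ _) (B.gE_le ht (sub_fe he) _ _) (abs_nonneg _) (by positivity)
    · refine Eventually.of_forall fun x => ?_
      refine tendsto_const_nhds.congr' ?_
      filter_upwards [ev_gE (H := H) (t := t) (x 0) (x 2), ev_gE (H := H) (t := t) (x 1) (x 3)] with e h1 h2
      rw [h1, h2]
  · have : Tendsto (fun e => ∫ z in simplex3 ×ˢ univ, cc e (dot3 z.2 z.2) * DE (fe e) H t (z.1 0) (z.1 1) (z.1 2) z.2)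
       (𝓝[>] 0) (𝓝 (∫ z in simplex3 ×ˢ univ, DE fS H t (z.1 0) (z.1 1) (z.1 2) z.2)) := by
      refine tendsto_integral_filter_of_dominated_convergence (fun z => 576 * C^11 * SD H t z) ?_ ?_ 
        ((int_SD F).const_mul _) ?_
      · filter_upwards [pos] with e he
        refine Measurable.aestronglyMeasurable (Measurable.mul ?_ (measurable_DE F (profe he).cφ.measurable))
        refine (cutE he).prof.cφ.measurable.comp (Continuous.measurable ?_)
        fun_prop
      · filter_upwards [pos] with e he
        refine Eventually.of_forall fun z => ?_
        have d := B.D_le ht (sub_fe he) (z.1 0) (z.1 1) (z.1 2) z.2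
        have c : |cc e (dot3 z.2 z.2)| ≤ 1 := by
          rw [cc, abs_of_nonneg (Real.smoothTransition.nonneg _)]
          exact Real.smoothTransition.le_one _
        rw [Real.norm_eq_abs, abs_mul]
        calc _ ≤ 1 * |DE (fe e) H t (z.1 0) (z.1 1) (z.1 2) z.2| := by gcongr
          _ ≤ _ := by rw [one_mul]; exact d
      · refine Eventually.of_forall fun z => ?_
        refine tendsto_const_nhds.congr' ?_
        filter_upwards [ev_DE (H := H) (t := t) (z.1 0) (z.1 1) (z.1 2) z.2, ev_cc (dot3 z.2 z.2)] with e h1 h2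
        rw [h1, h2, one_mul]
    refine this.congr' ?_
    filter_upwards [pos] with e he
    rw [ZA_eq he]

theorem LL_const (F : KFam H) : LL H 0 = LL H 1 := by
  obtain ⟨C, B⟩ := exists_Bd F
  obtain ⟨M, hM⟩ := Z_bound F B
  have hC := B.pos
  have t0 := tendsto_ZZ F B (t := 0) (by simp)
  have t1 := tendsto_ZZ F B (t := 1) (by simp)
  have d := t1.sub t0
  have z : Tendsto (fun e => ZZ H e 1 - ZZ H e 0) (𝓝[>] 0) (𝓝 0) := by
    have s : Tendsto (fun e : ℝ => M * √e) (𝓝[>] 0) (𝓝 0) := by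
      have : Continuous (fun e : ℝ => M * √e) := by fun_prop
      simpa using (this.tendsto 0).mono_left nhdsWithin_le_nhds
    refine squeeze_zero_norm' ?_ s
    have hp : 0 < 1 / (2 * C) := by positivity
    filter_upwards [Ioo_mem_nhdsGT hp] with e he
    have he2 : e * (2 * C) ≤ 1 := by
      have := he.2.le
      rwa [le_div_iff₀ (by positivity)] at this
    choose! Z' h1 h2 using hM e he.1 he2
    have := (convex_Icc (0:ℝ) 1).norm_image_sub_le_of_norm_hasDerivWithin_le (f := ZZ H e) (f' := Z') (C := M * √e)
      (fun x hx => (h1 x hx).hasDerivWithinAt) (fun x hx => h2 x hx) (x := 0) (y := 1) (by simp) (by simp)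
    simpa using this
  have := tendsto_nhds_unique d z
  linarith
end

end

section

open MeasureTheory Set Filter

/-! ### The algebra of the wedge product -/

lemma perm_step {n : ℕ} (F : Equiv.Perm (Fin (n+1)) → ℝ) :
    (∑ σ : Equiv.Perm (Fin (n+1)), ((Equiv.Perm.sign σ : ℤ) : ℝ) * F σ) =
    ∑ p : Fin (n+1), (if p = 0 then (1:ℝ) else -1) * 
      ∑ τ : Equiv.Perm (Fin n), ((Equiv.Perm.sign τ : ℤ) : ℝ) * F (Equiv.Perm.decomposeFin.symm (p, τ)) := by
  rw [← Equiv.sum_comp Equiv.Perm.decomposeFin.symm, Fintype.sum_prod_type]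
  refine Finset.sum_congr rfl fun p _ => ?_
  rw [Finset.mul_sum]
  refine Finset.sum_congr rfl fun τ _ => ?_
  rw [Equiv.Perm.decomposeFin.symm_sign]
  by_cases h : p = 0 <;> simp [h]

lemma step6 (G : Fin 6 → Fin 6 → Fin 6 → Fin 6 → Fin 6 → Fin 6 → ℝ) :
    (∑ σ : Equiv.Perm (Fin 6), ((Equiv.Perm.sign σ : ℤ) : ℝ) *
      G (σ 0) (σ 1) (σ 2) (σ 3) (σ 4) (σ 5)) =
    ∑ p : Fin 6, (if p = 0 then (1:ℝ) else -1) *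
      ∑ τ : Equiv.Perm (Fin 5), ((Equiv.Perm.sign τ : ℤ) : ℝ) *
        G p (Equiv.swap 0 p (τ 0).succ) (Equiv.swap 0 p (τ 1).succ) (Equiv.swap 0 p (τ 2).succ)
          (Equiv.swap 0 p (τ 3).succ) (Equiv.swap 0 p (τ 4).succ) := by
  rw [perm_step (F := fun σ => G (σ 0) (σ 1) (σ 2) (σ 3) (σ 4) (σ 5))]
  refine Finset.sum_congr rfl fun p _ => ?_
  congr 1
  refine Finset.sum_congr rfl fun τ _ => ?_
  have h0 := Equiv.Perm.decomposeFin_symm_apply_zero p τ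
  have h : ∀ k : Fin 5, _ := fun k => Equiv.Perm.decomposeFin_symm_apply_succ τ p k
  congr 1
  exact congr (congr (congr (congr (congr (congrArg G h0) (h 0)) (h 1)) (h 2)) (h 3)) (h 4)

lemma step5 (G : Fin 5 → Fin 5 → Fin 5 → Fin 5 → Fin 5 → ℝ) :
    (∑ σ : Equiv.Perm (Fin 5), ((Equiv.Perm.sign σ : ℤ) : ℝ) *
      G (σ 0) (σ 1) (σ 2) (σ 3) (σ 4)) =
    ∑ p : Fin 5, (if p = 0 then (1:ℝ) else -1) *
      ∑ τ : Equiv.Perm (Fin 4), ((Equiv.Perm.sign τ : ℤ) : ℝ) *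
        G p (Equiv.swap 0 p (τ 0).succ) (Equiv.swap 0 p (τ 1).succ) (Equiv.swap 0 p (τ 2).succ)
          (Equiv.swap 0 p (τ 3).succ) := by
  rw [perm_step (F := fun σ => G (σ 0) (σ 1) (σ 2) (σ 3) (σ 4))]
  refine Finset.sum_congr rfl fun p _ => ?_
  congr 1
  refine Finset.sum_congr rfl fun τ _ => ?_
  have h0 := Equiv.Perm.decomposeFin_symm_apply_zero p τ
  have h : ∀ k : Fin 4, _ := fun k => Equiv.Perm.decomposeFin_symm_apply_succ τ p k
  congr 1
  exact congr (congr (congr (congr (congrArg G h0) (h 0)) (h 1)) (h 2)) (h 3)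

lemma step4 (G : Fin 4 → Fin 4 → Fin 4 → Fin 4 → ℝ) :
    (∑ σ : Equiv.Perm (Fin 4), ((Equiv.Perm.sign σ : ℤ) : ℝ) *
      G (σ 0) (σ 1) (σ 2) (σ 3)) =
    ∑ p : Fin 4, (if p = 0 then (1:ℝ) else -1) *
      ∑ τ : Equiv.Perm (Fin 3), ((Equiv.Perm.sign τ : ℤ) : ℝ) *
        G p (Equiv.swap 0 p (τ 0).succ) (Equiv.swap 0 p (τ 1).succ)
          (Equiv.swap 0 p (τ 2).succ) := by
  rw [perm_step (F := fun σ => G (σ 0) (σ 1) (σ 2) (σ 3))]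
  refine Finset.sum_congr rfl fun p _ => ?_
  congr 1
  refine Finset.sum_congr rfl fun τ _ => ?_
  have h0 := Equiv.Perm.decomposeFin_symm_apply_zero p τ
  have h : ∀ k : Fin 3, _ := fun k => Equiv.Perm.decomposeFin_symm_apply_succ τ p k
  congr 1
  exact congr (congr (congr (congrArg G h0) (h 0)) (h 1)) (h 2)

lemma step3 (G : Fin 3 → Fin 3 → Fin 3 → ℝ) :
    (∑ σ : Equiv.Perm (Fin 3), ((Equiv.Perm.sign σ : ℤ) : ℝ) * G (σ 0) (σ 1) (σ 2)) =
    G 0 1 2 - G 0 2 1 - G 1 0 2 + G 1 2 0 - G 2 1 0 + G 2 0 1 := by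
  have s2 : ∀ G : Fin 2 → Fin 2 → ℝ,
      (∑ σ : Equiv.Perm (Fin 2), ((Equiv.Perm.sign σ : ℤ) : ℝ) * G (σ 0) (σ 1)) =
        G 0 1 - G 1 0 := by
    intro G
    have : (Finset.univ : Finset (Equiv.Perm (Fin 2))) = {1, Equiv.swap 0 1} := by decide
    rw [this, Finset.sum_insert (by decide), Finset.sum_singleton]
    simp [sub_eq_add_neg]
  rw [perm_step (F := fun σ => G (σ 0) (σ 1) (σ 2))]
  have : ∀ p : Fin 3, (∑ τ : Equiv.Perm (Fin 2), ((Equiv.Perm.sign τ : ℤ) : ℝ) *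
      (fun σ : Equiv.Perm (Fin 3) => G (σ 0) (σ 1) (σ 2))
        (Equiv.Perm.decomposeFin.symm (p, τ))) =
      G p (Equiv.swap 0 p 1) (Equiv.swap 0 p 2) - G p (Equiv.swap 0 p 2) (Equiv.swap 0 p 1) := by
    intro p
    have e := s2 (fun i j => G p (Equiv.swap 0 p i.succ) (Equiv.swap 0 p j.succ))
    refine Eq.trans ?_ e
    refine Finset.sum_congr rfl fun τ _ => ?_
    have h0 := Equiv.Perm.decomposeFin_symm_apply_zero p τ
    have h : ∀ k : Fin 2, _ := fun k => Equiv.Perm.decomposeFin_symm_apply_succ τ p k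
    congr 1
    exact congr (congr (congrArg G h0) (h 0)) (h 1)
  rw [Fin.sum_univ_three, this, this, this]
  have t1 : Equiv.swap (0 : Fin 3) 0 1 = 1 := by decide
  have t2 : Equiv.swap (0 : Fin 3) 0 2 = 2 := by decide
  have t3 : Equiv.swap (0 : Fin 3) 1 1 = 0 := by decide
  have t4 : Equiv.swap (0 : Fin 3) 1 2 = 2 := by decide
  have t5 : Equiv.swap (0 : Fin 3) 2 1 = 1 := by decide
  have t6 : Equiv.swap (0 : Fin 3) 2 2 = 0 := by decide
  have n1 : (1 : Fin 3) ≠ 0 := by decide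
  have n2 : (2 : Fin 3) ≠ 0 := by decide
  rw [t1, t2, t3, t4, t5, t6, if_pos rfl, if_neg n1, if_neg n2]
  ring

lemma perm_four (b c : Fin 4 → Fin 4 → ℝ) (hb : ∀ i j, b j i = - b i j)
    (hc : ∀ i j, c j i = - c i j) :
    (∑ τ : Equiv.Perm (Fin 4), ((Equiv.Perm.sign τ : ℤ) : ℝ) *
      (b (τ 0) (τ 1) * c (τ 2) (τ 3))) =
    4 * (b 0 1 * c 2 3 - b 0 2 * c 1 3 + b 0 3 * c 1 2 + b 1 2 * c 0 3 - b 1 3 * c 0 2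
      + b 2 3 * c 0 1) := by
  rw [step4 (G := fun i j k l => b i j * c k l)]
  have : ∀ p : Fin 4, _ := fun p => step3 (fun i j k => b p (Equiv.swap 0 p i.succ) *
    c (Equiv.swap 0 p j.succ) (Equiv.swap 0 p k.succ))
  simp only [this, Fin.sum_univ_four]
  have u0 : Fin.succ (0 : Fin 3) = 1 := rfl
  have u1 : Fin.succ (1 : Fin 3) = 2 := rfl
  have u2 : Fin.succ (2 : Fin 3) = 3 := rfl
  have t : (Equiv.swap (0 : Fin 4) 0 1 = 1 ∧ Equiv.swap (0 : Fin 4) 0 2 = 2 ∧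
    Equiv.swap (0 : Fin 4) 0 3 = 3) ∧ (Equiv.swap (0 : Fin 4) 1 1 = 0 ∧
    Equiv.swap (0 : Fin 4) 1 2 = 2 ∧ Equiv.swap (0 : Fin 4) 1 3 = 3) ∧
    (Equiv.swap (0 : Fin 4) 2 1 = 1 ∧ Equiv.swap (0 : Fin 4) 2 2 = 0 ∧
    Equiv.swap (0 : Fin 4) 2 3 = 3) ∧ (Equiv.swap (0 : Fin 4) 3 1 = 1 ∧
    Equiv.swap (0 : Fin 4) 3 2 = 2 ∧ Equiv.swap (0 : Fin 4) 3 3 = 0) := by decide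
  obtain ⟨⟨t1, t2, t3⟩, ⟨t4, t5, t6⟩, ⟨t7, t8, t9⟩, ⟨t10, t11, t12⟩⟩ := t
  have n1 : (1 : Fin 4) ≠ 0 := by decide
  have n2 : (2 : Fin 4) ≠ 0 := by decide
  have n3 : (3 : Fin 4) ≠ 0 := by decide
  rw [u0, u1, u2, t1, t2, t3, t4, t5, t6, t7, t8, t9, t10, t11, t12, if_pos trivial, if_neg n1,
    if_neg n2, if_neg n3]
  rw [hb 0 1, hb 0 2, hb 0 3, hb 1 2, hb 1 3, hb 2 3, hc 0 1, hc 0 2, hc 0 3, hc 1 2, hc 1 3,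
    hc 2 3]
  ring

/-- The value of the alternating sum over permutations of four letters. -/
def four (b c : Fin 4 → Fin 4 → ℝ) : ℝ :=
  4 * (b 0 1 * c 2 3 - b 0 2 * c 1 3 + b 0 3 * c 1 2 + b 1 2 * c 0 3 - b 1 3 * c 0 2
      + b 2 3 * c 0 1)

/-- The matrix of the pulled back two-form: `j` is the position of the arc parameter. -/
def formM (j : Fin 3) (g b : E3) : Fin 6 → Fin 6 → ℝ := fun p q =>
  if p.val < 3 then
    (if p.val = j.val then
      (if q = 3 then - b 0 else if q = 4 then - b 1 else if q = 5 then - b 2 else 0) else 0)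
  else if q.val < 3 then
    (if q.val = j.val then
      (if p = 3 then b 0 else if p = 4 then b 1 else if p = 5 then b 2 else 0) else 0)
  else if p = 3 ∧ q = 4 then g 2 else if p = 4 ∧ q = 3 then - g 2
  else if p = 3 ∧ q = 5 then - g 1 else if p = 5 ∧ q = 3 then g 1
  else if p = 4 ∧ q = 5 then g 0 else if p = 5 ∧ q = 4 then - g 0 else 0

lemma formM_symm (j : Fin 3) (g b : E3) (p q : Fin 6) : formM j g b q p = - formM j g b p q := by
  fin_cases j <;> fin_cases p <;> fin_cases q <;> simp [formM, Fin.ext_iff]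

lemma wedge_formM (g g' g'' b b' b'' : E3) :
    (∑ σ : Equiv.Perm (Fin 6), ((Equiv.Perm.sign σ : ℤ) : ℝ) *
      (formM 0 g b (σ 0) (σ 1) * formM 1 g' b' (σ 2) (σ 3) * formM 2 g'' b'' (σ 4) (σ 5))) / 8
      = det3 b b' b'' := by
  rw [step6 (G := fun i j k l m n => formM 0 g b i j * formM 1 g' b' k l * formM 2 g'' b'' m n)]
  set s : Fin 6 → Fin 5 → Fin 6 := fun p k => Equiv.swap 0 p k.succ with hs
  set u : Fin 5 → Fin 4 → Fin 5 := fun p k => Equiv.swap 0 p k.succ with hu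
  have e5 : ∀ p : Fin 6, _ := fun p => step5 (fun i j k l m => formM 0 g b p (s p i) *
    formM 1 g' b' (s p j) (s p k) * formM 2 g'' b'' (s p l) (s p m))
  have e4 : ∀ (p : Fin 6) (q : Fin 5), (∑ τ : Equiv.Perm (Fin 4),
      ((Equiv.Perm.sign τ : ℤ) : ℝ) * (formM 0 g b p (s p q) *
        formM 1 g' b' (s p (u q (τ 0))) (s p (u q (τ 1))) *
        formM 2 g'' b'' (s p (u q (τ 2))) (s p (u q (τ 3))))) = formM 0 g b p (s p q) *
          four (fun i j => formM 1 g' b' (s p (u q i)) (s p (u q j)))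
            (fun i j => formM 2 g'' b'' (s p (u q i)) (s p (u q j))) := by
    intro p q
    rw [four, ← perm_four (fun i j => formM 1 g' b' (s p (u q i)) (s p (u q j)))
      (fun i j => formM 2 g'' b'' (s p (u q i)) (s p (u q j)))
      (fun _ _ => formM_symm _ _ _ _ _) (fun _ _ => formM_symm _ _ _ _ _), Finset.mul_sum]
    refine Finset.sum_congr rfl fun τ _ => ?_
    ring
  have e6 : ∀ p : Fin 6, _ := fun p => (e5 p).trans (Finset.sum_congr rfl fun q _ =>
    congrArg _ (e4 p q))
  rw [Finset.sum_congr rfl fun p _ => congrArg _ (e6 p)]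
  have z1 : ∀ q, formM 0 g b 1 q = 0 := fun q => by simp [formM]
  have z2 : ∀ q, formM 0 g b 2 q = 0 := fun q => by simp [formM]
  rw [Fin.sum_univ_six]
  simp only [Fin.sum_univ_five, z1, z2, zero_mul, mul_zero, add_zero]
  have uu : ∀ p k, u p k = if k.succ = p then 0 else k.succ := by decide
  have ss : ∀ p k, s p k = if k.succ = p then 0 else k.succ := by decide
  simp only [ss, uu, four]
  simp [formM, Fin.ext_iff]
  simp only [det3]
  ring

end

section

open MeasureTheory Set Filter

/-! ### The integrand of `A` -/

lemma unit_deriv (w : E3) (hw : w ≠ 0) :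
    ∃ c : E3 →L[ℝ] ℝ, HasFDerivAt (fun w : E3 => ‖w‖⁻¹ • w)
      (‖w‖⁻¹ • ContinuousLinearMap.id ℝ E3 + c.smulRight w) w := by
  have h1 : DifferentiableAt ℝ (fun w : E3 => ‖w‖⁻¹) w :=
    ((contDiffAt_norm (n := 1) ℝ hw).differentiableAt (by simp)).inv (norm_ne_zero_iff.2 hw)
  exact ⟨_, h1.hasFDerivAt.smul (hasFDerivAt_id w)⟩

lemma sphereForm_unit (w a b : E3) (hw : w ≠ 0) (s s' : ℝ) :
    sphereForm (‖w‖⁻¹ • w) (‖w‖⁻¹ • a + s • w) (‖w‖⁻¹ • b + s' • w) = det3 (GK fS w) a b := by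
  have hp : 0 < ‖w‖ := norm_pos_iff.2 hw
  rw [sphereForm, GK, dot3_self, fS_sq hp]
  simp only [det3, PiLp.add_apply, PiLp.smul_apply, smul_eq_mul]
  have hpi := Real.pi_ne_zero
  field_simp
  ring

lemma arc_deriv {K : ℝ → E3} (hK : IsKnot K) (z : (Fin 3 → ℝ) × E3) (j : Fin 3) :
    HasFDerivAt (fun z : (Fin 3 → ℝ) × E3 => z.2 - K (z.1 j))
      (ContinuousLinearMap.snd ℝ (Fin 3 → ℝ) E3 -
        (((ContinuousLinearMap.proj j : (Fin 3 → ℝ) →L[ℝ] ℝ).comp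
          (ContinuousLinearMap.fst ℝ (Fin 3 → ℝ) E3)).smulRight (deriv K (z.1 j)))) z := by
  have h1 : HasDerivAt K (deriv K (z.1 j)) (z.1 j) :=
    (hK.smooth.differentiable (by simp) _).hasDerivAt
  have h2 : HasFDerivAt (fun z : (Fin 3 → ℝ) × E3 => z.1 j)
      ((ContinuousLinearMap.proj j : (Fin 3 → ℝ) →L[ℝ] ℝ).comp
          (ContinuousLinearMap.fst ℝ (Fin 3 → ℝ) E3)) z :=
    ((ContinuousLinearMap.proj j : (Fin 3 → ℝ) →L[ℝ] ℝ).comp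
          (ContinuousLinearMap.fst ℝ (Fin 3 → ℝ) E3)).hasFDerivAt
  have h3 : HasFDerivAt (fun z : (Fin 3 → ℝ) × E3 => K (z.1 j)) _ z :=
    HasFDerivAt.comp z h1.hasFDerivAt h2
  refine (hasFDerivAt_snd.sub h3).congr_fderiv ?_
  ext v <;> simp

lemma comp_deriv {K : ℝ → E3} (hK : IsKnot K) (z : (Fin 3 → ℝ) × E3) (j : Fin 3)
    (hz : z.2 - K (z.1 j) ≠ 0) :
    ∃ L : (Fin 3 → ℝ) × E3 →L[ℝ] E3, HasFDerivAt (fun z : (Fin 3 → ℝ) × E3 =>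
        ‖z.2 - K (z.1 j)‖⁻¹ • (z.2 - K (z.1 j))) L z ∧
      ∀ v w, sphereForm (‖z.2 - K (z.1 j)‖⁻¹ • (z.2 - K (z.1 j))) (L v) (L w) =
        det3 (GK fS (z.2 - K (z.1 j))) (v.2 - v.1 j • deriv K (z.1 j))
          (w.2 - w.1 j • deriv K (z.1 j)) := by
  obtain ⟨c, hc⟩ := unit_deriv _ hz
  have h := HasFDerivAt.comp (g := fun w : E3 => ‖w‖⁻¹ • w) z hc (arc_deriv hK z j)
  refine ⟨_, h, fun v w => ?_⟩
  exact sphereForm_unit _ (v.2 - v.1 j • deriv K (z.1 j)) (w.2 - w.1 j • deriv K (z.1 j)) hz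
    (c (v.2 - v.1 j • deriv K (z.1 j))) (c (w.2 - w.1 j • deriv K (z.1 j)))

lemma form_basis (j : Fin 3) (g X : E3) (p q : Fin 6) :
    det3 g ((stdBasis6 p).2 - (stdBasis6 p).1 j • X) ((stdBasis6 q).2 - (stdBasis6 q).1 j • X) =
      formM j g (cross3 g X) p q := by
  fin_cases j <;> fin_cases p <;> fin_cases q <;>
    simp [formM, Fin.ext_iff, stdBasis6, det3, Pi.single_apply] <;> ring

lemma AIntegrand_eq {K : ℝ → E3} (hK : IsKnot K) {z : (Fin 3 → ℝ) × E3} (hz : z ∈ ADomain K)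
    (t : ℝ) : AIntegrand K z = DE fS (fun _ => K) t (z.1 0) (z.1 1) (z.1 2) z.2 := by
  obtain ⟨-, h0, h1, h2⟩ := hz
  obtain ⟨L0, d0, f0⟩ := comp_deriv hK z 0 (sub_ne_zero.2 h0)
  obtain ⟨L1, d1, f1⟩ := comp_deriv hK z 1 (sub_ne_zero.2 h1)
  obtain ⟨L2, d2, f2⟩ := comp_deriv hK z 2 (sub_ne_zero.2 h2)
  have hd : HasFDerivAt (tripodMap K) (L0.prod (L1.prod L2)) z :=
    d0.prodMk (d1.prodMk d2)
  rw [AIntegrand, hd.fderiv, wedge3]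
  simp only [tripodMap, ContinuousLinearMap.prod_apply, f0, f1, f2, form_basis]
  rw [wedge_formM]
  rfl

end

section

open MeasureTheory Set Filter

/-! ### Conclusion -/

lemma KFam_const {K : ℝ → E3} (hK : IsKnot K) : KFam (fun _ => K) :=
  ⟨hK.smooth.comp contDiff_snd, fun _ => hK⟩

lemma gauss_eq (K : ℝ → E3) (x y : ℝ) : gaussKernel K x y = gE fS (fun _ => K) 0 x y := by
  rw [gE_eq, gaussKernel]
  simp only [pX]
  rcases eq_or_ne (K y - K x) 0 with h | h
  · simp [h, det3]
  · rw [fS_sq (norm_pos_iff.2 h)]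
    ring

lemma I2Integrand_eq (K : ℝ → E3) : I₂Integrand K = fun x =>
    gE fS (fun _ => K) 0 (x 0) (x 2) * gE fS (fun _ => K) 0 (x 1) (x 3) := by
  funext x
  rw [I₂Integrand, gauss_eq, gauss_eq]

lemma ADomain_subset (K : ℝ → E3) : ADomain K ⊆ simplex3 ×ˢ univ := fun _ hz => ⟨hz.1, trivial⟩

lemma measurableSet_ADomain {K : ℝ → E3} (hK : IsKnot K) : MeasurableSet (ADomain K) := by
  have hc : Continuous K := hK.smooth.continuous
  have hn : ∀ j : Fin 3, MeasurableSet {z : (Fin 3 → ℝ) × E3 | z.2 ≠ K (z.1 j)} := fun j =>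
    (isOpen_ne_fun (by fun_prop) (by fun_prop)).measurableSet
  have : ADomain K = (simplex3 ×ˢ univ) ∩ ({z | z.2 ≠ K (z.1 0)} ∩
      ({z | z.2 ≠ K (z.1 1)} ∩ {z | z.2 ≠ K (z.1 2)})) := by
    ext z
    simp [ADomain, simplex3]
  rw [this]
  exact (measurableSet_simplex3.prod MeasurableSet.univ).inter ((hn 0).inter ((hn 1).inter (hn 2)))

lemma A_eq {K : ℝ → E3} (hK : IsKnot K) : A K = ∫ z in simplex3 ×ˢ (univ : Set E3),
    DE fS (fun _ => K) 0 (z.1 0) (z.1 1) (z.1 2) z.2 := by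
  rw [A, setIntegral_congr_fun (measurableSet_ADomain hK) fun z hz => AIntegrand_eq hK hz 0]
  refine Eq.symm (setIntegral_eq_of_subset_of_forall_sdiff_eq_zero
    (measurableSet_simplex3.prod MeasurableSet.univ) (ADomain_subset K) ?_)
  rintro z ⟨⟨h1, -⟩, h2⟩
  have h3 : ¬ (z.2 ≠ K (z.1 0) ∧ z.2 ≠ K (z.1 1) ∧ z.2 ≠ K (z.1 2)) := fun h => h2 ⟨h1, h⟩
  by_cases e0 : z.2 = K (z.1 0)
  · rw [e0]; exact DE_self (H := fun _ => K) (t := 0) _ _ _ _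
  by_cases e1 : z.2 = K (z.1 1)
  · rw [e1, DE_cyc]; exact DE_self (H := fun _ => K) (t := 0) _ _ _ _
  by_cases e2 : z.2 = K (z.1 2)
  · rw [e2, DE_cyc, DE_cyc]; exact DE_self (H := fun _ => K) (t := 0) _ _ _ _
  exact absurd ⟨e0, e1, e2⟩ h3

lemma LL_eq {K : ℝ → E3} (hK : IsKnot K) {H : ℝ → ℝ → E3} {t : ℝ} (h : H t = K) :
    LL H t = I₂ K + A K := by
  rw [A_eq hK, I₂, I2Integrand_eq, LL, I2E]
  simp only [gE, DE, bE, pX, h]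

lemma invariance {K₀ K₁ : ℝ → E3} (h₀ : IsKnot K₀) (h₁ : IsKnot K₁) (h : KnotIsotopic K₀ K₁) :
    I₂ K₀ + A K₀ = I₂ K₁ + A K₁ := by
  obtain ⟨H, hs, hk, e0, e1⟩ := h
  have F : KFam (fun t => H (Real.smoothTransition t)) := by
    refine ⟨?_, fun t => hk _ ⟨Real.smoothTransition.nonneg t, Real.smoothTransition.le_one t⟩⟩
    have h2 : ContDiff ℝ (⊤ : ℕ∞) (fun p : ℝ × ℝ => (Real.smoothTransition p.1, p.2)) :=
      (Real.smoothTransition.contDiff.comp contDiff_fst).prodMk contDiff_snd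
    exact hs.comp h2
  have := LL_const F
  rwa [LL_eq h₀ (by simp [e0]), LL_eq h₁ (by simp [e1])] at this

lemma integrable_both {K : ℝ → E3} (hK : IsKnot K) :
    IntegrableOn (I₂Integrand K) simplex4 ∧ IntegrableOn (AIntegrand K) (ADomain K) := by
  have F := KFam_const hK
  obtain ⟨C, B⟩ := exists_Bd F
  have h0 : (0:ℝ) ∈ Icc (0:ℝ) 1 := by simp
  refine ⟨?_, ?_⟩
  · rw [I2Integrand_eq]
    exact int_gg F B h0 measurable_fS sub_fS
  · refine ((int_DE F B h0 measurable_fS sub_fS).mono_set (ADomain_subset K)).congr_fun ?_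
      (measurableSet_ADomain hK)
    exact fun z hz => (AIntegrand_eq hK hz 0).symm

end

/-- **The Bott–Taubes degree-2 invariant** (Bott–Taubes, Theorem 1.3; Theorem 3.6 of the
paper): for every knot `K` both configuration space integrals converge absolutely, and
there is a sign `ε ∈ {±1}`, independent of the knot, such that `K ↦ I₂(K) + ε·A(K)`
is a knot invariant. -/
theorem bott_taubes_degree_two :
    (∀ K : ℝ → E3, IsKnot K →
      MeasureTheory.IntegrableOn (I₂Integrand K) simplex4 ∧
      MeasureTheory.IntegrableOn (AIntegrand K) (ADomain K)) ∧
    ∃ ε : ℝ, (ε = 1 ∨ ε = -1) ∧ IsKnotInvariant (fun K => I₂ K + ε * A K) := by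
  refine ⟨fun K hK => integrable_both hK, 1, Or.inl rfl, fun K₀ K₁ h₀ h₁ h => ?_⟩
  simpa using invariance h₀ h₁ h
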